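/- Fix integers k1 ≥ 2, k2 ≥ 2, set k := min{k1,k2}, and fix reals ε > 0 and C1 > max{k1,k2} + ε. For positive integers N, M with (max{k1,k2}+ε)·N ≤ M ≤ C1·N, let z_1, z_2 > 0 be the unique roots of z_j·f_{k_j−1}(z_j)/f_{k_j}(z_j) = M/N for j = 1,2, and for j = 1,2 set m_j := z_j·f_{k_j−1}(z_j)/f_{k_j}(z_j) (= M/N), v_j := z_j²·f_{k_j−2}(z_j)/f_{k_j}(z_j) + m_j − m_j², and e_j := z_j·f_{k_j−2}(z_j)/f_{k_j−1}(z_j). Let C_{k1,k2}(N,M) denote the number of k-strongly connected (k1,k2)-dicores on vertex set {1,…,N} with M edges. Then there is a constant C > 0 such that for all such N ≥ 2emsp;and M: | C_{k1,k2}(N,M) / ( exp(−M/N − (1/2)e_1e_2) · M! · ∏_{j=1}^{2} f_{k_j}(z_j)^N / (z_j^M · √(2πN·v_j)) ) − 1 | ≤ C·N^{-1}·(log N)^6. -/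

import Mathlib

/-- `fk k x = ∑_{j ≥ k} x^j / j!`, the tail of the exponential series. -/
noncomputable def fk (k : ℕ) (x : ℝ) : ℝ := ∑' n : ℕ, x ^ (n + k) / (n + k).factorial

/-- Mean of a Poisson(z) random variable conditioned to be `≥ k`. -/
noncomputable def mPoi (k : ℕ) (z : ℝ) : ℝ := z * fk (k - 1) z / fk k z

/-- Variance of a Poisson(z) random variable conditioned to be `≥ k`. -/
noncomputable def vPoi (k : ℕ) (z : ℝ) : ℝ :=
  z ^ 2 * fk (k - 2) z / fk k z + mPoi k z - (mPoi k z) ^ 2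

/-- Mean of a Poisson(z) random variable conditioned to be `≥ k - 1`. -/
noncomputable def ePoi (k : ℕ) (z : ℝ) : ℝ := z * fk (k - 2) z / fk (k - 1) z

/-- A `(k1,k2)`-dicore on vertex set `Fin N` with `M` edges: a simple digraph
(edges are ordered pairs of distinct vertices; a `Finset` has no repeated edges)
with exactly `M` edges, minimum in-degree `≥ k1` and minimum out-degree `≥ k2`. -/
def IsDicore (k1 k2 N M : ℕ) (E : Finset (Fin N × Fin N)) : Prop :=
  E.card = M ∧ (∀ e ∈ E, e.1 ≠ e.2) ∧
    ∀ v : Fin N,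
      k1 ≤ (E.filter (fun e => e.2 = v)).card ∧
      k2 ≤ (E.filter (fun e => e.1 = v)).card

/-- A digraph on `N` vertices is `k`-strongly connected if `N > k` and, for every
set `T` of fewer than `k` vertices, every ordered pair of remaining vertices is
joined by a directed path avoiding `T`. -/
def KStronglyConnected {N : ℕ} (k : ℕ) (E : Finset (Fin N × Fin N)) : Prop :=
  k < N ∧ ∀ T : Finset (Fin N), T.card < k →
    ∀ u v : Fin N, u ∉ T → v ∉ T →
      Relation.ReflTransGen (fun a b => a ∉ T ∧ b ∉ T ∧ (a, b) ∈ E) u v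

set_option linter.unusedSectionVars false

namespace DicoreCount

open Finset

lemma hasSum_of_eq {α : Type*} [AddCommMonoid α] [TopologicalSpace α] {f g : ℕ → α} {a : α}
    (h : HasSum f a) (e : ∀ j, g j = f j) : HasSum g a := by
  rwa [funext e]

/-- The term `z ^ j / j!` of the exponential series, truncated to `j ≥ k`. -/
noncomputable def expTerm (k : ℕ) (z : ℝ) (j : ℕ) : ℝ :=
  if k ≤ j then z ^ j / j.factorial else 0

/-- The probability that a Poisson(`z`) variable conditioned to be `≥ k` equals `j`. -/
noncomputable def poiProb (k : ℕ) (z : ℝ) (j : ℕ) : ℝ := expTerm k z j / fk k z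

lemma summable_fk (k : ℕ) (x : ℝ) :
    Summable fun n : ℕ => x ^ (n + k) / ((n + k).factorial : ℝ) :=
  (summable_nat_add_iff (f := fun n : ℕ => x ^ n / (n.factorial : ℝ)) k).2
    (Real.summable_pow_div_factorial x)

lemma hasSum_expTerm (k : ℕ) (z : ℝ) : HasSum (expTerm k z) (fk k z) := by
  have h : HasSum (fun n => expTerm k z (n + k)) (fk k z) := by
    have := (summable_fk k z).hasSum
    simpa [expTerm, fk] using this
  have h2 := (hasSum_nat_add_iff (f := expTerm k z) k).1 h
  have h3 : ∑ i ∈ range k, expTerm k z i = 0 := by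
    refine sum_eq_zero fun i hi => ?_
    have : ¬ k ≤ i := by simpa using hi
    simp [expTerm, this]
  simpa [h3] using h2

lemma fk_eq_add (k : ℕ) (z : ℝ) : fk k z = z ^ k / k.factorial + fk (k + 1) z := by
  have h := (summable_fk k z).tsum_eq_zero_add
  unfold fk
  rw [h]
  simp only [zero_add]
  congr 2
  ext n
  rw [add_right_comm, add_assoc]

lemma fk_nonneg (k : ℕ) {z : ℝ} (hz : 0 ≤ z) : 0 ≤ fk k z :=
  tsum_nonneg fun n => by positivity

lemma pow_div_le_fk (k : ℕ) {z : ℝ} (hz : 0 ≤ z) : z ^ k / k.factorial ≤ fk k z := by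
  rw [fk_eq_add]; linarith [fk_nonneg (k + 1) hz]

lemma fk_pos (k : ℕ) {z : ℝ} (hz : 0 < z) : 0 < fk k z :=
  lt_of_lt_of_le (by positivity) (pow_div_le_fk k hz.le)

lemma fk_le_exp (k : ℕ) {z : ℝ} (hz : 0 ≤ z) : fk k z ≤ Real.exp z := by
  have h := hasSum_expTerm k z
  have h2 : HasSum (fun n : ℕ => z ^ n / (n.factorial : ℝ)) (Real.exp z) := by
    rw [Real.exp_eq_exp_ℝ]; exact NormedSpace.expSeries_div_hasSum_exp z
  refine hasSum_le (fun n => ?_) h h2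
  unfold expTerm; split_ifs
  · exact le_rfl
  · positivity

lemma expTerm_nonneg (k : ℕ) {z : ℝ} (hz : 0 ≤ z) (j : ℕ) : 0 ≤ expTerm k z j := by
  unfold expTerm; split_ifs <;> positivity

lemma succ_mul_expTerm {k : ℕ} (hk : 1 ≤ k) (z : ℝ) (j : ℕ) :
    ((j + 1 : ℕ) : ℝ) * expTerm k z (j + 1) = z * expTerm (k - 1) z j := by
  unfold expTerm
  by_cases h : k ≤ j + 1
  · have h' : k - 1 ≤ j := by omega
    rw [if_pos h, if_pos h', Nat.factorial_succ, pow_succ]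
    have : (j.factorial : ℝ) ≠ 0 := by positivity
    push_cast
    field_simp
  · have h' : ¬ k - 1 ≤ j := by omega
    rw [if_neg h, if_neg h']; simp

lemma hasSum_mul_expTerm {k : ℕ} (hk : 1 ≤ k) (z : ℝ) :
    HasSum (fun j : ℕ => (j : ℝ) * expTerm k z j) (z * fk (k - 1) z) := by
  rw [← hasSum_nat_add_iff' 1]
  simp only [range_one, sum_singleton, Nat.cast_zero, zero_mul, sub_zero, succ_mul_expTerm hk]
  exact (hasSum_expTerm (k - 1) z).mul_left z

lemma hasSum_mul_pred_mul_expTerm {k : ℕ} (hk : 2 ≤ k) (z : ℝ) :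
    HasSum (fun j : ℕ => (j : ℝ) * (j - 1) * expTerm k z j) (z ^ 2 * fk (k - 2) z) := by
  rw [← hasSum_nat_add_iff' 1]
  simp only [range_one, sum_singleton, Nat.cast_zero, zero_mul, sub_zero]
  have h := (hasSum_mul_expTerm (k := k - 1) (by omega) z).mul_left z
  rw [show k - 1 - 1 = k - 2 by omega, ← mul_assoc, ← sq] at h
  refine hasSum_of_eq h fun j => ?_
  have := succ_mul_expTerm (show 1 ≤ k by omega) z j
  push_cast at this ⊢
  linear_combination (j : ℝ) * this

section poiProb

variable {k : ℕ} {z : ℝ}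

lemma poiProb_nonneg (hz : 0 ≤ z) (j : ℕ) : 0 ≤ poiProb k z j :=
  div_nonneg (expTerm_nonneg k hz j) (fk_nonneg k hz)

lemma hasSum_poiProb (hz : 0 < z) : HasSum (poiProb k z) 1 := by
  have := (hasSum_expTerm k z).div_const (fk k z)
  rwa [div_self (fk_pos k hz).ne'] at this

lemma hasSum_mul_poiProb (hk : 1 ≤ k) :
    HasSum (fun j : ℕ => (j : ℝ) * poiProb k z j) (mPoi k z) := by
  have := (hasSum_mul_expTerm hk z).div_const (fk k z)
  simpa [poiProb, mPoi, mul_div_assoc] using this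

lemma hasSum_mul_pred_mul_poiProb (hk : 2 ≤ k) :
    HasSum (fun j : ℕ => (j : ℝ) * (j - 1) * poiProb k z j) (z ^ 2 * fk (k - 2) z / fk k z) := by
  have := (hasSum_mul_pred_mul_expTerm hk z).div_const (fk k z)
  simpa [poiProb, mul_div_assoc] using this

lemma hasSum_sub_mul_poiProb (hk : 1 ≤ k) (hz : 0 < z) :
    HasSum (fun j : ℕ => ((j : ℝ) - mPoi k z) * poiProb k z j) 0 := by
  have := (hasSum_mul_poiProb (z := z) hk).sub ((hasSum_poiProb (k := k) hz).mul_left (mPoi k z))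
  simpa [sub_mul] using this

lemma hasSum_sq_mul_poiProb (hk : 2 ≤ k) (hz : 0 < z) :
    HasSum (fun j : ℕ => ((j : ℝ) - mPoi k z) ^ 2 * poiProb k z j) (vPoi k z) := by
  have h := ((hasSum_mul_pred_mul_poiProb (z := z) hk).add
    ((hasSum_mul_poiProb (z := z) (k := k) (by omega)).mul_left (1 - 2 * mPoi k z))).add
    ((hasSum_poiProb (k := k) hz).mul_left (mPoi k z ^ 2))
  convert h using 1
  · ext j; ring
  · unfold vPoi; ring

lemma poiProb_self (k : ℕ) (z : ℝ) : poiProb k z k = z ^ k / k.factorial / fk k z := by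
  simp [poiProb, expTerm]

lemma poiProb_succ (k : ℕ) (z : ℝ) :
    poiProb k z (k + 1) = z ^ (k + 1) / (k + 1).factorial / fk k z := by
  simp [poiProb, expTerm]

lemma poiProb_eq_zero {j : ℕ} (h : j < k) : poiProb k z j = 0 := by
  simp [poiProb, expTerm, not_le.2 h]

lemma poiProb_le_one (hz : 0 < z) (j : ℕ) : poiProb k z j ≤ 1 :=
  le_hasSum (hasSum_poiProb hz) j fun i _ => poiProb_nonneg hz.le i

/-- A dominating sequence for `poiProb k z`, uniform for `z` in a compact interval. -/
noncomputable def poiDom (k : ℕ) (zlo zhi : ℝ) (j : ℕ) : ℝ :=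
  k.factorial / zlo ^ k * (zhi ^ j / j.factorial)

lemma poiProb_le_poiDom {zlo zhi : ℝ} (hlo : 0 < zlo) (h1 : zlo ≤ z) (h2 : z ≤ zhi) (j : ℕ) :
    poiProb k z j ≤ poiDom k zlo zhi j := by
  have hz : 0 < z := hlo.trans_le h1
  unfold poiProb poiDom
  have hf : zlo ^ k / k.factorial ≤ fk k z :=
    le_trans (by gcongr) (pow_div_le_fk k hz.le)
  have he : expTerm k z j ≤ zhi ^ j / j.factorial := by
    have : z ^ j / (j.factorial : ℝ) ≤ zhi ^ j / j.factorial := by gcongr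
    unfold expTerm; split_ifs
    · exact this
    · exact le_trans (by positivity) this
  calc expTerm k z j / fk k z ≤ (zhi ^ j / j.factorial) / (zlo ^ k / k.factorial) := by
        have : 0 ≤ zhi := hz.le.trans h2
        gcongr
    _ = _ := by
        have : (k.factorial : ℝ) ≠ 0 := by positivity
        have : (j.factorial : ℝ) ≠ 0 := by positivity
        have : zlo ≠ 0 := hlo.ne'
        field_simp

lemma poiDom_nonneg {zlo zhi : ℝ} (hlo : 0 < zlo) (hhi : 0 ≤ zhi) (j : ℕ) :
    0 ≤ poiDom k zlo zhi j := by unfold poiDom; positivity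

lemma summable_exp_mul_poiDom (k : ℕ) (zlo zhi : ℝ) :
    Summable fun j : ℕ => Real.exp j * poiDom k zlo zhi j := by
  have h := (Real.summable_pow_div_factorial (Real.exp 1 * zhi)).mul_left
    (k.factorial / zlo ^ k : ℝ)
  refine (summable_congr fun j => ?_).2 h
  rw [mul_pow, ← Real.exp_nat_mul, mul_one, poiDom]
  ring

lemma summable_pow_mul_poiDom (k : ℕ) {zlo zhi : ℝ} (hlo : 0 < zlo) (hhi : 0 ≤ zhi) (r : ℕ) :
    Summable fun j : ℕ => (1 + (j : ℝ)) ^ r * poiDom k zlo zhi j := by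
  refine Summable.of_nonneg_of_le (fun j => ?_) (fun j => ?_)
    ((summable_exp_mul_poiDom k zlo zhi).mul_left (r.factorial * Real.exp 1))
  · have := poiDom_nonneg (k := k) hlo hhi j
    positivity
  · have h0 := poiDom_nonneg (k := k) hlo hhi j
    rw [← mul_assoc]
    refine mul_le_mul_of_nonneg_right ?_ h0
    have := Real.pow_div_factorial_le_exp (1 + (j : ℝ)) (by positivity) r
    rw [div_le_iff₀ (by positivity), Real.exp_add] at this
    linarith

lemma mPoi_pos (hz : 0 < z) : 0 < mPoi k z :=
  div_pos (mul_pos hz (fk_pos _ hz)) (fk_pos _ hz)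

lemma fk_anti {a b : ℕ} (hab : a ≤ b) (hz : 0 ≤ z) : fk b z ≤ fk a z := by
  refine hasSum_le (fun n => ?_) (hasSum_expTerm b z) (hasSum_expTerm a z)
  unfold expTerm
  by_cases h : b ≤ n
  · rw [if_pos h, if_pos (hab.trans h)]
  · rw [if_neg h]; split_ifs <;> positivity

lemma le_mPoi (hz : 0 < z) : z ≤ mPoi k z := by
  unfold mPoi
  rw [le_div_iff₀ (fk_pos k hz)]
  exact mul_le_mul_of_nonneg_left (fk_anti (by omega) hz.le) hz.le

lemma mPoi_sub_le (hk : 1 ≤ k) (hz : 0 < z) : mPoi k z - k ≤ z := by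
  have hf := fk_pos k hz
  have h1 := fk_eq_add (k - 1) z
  have h2 := pow_div_le_fk k hz.le
  rw [Nat.sub_add_cancel hk] at h1
  have h3 : z * (z ^ (k - 1) / ((k - 1).factorial : ℝ)) = k * (z ^ k / k.factorial) := by
    obtain ⟨m, rfl⟩ : ∃ m, k = m + 1 := ⟨k - 1, by omega⟩
    rw [Nat.factorial_succ]
    have : (m.factorial : ℝ) ≠ 0 := by positivity
    rw [pow_succ']
    push_cast
    field_simp
  have : mPoi k z - k = (z * fk (k - 1) z - k * fk k z) / fk k z := by
    unfold mPoi; field_simp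
  rw [this, div_le_iff₀ hf, h1, mul_add, h3]
  nlinarith [mul_le_mul_of_nonneg_left h2 (Nat.cast_nonneg (α := ℝ) k)]

end poiProb

end DicoreCount

namespace DicoreCount

open Finset MeasureTheory
open scoped Real

/-- The `n`-fold convolution power of a sequence `p`, evaluated at `m`. -/
noncomputable def convPow (p : ℕ → ℝ) : ℕ → ℕ → ℝ
  | 0, m => if m = 0 then 1 else 0
  | n + 1, m => ∑ j ∈ range (m + 1), p j * convPow p n (m - j)

/-- The characteristic function of a sequence `p`. -/
noncomputable def charFn (p : ℕ → ℝ) (θ : ℝ) : ℂ :=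
  ∑' j : ℕ, (p j : ℂ) * Complex.exp (Complex.I * θ) ^ j

section convPow

variable {p : ℕ → ℝ}

lemma convPow_nonneg (hp : ∀ j, 0 ≤ p j) (n m : ℕ) : 0 ≤ convPow p n m := by
  induction n generalizing m with
  | zero => unfold convPow; split_ifs <;> norm_num
  | succ n ih => exact sum_nonneg fun j _ => mul_nonneg (hp j) (ih _)

lemma norm_exp_I_mul (θ : ℝ) : ‖Complex.exp (Complex.I * θ)‖ = 1 := by
  rw [mul_comm]; exact Complex.norm_exp_ofReal_mul_I θ

lemma summable_norm_charFn (hp : ∀ j, 0 ≤ p j) (hs : Summable p) (θ : ℝ) :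
    Summable fun j : ℕ => ‖(p j : ℂ) * Complex.exp (Complex.I * θ) ^ j‖ := by
  refine hs.congr fun j => ?_
  rw [norm_mul, norm_pow, norm_exp_I_mul, one_pow, mul_one, Complex.norm_real, Real.norm_eq_abs,
    abs_of_nonneg (hp j)]

lemma summable_hasSum_convPow (hp : ∀ j, 0 ≤ p j) (hs : Summable p) (n : ℕ) :
    Summable (convPow p n) ∧ ∀ θ : ℝ,
      HasSum (fun m : ℕ => (convPow p n m : ℂ) * Complex.exp (Complex.I * θ) ^ m)
        (charFn p θ ^ n) := by
  induction n with
  | zero =>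
    have h0 : ∀ m ∉ ({0} : Finset ℕ), convPow p 0 m = 0 := fun m hm => by
      simp only [mem_singleton] at hm; simp [convPow, hm]
    refine ⟨summable_of_ne_finset_zero h0, fun θ => ?_⟩
    have : HasSum (fun m : ℕ => (convPow p 0 m : ℂ) * Complex.exp (Complex.I * θ) ^ m)
        (∑ m ∈ {0}, (convPow p 0 m : ℂ) * Complex.exp (Complex.I * θ) ^ m) :=
      hasSum_sum_of_ne_finset_zero fun m hm => by rw [h0 m hm]; simp
    simpa [convPow] using this
  | succ n ih =>
    constructor
    · have := summable_norm_sum_mul_range_of_summable_norm (f := p) (g := convPow p n)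
        hs.norm ih.1.norm
      exact this.of_norm
    · intro θ
      have h := hasSum_sum_range_mul_of_summable_norm (summable_norm_charFn hp hs θ)
        (summable_norm_charFn (convPow_nonneg hp n) ih.1 θ)
      rw [(ih.2 θ).tsum_eq] at h
      rw [pow_succ']
      refine hasSum_of_eq h fun m => ?_
      simp only [convPow]
      push_cast
      rw [sum_mul]
      refine sum_congr rfl fun j hj => ?_
      have hj' : j + (m - j) = m := Nat.add_sub_of_le (by simpa [Nat.lt_succ_iff] using hj)
      nth_rw 2 [← hj']
      rw [pow_add]; ring

lemma integral_exp_pow_mul (l m : ℕ) :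
    ∫ θ in (-π)..π, Complex.exp (Complex.I * θ) ^ l * Complex.exp (-(Complex.I * (m * θ))) =
      if l = m then 2 * (π : ℂ) else 0 := by
  have h : ∀ θ : ℝ, Complex.exp (Complex.I * θ) ^ l * Complex.exp (-(Complex.I * (m * θ))) =
      Complex.exp ((Complex.I * ((l : ℂ) - m)) * θ) := fun θ => by
    rw [← Complex.exp_nat_mul, ← Complex.exp_add]; congr 1; ring
  simp_rw [h]
  split_ifs with hlm
  · subst hlm; simp; ring
  · have hc : Complex.I * ((l : ℂ) - m) ≠ 0 :=
      mul_ne_zero Complex.I_ne_zero (sub_ne_zero.2 (by exact_mod_cast hlm))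
    rw [integral_exp_mul_complex hc, div_eq_zero_iff]
    left
    rw [sub_eq_zero, Complex.exp_eq_exp_iff_exists_int]
    refine ⟨(l : ℤ) - m, ?_⟩
    push_cast; ring

lemma two_pi_mul_convPow (hp : ∀ j, 0 ≤ p j) (hs : Summable p) (n m : ℕ) :
    2 * (π : ℂ) * convPow p n m =
      ∫ θ in (-π)..π, charFn p θ ^ n * Complex.exp (-(Complex.I * (m * θ))) := by
  obtain ⟨h1, h2⟩ := summable_hasSum_convPow hp hs n
  have key : HasSum (fun l : ℕ => ∫ θ in (-π)..π, (convPow p n l : ℂ) *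
      Complex.exp (Complex.I * θ) ^ l * Complex.exp (-(Complex.I * (m * θ))))
      (∫ θ in (-π)..π, charFn p θ ^ n * Complex.exp (-(Complex.I * (m * θ)))) := by
    refine intervalIntegral.hasSum_integral_of_dominated_convergence
      (fun l _ => convPow p n l) (fun l => ?_) (fun l => ?_) ?_ ?_ ?_
    · exact Continuous.aestronglyMeasurable (by fun_prop)
    · refine Filter.Eventually.of_forall fun θ _ => ?_
      have : ‖Complex.exp (-(Complex.I * (m * θ)))‖ = 1 := by
        rw [show -(Complex.I * (m * θ)) = ((-(m * θ) : ℝ) : ℂ) * Complex.I by push_cast; ring]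
        exact Complex.norm_exp_ofReal_mul_I _
      rw [norm_mul, this, norm_mul, norm_pow, norm_exp_I_mul, one_pow, mul_one, mul_one,
        Complex.norm_real, Real.norm_eq_abs, abs_of_nonneg (convPow_nonneg hp n l)]
    · exact Filter.Eventually.of_forall fun θ _ => h1
    · exact intervalIntegrable_const
    · exact Filter.Eventually.of_forall fun θ _ => (h2 θ).mul_right _
  rw [← key.tsum_eq]
  have h3 : ∀ l : ℕ, ∫ θ in (-π)..π, (convPow p n l : ℂ) *
      Complex.exp (Complex.I * θ) ^ l * Complex.exp (-(Complex.I * (m * θ))) =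
      if l = m then 2 * (π : ℂ) * convPow p n m else 0 := fun l => by
    simp_rw [mul_assoc]
    rw [intervalIntegral.integral_const_mul, integral_exp_pow_mul]
    split_ifs with h
    · subst h; ring
    · simp
  simp_rw [h3]
  rw [tsum_ite_eq]

lemma convPow_le_one (hp : ∀ j, 0 ≤ p j) (hs : HasSum p 1) (n m : ℕ) : convPow p n m ≤ 1 := by
  induction n generalizing m with
  | zero => unfold convPow; split_ifs <;> norm_num
  | succ n ih =>
    calc convPow p (n + 1) m ≤ ∑ j ∈ range (m + 1), p j * 1 :=
          sum_le_sum fun j _ => mul_le_mul_of_nonneg_left (ih _) (hp j)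
      _ ≤ 1 := by
          simp only [mul_one]
          exact sum_le_hasSum _ (fun j _ => hp j) hs

end convPow

end DicoreCount

namespace DicoreCount

open Finset MeasureTheory
open scoped Real

section charFn

variable {p : ℕ → ℝ}

lemma norm_add_mul_exp_le {P Q : ℝ} (hP : 0 ≤ P) (hQ : 0 ≤ Q) (hPQ : P + Q ≤ 1) (θ : ℝ) :
    ‖(P : ℂ) + Q * Complex.exp (Complex.I * θ)‖ ≤ P + Q - P * Q * (1 - Real.cos θ) := by
  have hc1 := Real.cos_le_one θ
  have hc2 := Real.neg_one_le_cos θ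
  have hre : ((P : ℂ) + Q * Complex.exp (Complex.I * θ)) =
      ⟨P + Q * Real.cos θ, Q * Real.sin θ⟩ := by
    rw [mul_comm Complex.I, Complex.exp_mul_I]
    apply Complex.ext <;> simp [Complex.cos_ofReal_re, Complex.sin_ofReal_re]
  have hPQ0 : 0 ≤ P * Q := mul_nonneg hP hQ
  have hB : 0 ≤ P + Q - P * Q * (1 - Real.cos θ) := by nlinarith [sq_nonneg (P - Q)]
  refine abs_le_of_sq_le_sq' ?_ hB |>.2
  rw [← Complex.normSq_eq_norm_sq, hre, Complex.normSq_mk]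
  have hsc := Real.sin_sq_add_cos_sq θ
  have hlhs : (P + Q * Real.cos θ) * (P + Q * Real.cos θ) + Q * Real.sin θ * (Q * Real.sin θ) =
      (P + Q) ^ 2 - 2 * (P * Q * (1 - Real.cos θ)) := by
    linear_combination Q ^ 2 * hsc
  rw [hlhs]
  have hb : 0 ≤ P * Q * (1 - Real.cos θ) := mul_nonneg hPQ0 (sub_nonneg.2 hc1)
  nlinarith [mul_nonneg hb (sub_nonneg.2 hPQ), sq_nonneg (P * Q * (1 - Real.cos θ))]

lemma norm_charFn_le (hp : ∀ j, 0 ≤ p j) (hs : HasSum p 1) (k : ℕ) {θ : ℝ} (hθ : |θ| ≤ π) :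
    ‖charFn p θ‖ ≤ Real.exp (-(2 / π ^ 2 * (p k * p (k + 1))) * θ ^ 2) := by
  set x := Complex.exp (Complex.I * θ) with hx
  have hxn : ‖x‖ = 1 := norm_exp_I_mul θ
  have hsn := summable_norm_charFn hp hs.summable θ
  have hne : k ∉ ({k + 1} : Finset ℕ) := by simp
  have hsplit := hsn.of_norm.sum_add_tsum_compl (s := {k, k + 1})
  have hsplit' := hs.summable.sum_add_tsum_compl (s := {k, k + 1})
  rw [sum_insert hne, sum_singleton] at hsplit hsplit'
  rw [hs.tsum_eq] at hsplit'
  have hnorm : ∀ j, ‖(p j : ℂ) * x ^ j‖ = p j := fun j => by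
    rw [norm_mul, norm_pow, hxn, one_pow, mul_one, Complex.norm_real, Real.norm_eq_abs,
      abs_of_nonneg (hp j)]
  have hrest : ‖∑' j : ↥((({k, k + 1} : Finset ℕ) : Set ℕ)ᶜ), (p j : ℂ) * x ^ (j : ℕ)‖ ≤
      1 - (p k + p (k + 1)) := by
    refine (norm_tsum_le_tsum_norm ?_).trans ?_
    · exact hsn.subtype _
    · simp_rw [hnorm]; linarith
  have hfirst : ‖(p k : ℂ) * x ^ k + p (k + 1) * x ^ (k + 1)‖ ≤
      p k + p (k + 1) - p k * p (k + 1) * (1 - Real.cos θ) := by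
    rw [show (p k : ℂ) * x ^ k + p (k + 1) * x ^ (k + 1) =
      x ^ k * ((p k : ℂ) + p (k + 1) * x) by ring, norm_mul, norm_pow, hxn, one_pow, one_mul]
    refine norm_add_mul_exp_le (hp _) (hp _) ?_ θ
    have : 0 ≤ ∑' j : ↥((({k, k + 1} : Finset ℕ) : Set ℕ)ᶜ), p j := tsum_nonneg fun j => hp j
    linarith
  have hcos := Real.cos_le_one_sub_mul_cos_sq hθ
  have hpp : 0 ≤ p k * p (k + 1) := mul_nonneg (hp _) (hp _)
  calc ‖charFn p θ‖ ≤ ‖(p k : ℂ) * x ^ k + p (k + 1) * x ^ (k + 1)‖ + _ := by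
        unfold charFn; rw [← hsplit]; exact norm_add_le _ _
    _ ≤ 1 + -(2 / π ^ 2 * (p k * p (k + 1))) * θ ^ 2 := by
        nlinarith [mul_le_mul_of_nonneg_left hcos hpp]
    _ ≤ _ := by rw [add_comm]; exact Real.add_one_le_exp _

lemma norm_exp_I_sub_taylor_le (y : ℝ) :
    ‖Complex.exp (Complex.I * y) - (1 + Complex.I * y - y ^ 2 / 2 - Complex.I * y ^ 3 / 6)‖ ≤
      4 * y ^ 4 := by
  have hI3 : Complex.I ^ 3 = -Complex.I := by rw [pow_succ, Complex.I_sq]; ring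
  have hn : ‖Complex.I * y‖ = |y| := by simp
  rcases le_or_gt |y| 1 with hy | hy
  · have h := Complex.exp_bound (x := Complex.I * y) (by rw [hn]; exact hy) (n := 4) (by norm_num)
    simp only [sum_range_succ, range_zero, sum_empty, hn] at h
    norm_num [Nat.factorial, mul_pow, hI3] at h
    refine le_trans (le_of_eq ?_) (h.trans ?_)
    · congr 1; ring
    · have : |y| ^ 4 = y ^ 4 := by rw [← abs_pow, abs_of_nonneg (by positivity)]
      rw [this]; nlinarith [show 0 ≤ y ^ 4 by positivity]
  · have e1 : ‖Complex.exp (Complex.I * y)‖ = 1 := norm_exp_I_mul y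
    have e2 : ‖(1 + Complex.I * y - y ^ 2 / 2 - Complex.I * y ^ 3 / 6 : ℂ)‖ ≤
        1 + |y| + |y| ^ 2 / 2 + |y| ^ 3 / 6 := by
      refine (norm_sub_le _ _).trans (add_le_add ((norm_sub_le _ _).trans
        (add_le_add ((norm_add_le _ _).trans ?_) ?_)) ?_) <;> simp
    refine (norm_sub_le _ _).trans ?_
    have h4 : |y| ^ 4 = y ^ 4 := by rw [← abs_pow, abs_of_nonneg (by positivity)]
    rw [e1, ← h4]
    have a2 : 1 ≤ |y| ^ 4 := one_le_pow₀ hy.le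
    have a3 : |y| ^ 1 ≤ |y| ^ 4 := pow_le_pow_right₀ hy.le (by norm_num)
    have a4 : |y| ^ 2 ≤ |y| ^ 4 := pow_le_pow_right₀ hy.le (by norm_num)
    have a5 : |y| ^ 3 ≤ |y| ^ 4 := pow_le_pow_right₀ hy.le (by norm_num)
    rw [pow_one] at a3
    linarith

lemma norm_exp_sub_one_sub_le {w : ℂ} (hw : w.re ≤ 0) : ‖Complex.exp w - 1 - w‖ ≤ 3 * ‖w‖ ^ 2 := by
  rcases le_or_gt ‖w‖ 1 with h | h
  · have := Complex.norm_exp_sub_one_sub_id_le h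
    nlinarith [sq_nonneg ‖w‖]
  · have : ‖Complex.exp w‖ ≤ 1 := by rw [Complex.norm_exp]; exact Real.exp_le_one_iff.2 hw
    have h1 := norm_sub_le (Complex.exp w - 1) w
    have h2 := norm_sub_le (Complex.exp w) 1
    rw [norm_one] at h2
    nlinarith

lemma norm_charFn_sub_le (hp : ∀ j, 0 ≤ p j) (hs : HasSum p 1) {c v g m4 : ℝ} (hv : 0 ≤ v)
    (h1 : HasSum (fun j : ℕ => ((j : ℝ) - c) * p j) 0)
    (h2 : HasSum (fun j : ℕ => ((j : ℝ) - c) ^ 2 * p j) v)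
    (h3 : HasSum (fun j : ℕ => ((j : ℝ) - c) ^ 3 * p j) g)
    (h4 : HasSum (fun j : ℕ => ((j : ℝ) - c) ^ 4 * p j) m4) {θ : ℝ} (hθ : |θ| ≤ π) :
    ‖charFn p θ * Complex.exp (-(Complex.I * (c * θ))) -
      Complex.exp (((-(v / 2) * θ ^ 2 : ℝ) : ℂ) - Complex.I * ((g / 6 * θ ^ 3 : ℝ) : ℂ))‖ ≤
      (4 * m4 + 3 * (v + |g|) ^ 2) * θ ^ 4 := by
  set w : ℂ := ((-(v / 2) * θ ^ 2 : ℝ) : ℂ) - Complex.I * ((g / 6 * θ ^ 3 : ℝ) : ℂ) with hw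
  have hsum := (summable_norm_charFn hp hs.summable θ).of_norm.hasSum
  have hpsi : HasSum (fun j : ℕ => (p j : ℂ) * Complex.exp (Complex.I * (((j : ℝ) - c) * θ : ℝ)))
      (charFn p θ * Complex.exp (-(Complex.I * (c * θ)))) := by
    refine hasSum_of_eq (hsum.mul_right _) fun j => ?_
    rw [mul_assoc, ← Complex.exp_nat_mul, ← Complex.exp_add]
    congr 2; push_cast; ring
  have o : ∀ {f : ℕ → ℝ} {a : ℝ}, HasSum f a → HasSum (fun j => (f j : ℂ)) (a : ℂ) :=
    fun h => Complex.hasSum_ofReal.2 h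
  have htay : HasSum (fun j : ℕ => (p j : ℂ) * (1 + Complex.I * (((j : ℝ) - c) * θ : ℝ) -
      ((((j : ℝ) - c) * θ : ℝ) : ℂ) ^ 2 / 2 -
      Complex.I * ((((j : ℝ) - c) * θ : ℝ) : ℂ) ^ 3 / 6)) (1 + w) := by
    have hh := (((o hs).add ((o h1).mul_left (Complex.I * θ))).sub
      ((o h2).mul_left ((θ : ℂ) ^ 2 / 2))).sub ((o h3).mul_left (Complex.I * θ ^ 3 / 6))
    have hval : (1 : ℂ) + w = ((1 : ℝ) : ℂ) + Complex.I * θ * ((0 : ℝ) : ℂ) -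
        (θ : ℂ) ^ 2 / 2 * (v : ℂ) - Complex.I * θ ^ 3 / 6 * (g : ℂ) := by
      rw [hw]; push_cast; ring
    rw [hval]
    refine hasSum_of_eq hh fun j => ?_
    push_cast; ring
  have hdiff := hpsi.sub htay
  have hb : ‖charFn p θ * Complex.exp (-(Complex.I * (c * θ))) - (1 + w)‖ ≤ 4 * m4 * θ ^ 4 := by
    have hg : HasSum (fun j : ℕ => 4 * θ ^ 4 * (((j : ℝ) - c) ^ 4 * p j)) (4 * m4 * θ ^ 4) := by
      have := h4.mul_left (4 * θ ^ 4)
      rwa [show 4 * θ ^ 4 * m4 = 4 * m4 * θ ^ 4 by ring] at this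
    rw [← hdiff.tsum_eq]
    refine tsum_of_norm_bounded hg fun j => ?_
    rw [← mul_sub, norm_mul, Complex.norm_real, Real.norm_eq_abs, abs_of_nonneg (hp j)]
    have := mul_le_mul_of_nonneg_left (norm_exp_I_sub_taylor_le (((j : ℝ) - c) * θ)) (hp j)
    refine this.trans (le_of_eq ?_)
    ring
  have hwre : w.re ≤ 0 := by
    have : w.re = -(v / 2) * θ ^ 2 := by simp [hw, -Complex.ofReal_mul, -Complex.ofReal_neg]
    rw [this]; nlinarith [sq_nonneg θ]
  have hwn : ‖w‖ ≤ (v + |g|) * θ ^ 2 := by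
    refine (norm_sub_le _ _).trans ?_
    rw [norm_mul, Complex.norm_I, one_mul, Complex.norm_real, Complex.norm_real, Real.norm_eq_abs,
      Real.norm_eq_abs, abs_mul, abs_mul, abs_neg, abs_of_nonneg (by positivity : 0 ≤ v / 2),
      abs_of_nonneg (by positivity : 0 ≤ θ ^ 2), abs_div, abs_of_pos (by norm_num : (0:ℝ) < 6),
      abs_pow]
    have e : |θ| ^ 3 ≤ 6 * θ ^ 2 := by
      rw [pow_succ, sq_abs]
      nlinarith [sq_nonneg θ, Real.pi_le_four]
    nlinarith [abs_nonneg g, mul_le_mul_of_nonneg_left e (abs_nonneg g), sq_nonneg θ,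
      mul_nonneg hv (sq_nonneg θ)]
  have hexp := norm_exp_sub_one_sub_le hwre
  have hsq : ‖w‖ ^ 2 ≤ (v + |g|) ^ 2 * θ ^ 4 := by
    calc ‖w‖ ^ 2 ≤ ((v + |g|) * θ ^ 2) ^ 2 := by gcongr
      _ = _ := by ring
  have htri : charFn p θ * Complex.exp (-(Complex.I * (c * θ))) - Complex.exp w =
      (charFn p θ * Complex.exp (-(Complex.I * (c * θ))) - (1 + w)) -
        (Complex.exp w - 1 - w) := by ring
  rw [htri]
  refine (norm_sub_le _ _).trans ?_
  nlinarith

end charFn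

end DicoreCount

namespace DicoreCount

open Finset MeasureTheory
open scoped Real

lemma norm_pow_sub_pow_le {R : Type*} [NormedCommRing R] [NormOneClass R] {x y : R} {r : ℝ}
    (hx : ‖x‖ ≤ r) (hy : ‖y‖ ≤ r) (n : ℕ) :
    ‖x ^ n - y ^ n‖ ≤ n * r ^ (n - 1) * ‖x - y‖ := by
  have hr : 0 ≤ r := (norm_nonneg _).trans hx
  rw [← (Commute.all x y).geom_sum₂_mul n]
  refine (norm_mul_le _ _).trans ?_
  gcongr
  refine (norm_sum_le _ _).trans ?_
  calc ∑ i ∈ range n, ‖x ^ i * y ^ (n - 1 - i)‖ ≤ ∑ _i ∈ range n, r ^ (n - 1) := by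
        refine sum_le_sum fun i hi => ?_
        have hi' : i + (n - 1 - i) = n - 1 := by have := mem_range.1 hi; omega
        calc ‖x ^ i * y ^ (n - 1 - i)‖ ≤ ‖x‖ ^ i * ‖y‖ ^ (n - 1 - i) :=
              (norm_mul_le _ _).trans (mul_le_mul (norm_pow_le _ _) (norm_pow_le _ _)
                (norm_nonneg _) (by positivity))
          _ ≤ r ^ i * r ^ (n - 1 - i) := by gcongr
          _ = _ := by rw [← pow_add, hi']
    _ = _ := by simp

lemma continuous_charFn {p : ℕ → ℝ} (hp : ∀ j, 0 ≤ p j) (hs : Summable p) :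
    Continuous (charFn p) := by
  unfold charFn
  refine continuous_tsum (u := p) (fun j => by fun_prop) hs fun j θ => le_of_eq ?_
  rw [norm_mul, norm_pow, norm_exp_I_mul, one_pow, mul_one, Complex.norm_real, Real.norm_eq_abs,
    abs_of_nonneg (hp j)]

lemma pow_mul_exp_neg_two_le {b t : ℝ} (hb : 0 < b) (ht : 0 ≤ t) (r : ℕ) :
    t ^ r * Real.exp (-(2 * b * t)) ≤ r.factorial / b ^ r * Real.exp (-(b * t)) := by
  have h := Real.pow_div_factorial_le_exp (b * t) (by positivity) r
  have hf : (0 : ℝ) < r.factorial := by positivity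
  rw [show -(2 * b * t) = -(b * t) + -(b * t) by ring, Real.exp_add, ← mul_assoc]
  refine mul_le_mul_of_nonneg_right ?_ (Real.exp_pos _).le
  rw [Real.exp_neg, ← div_eq_mul_inv, div_le_div_iff₀ (Real.exp_pos _) (by positivity)]
  rw [div_le_iff₀ hf, mul_pow] at h
  linarith

set_option maxHeartbeats 1000000 in
/-- Quantitative local limit theorem. -/
lemma abs_convPow_mul_sqrt_sub_one_le {p : ℕ → ℝ} (hp : ∀ j, 0 ≤ p j) (hs : HasSum p 1)
    {c v g m4 κ D : ℝ} {k : ℕ}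
    (h1 : HasSum (fun j : ℕ => ((j : ℝ) - c) * p j) 0)
    (h2 : HasSum (fun j : ℕ => ((j : ℝ) - c) ^ 2 * p j) v)
    (h3 : HasSum (fun j : ℕ => ((j : ℝ) - c) ^ 3 * p j) g)
    (h4 : HasSum (fun j : ℕ => ((j : ℝ) - c) ^ 4 * p j) m4)
    (hκ : 0 < κ) (hκp : κ ≤ 2 / π ^ 2 * (p k * p (k + 1))) (hκv : 2 * κ ≤ v)
    (hD : 4 * m4 + 3 * (v + |g|) ^ 2 ≤ D) (hgD : |g| ≤ D) {n : ℕ} (hn : 2 ≤ n) (m : ℕ) :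
    |convPow p n m * √(2 * π * n * v) - 1| ≤
      (32 * D / κ ^ 2 + 384 * D ^ 2 / κ ^ 3 + 4 * ((m : ℝ) - n * c) ^ 2 / κ + 1 / κ) / n *
        √(2 * v / κ) := by
  have hv : 0 < v := by linarith
  have hD0 : 0 ≤ D := (abs_nonneg g).trans hgD
  have hn0 : (0 : ℝ) < n := by positivity
  have hn2 : (2 : ℝ) ≤ n := by exact_mod_cast hn
  set a : ℝ := (m : ℝ) - n * c with ha
  set b : ℝ := κ * n / 4 with hb
  have hb0 : 0 < b := by positivity
  set R : ℝ := (32 * D / κ ^ 2 + 384 * D ^ 2 / κ ^ 3 + 4 * a ^ 2 / κ + 1 / κ) / n with hR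
  set F : ℝ → ℂ := fun θ => charFn p θ ^ n * Complex.exp (-(Complex.I * (m * θ))) with hF
  have hFc : Continuous F := by
    have := continuous_charFn hp hs.summable
    fun_prop
  have hRe : 2 * π * convPow p n m = ∫ θ in (-π)..π, (F θ).re := by
    have h := two_pi_mul_convPow hp hs.summable n m
    have h' := Complex.reCLM.intervalIntegral_comp_comm (hFc.intervalIntegrable (μ := volume) (-π) π)
    simp only [Complex.reCLM_apply] at h'
    rw [h', ← h]
    simp
  -- the estimate inside `[-π, π]`
  have hin : ∀ θ : ℝ, |θ| ≤ π →
      |(F θ).re - Real.exp (-(n * v / 2) * θ ^ 2)| ≤ R * Real.exp (-b * θ ^ 2) := by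
    intro θ hθ
    set ψ : ℂ := charFn p θ * Complex.exp (-(Complex.I * (c * θ))) with hψ
    set w : ℂ := ((-(v / 2) * θ ^ 2 : ℝ) : ℂ) - Complex.I * ((g / 6 * θ ^ 3 : ℝ) : ℂ) with hw
    set E : ℂ := Complex.exp (-(Complex.I * (a * θ))) with hE
    have hEn : ‖E‖ = 1 := by
      rw [hE, Complex.norm_exp]; simp
    have hFψ : F θ = ψ ^ n * E := by
      simp only [hF, hψ, hE, mul_pow, ← Complex.exp_nat_mul, mul_assoc, ← Complex.exp_add]
      congr 2
      simp only [ha]; push_cast; ring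
    have hψn : ‖ψ‖ ≤ Real.exp (-κ * θ ^ 2) := by
      rw [hψ, norm_mul, Complex.norm_exp]
      have := norm_charFn_le hp hs k hθ
      simp only [Complex.neg_re, Complex.mul_re, Complex.I_re, Complex.I_im, Complex.mul_im,
        Complex.ofReal_re, Complex.ofReal_im]
      norm_num
      refine this.trans (Real.exp_le_exp.2 ?_)
      nlinarith [sq_nonneg θ]
    have hwre : w.re = -(v / 2) * θ ^ 2 := by
      simp [hw, -Complex.ofReal_mul, -Complex.ofReal_neg]
    have hwn : ‖Complex.exp w‖ ≤ Real.exp (-κ * θ ^ 2) := by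
      rw [Complex.norm_exp, hwre]
      refine Real.exp_le_exp.2 ?_
      nlinarith [sq_nonneg θ]
    have hd : ‖ψ - Complex.exp w‖ ≤ D * θ ^ 4 :=
      (norm_charFn_sub_le hp hs hv.le h1 h2 h3 h4 hθ).trans (by gcongr)
    have hA : ‖ψ ^ n * E - Complex.exp w ^ n * E‖ ≤ n * Real.exp (-(2 * b * θ ^ 2)) * (D * θ ^ 4) := by
      rw [← sub_mul, norm_mul, hEn, mul_one]
      refine (norm_pow_sub_pow_le hψn hwn n).trans ?_
      gcongr
      rw [← Real.exp_nat_mul]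
      refine Real.exp_le_exp.2 ?_
      rw [Nat.cast_sub (by omega), hb]
      push_cast
      nlinarith [mul_nonneg hκ.le (sq_nonneg θ), mul_nonneg (mul_nonneg hκ.le (sq_nonneg θ)) (sub_nonneg.2 hn2)]
    set y : ℝ := n * (g / 6 * θ ^ 3) + a * θ with hy
    have hB : (Complex.exp w ^ n * E).re = Real.exp (-(n * v / 2) * θ ^ 2) * Real.cos y := by
      rw [hE, ← Complex.exp_nat_mul, ← Complex.exp_add]
      have : (n : ℂ) * w + -(Complex.I * (a * θ)) =
          ((-(n * v / 2) * θ ^ 2 : ℝ) : ℂ) + ((-y : ℝ) : ℂ) * Complex.I := by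
        rw [hw, hy]; push_cast; ring
      rw [this, Complex.exp_add, ← Complex.ofReal_exp, Complex.re_ofReal_mul,
        Complex.exp_ofReal_mul_I_re, Real.cos_neg]
    have hcos : |Real.cos y - 1| ≤ n ^ 2 * D ^ 2 * θ ^ 6 + a ^ 2 * θ ^ 2 := by
      rw [abs_sub_comm, abs_of_nonneg (sub_nonneg.2 (Real.cos_le_one y))]
      have h0 := Real.one_sub_sq_div_two_le_cos (x := y)
      have h5 : y ^ 2 ≤ 2 * (n * (g / 6 * θ ^ 3)) ^ 2 + 2 * (a * θ) ^ 2 := by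
        rw [hy]; nlinarith [sq_nonneg (n * (g / 6 * θ ^ 3) - a * θ)]
      have h6 : g ^ 2 ≤ D ^ 2 := by rw [← sq_abs g]; gcongr
      have h7 : (n * (g / 6 * θ ^ 3)) ^ 2 ≤ n ^ 2 * D ^ 2 * θ ^ 6 := by
        have : (n * (g / 6 * θ ^ 3)) ^ 2 = n ^ 2 * (g ^ 2 / 36) * θ ^ 6 := by ring
        rw [this]
        have : g ^ 2 / 36 ≤ D ^ 2 := by linarith [sq_nonneg g]
        gcongr
      linarith
    have hexp2 : Real.exp (-(n * v / 2) * θ ^ 2) ≤ Real.exp (-(2 * b * θ ^ 2)) := by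
      refine Real.exp_le_exp.2 ?_
      rw [hb]
      nlinarith [mul_nonneg hn0.le (sq_nonneg θ), mul_nonneg (mul_nonneg hn0.le (sq_nonneg θ)) hκ.le,
        mul_nonneg (mul_nonneg hn0.le (sq_nonneg θ)) (sub_nonneg.2 hκv)]
    have hC : |Real.exp (-(n * v / 2) * θ ^ 2) * Real.cos y - Real.exp (-(n * v / 2) * θ ^ 2)| ≤
        Real.exp (-(2 * b * θ ^ 2)) * (n ^ 2 * D ^ 2 * θ ^ 6 + a ^ 2 * θ ^ 2) := by
      rw [← mul_sub_one, abs_mul, abs_of_pos (Real.exp_pos _)]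
      gcongr
    have hre : |(F θ).re - Real.exp (-(n * v / 2) * θ ^ 2) * Real.cos y| ≤
        n * Real.exp (-(2 * b * θ ^ 2)) * (D * θ ^ 4) := by
      rw [hFψ, ← hB, ← Complex.sub_re]
      exact (Complex.abs_re_le_norm _).trans hA
    have p1 := pow_mul_exp_neg_two_le hb0 (sq_nonneg θ) 1
    have p2 := pow_mul_exp_neg_two_le hb0 (sq_nonneg θ) 2
    have p3 := pow_mul_exp_neg_two_le hb0 (sq_nonneg θ) 3
    set X := Real.exp (-(2 * b * θ ^ 2))
    set Y := Real.exp (-(b * θ ^ 2)) with hY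
    rw [show -b * θ ^ 2 = -(b * θ ^ 2) by ring, ← hY]
    have hsplit : |(F θ).re - Real.exp (-(n * v / 2) * θ ^ 2)| ≤
        n * D * ((θ ^ 2) ^ 2 * X) + n ^ 2 * D ^ 2 * ((θ ^ 2) ^ 3 * X) + a ^ 2 * ((θ ^ 2) ^ 1 * X) := by
      refine (abs_sub_le _ _ _).trans ((add_le_add hre hC).trans (le_of_eq ?_))
      ring
    refine hsplit.trans ?_
    have hY0 : 0 ≤ Y := (Real.exp_pos _).le
    have hfin : n * D * ((θ ^ 2) ^ 2 * X) + n ^ 2 * D ^ 2 * ((θ ^ 2) ^ 3 * X) +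
        a ^ 2 * ((θ ^ 2) ^ 1 * X) ≤ n * D * ((2 : ℕ).factorial / b ^ 2 * Y) +
        n ^ 2 * D ^ 2 * ((3 : ℕ).factorial / b ^ 3 * Y) + a ^ 2 * ((1 : ℕ).factorial / b ^ 1 * Y) := by
      gcongr
    refine hfin.trans ?_
    have : n * D * ((2 : ℕ).factorial / b ^ 2 * Y) +
        n ^ 2 * D ^ 2 * ((3 : ℕ).factorial / b ^ 3 * Y) + a ^ 2 * ((1 : ℕ).factorial / b ^ 1 * Y) =
        (R - 1 / κ / n) * Y := by
      rw [hR, hb]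
      simp only [Nat.factorial]
      push_cast
      field_simp
      ring
    rw [this]
    have : 0 ≤ 1 / κ / n * Y := by positivity
    linarith
  have hout : ∀ θ : ℝ, π ≤ |θ| →
      Real.exp (-(n * v / 2) * θ ^ 2) ≤ R * Real.exp (-b * θ ^ 2) := by
    intro θ hθ
    have hexp2 : Real.exp (-(n * v / 2) * θ ^ 2) ≤ Real.exp (-(2 * b * θ ^ 2)) := by
      refine Real.exp_le_exp.2 ?_
      rw [hb]
      nlinarith [mul_nonneg hn0.le (sq_nonneg θ), mul_nonneg (mul_nonneg hn0.le (sq_nonneg θ)) hκ.le,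
        mul_nonneg (mul_nonneg hn0.le (sq_nonneg θ)) (sub_nonneg.2 hκv)]
    have p1 := pow_mul_exp_neg_two_le hb0 (sq_nonneg θ) 1
    rw [show -b * θ ^ 2 = -(b * θ ^ 2) by ring]
    have h9 : (4 : ℝ) ≤ θ ^ 2 := by
      rw [← sq_abs]
      nlinarith [Real.pi_gt_three]
    set X := Real.exp (-(2 * b * θ ^ 2))
    have hX0 : 0 ≤ X := (Real.exp_pos _).le
    set Y := Real.exp (-(b * θ ^ 2)) with hY
    have hY0 : 0 ≤ Y := (Real.exp_pos _).le
    have hR1 : 1 / κ / n ≤ R := by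
      rw [hR]; gcongr
      have : 0 ≤ 32 * D / κ ^ 2 + 384 * D ^ 2 / κ ^ 3 + 4 * a ^ 2 / κ := by positivity
      linarith
    have : X ≤ 1 / κ / n * Y := by
      have : 4 * X ≤ 4 * (1 / κ / n * Y) := by
        calc 4 * X ≤ (θ ^ 2) ^ 1 * X := by nlinarith
          _ ≤ _ := p1
          _ = _ := by rw [hb]; simp only [Nat.factorial]; push_cast; field_simp
      linarith
    exact hexp2.trans (this.trans (mul_le_mul_of_nonneg_right hR1 hY0))
  have hgi : Integrable fun θ : ℝ => Real.exp (-(n * v / 2) * θ ^ 2) :=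
    integrable_exp_neg_mul_sq (by positivity)
  have hbi : Integrable fun θ : ℝ => Real.exp (-b * θ ^ 2) := integrable_exp_neg_mul_sq hb0
  set G : ℝ → ℝ := (Set.Ioc (-π) π).indicator fun θ => (F θ).re with hG
  have hGi : Integrable G := by
    rw [hG, integrable_indicator_iff measurableSet_Ioc]
    exact ((Complex.continuous_re.comp hFc).intervalIntegrable (-π) π).1
  have hGint : ∫ θ, G θ = 2 * π * convPow p n m := by
    rw [hG, integral_indicator measurableSet_Ioc, hRe,
      intervalIntegral.integral_of_le (by linarith [Real.pi_pos])]
  have hpt : ∀ θ, |G θ - Real.exp (-(n * v / 2) * θ ^ 2)| ≤ R * Real.exp (-b * θ ^ 2) := by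
    intro θ
    by_cases h : θ ∈ Set.Ioc (-π) π
    · rw [hG, Set.indicator_of_mem h]
      exact hin θ (abs_le.2 ⟨h.1.le, h.2⟩)
    · rw [hG, Set.indicator_of_notMem h, zero_sub, abs_neg, abs_of_pos (Real.exp_pos _)]
      refine hout θ ?_
      rw [Set.mem_Ioc, not_and_or, not_lt, not_le] at h
      rcases h with h | h
      · exact le_abs.2 (Or.inr (by linarith))
      · exact le_abs.2 (Or.inl h.le)
  have hmain : |2 * π * convPow p n m - √(π / (n * v / 2))| ≤ R * √(π / b) := by
    rw [← hGint, ← integral_gaussian, ← integral_gaussian, ← integral_sub hGi hgi,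
      ← integral_const_mul]
    rw [← Real.norm_eq_abs]
    exact norm_integral_le_of_norm_le (hbi.const_mul R) (Filter.Eventually.of_forall hpt)
  have hs1 : √(2 * π * n * v) = 2 * π * (√(n * v / 2 / π)) := by
    rw [show 2 * π * n * v = (2 * π) ^ 2 * (n * v / 2 / π) by field_simp,
      Real.sqrt_mul (by positivity), Real.sqrt_sq (by positivity)]
  have hs2 : √(π / (n * v / 2)) * √(n * v / 2 / π) = 1 := by
    rw [← Real.sqrt_mul (by positivity), show π / (n * v / 2) * (n * v / 2 / π) = 1 by field_simp,
      Real.sqrt_one]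
  have hs3 : √(π / b) * √(n * v / 2 / π) = √(2 * v / κ) := by
    rw [← Real.sqrt_mul (by positivity)]
    congr 1
    rw [hb]; field_simp; ring
  calc |convPow p n m * √(2 * π * n * v) - 1|
      = |2 * π * convPow p n m - √(π / (n * v / 2))| * √(n * v / 2 / π) := by
        rw [← abs_of_nonneg (Real.sqrt_nonneg (n * v / 2 / π))]
        rw [← abs_mul, sub_mul, hs2, hs1]
        congr 1; ring
    _ ≤ R * √(π / b) * √(n * v / 2 / π) := by gcongr
    _ = _ := by rw [mul_assoc, hs3]

end DicoreCount

namespace DicoreCount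

open Finset
open scoped Real

section

variable {k : ℕ} {z zlo zhi : ℝ}

/-- Moment constant dominating the centred moments of conditioned Poisson laws. -/
noncomputable def momBound (k : ℕ) (zlo zhi : ℝ) (r : ℕ) : ℝ :=
  (1 + k + zhi) ^ r * ∑' j : ℕ, (1 + (j : ℝ)) ^ r * poiDom k zlo zhi j

lemma momBound_nonneg (hlo : 0 < zlo) (hhi : 0 ≤ zhi) (r : ℕ) : 0 ≤ momBound k zlo zhi r := by
  unfold momBound
  exact mul_nonneg (by positivity)
    (tsum_nonneg fun j => mul_nonneg (by positivity) (poiDom_nonneg hlo hhi j))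

lemma centred_moment (hk : 1 ≤ k) (hlo : 0 < zlo) (h1 : zlo ≤ z) (h2 : z ≤ zhi) (r : ℕ) :
    ∃ g, HasSum (fun j : ℕ => ((j : ℝ) - mPoi k z) ^ r * poiProb k z j) g ∧
      |g| ≤ momBound k zlo zhi r := by
  have hz : 0 < z := hlo.trans_le h1
  have hhi : 0 ≤ zhi := hz.le.trans h2
  have hc0 := mPoi_pos (k := k) hz
  have hc1 := mPoi_sub_le hk hz
  have hsum := (summable_pow_mul_poiDom k hlo hhi r).mul_left ((1 + (k : ℝ) + zhi) ^ r)
  have hb : ∀ j : ℕ, ‖((j : ℝ) - mPoi k z) ^ r * poiProb k z j‖ ≤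
      (1 + (k : ℝ) + zhi) ^ r * ((1 + (j : ℝ)) ^ r * poiDom k zlo zhi j) := by
    intro j
    rw [norm_mul, norm_pow, Real.norm_eq_abs, Real.norm_eq_abs,
      abs_of_nonneg (poiProb_nonneg hz.le j), ← mul_assoc, ← mul_pow]
    have h3 : |(j : ℝ) - mPoi k z| ≤ (1 + (k : ℝ) + zhi) * (1 + j) := by
      have hj : (0 : ℝ) ≤ j := by positivity
      have hkk : (0 : ℝ) ≤ k := by positivity
      rw [abs_le]
      constructor <;> nlinarith [mul_nonneg hj hkk, mul_nonneg hj hhi]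
    have := poiProb_le_poiDom (k := k) hlo h1 h2 j
    have := poiProb_nonneg (k := k) hz.le j
    gcongr
  have hs := Summable.of_norm_bounded hsum hb
  refine ⟨_, hs.hasSum, ?_⟩
  unfold momBound
  rw [← tsum_mul_left]
  exact tsum_of_norm_bounded hsum.hasSum hb

/-- Lower bound for the product of the two first atoms. -/
noncomputable def atomBound (k : ℕ) (zlo zhi : ℝ) : ℝ :=
  zlo ^ k / k.factorial / Real.exp zhi * (zlo ^ (k + 1) / (k + 1).factorial / Real.exp zhi)

lemma atomBound_pos (hlo : 0 < zlo) : 0 < atomBound k zlo zhi := by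
  unfold atomBound; positivity

lemma atomBound_le (hlo : 0 < zlo) (h1 : zlo ≤ z) (h2 : z ≤ zhi) :
    atomBound k zlo zhi ≤ poiProb k z k * poiProb k z (k + 1) := by
  have hz : 0 < z := hlo.trans_le h1
  have hf := fk_pos k hz
  have hfe : fk k z ≤ Real.exp zhi := (fk_le_exp k hz.le).trans (Real.exp_le_exp.2 h2)
  rw [poiProb_self, poiProb_succ]
  unfold atomBound
  gcongr

lemma atomBound_le_vPoi (hk : 2 ≤ k) (hlo : 0 < zlo) (h1 : zlo ≤ z) (h2 : z ≤ zhi) :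
    atomBound k zlo zhi / 2 ≤ vPoi k z := by
  have hz : 0 < z := hlo.trans_le h1
  have h := sum_le_hasSum {k, k + 1} (fun j _ => mul_nonneg (sq_nonneg _)
    (poiProb_nonneg hz.le j)) (hasSum_sq_mul_poiProb hk hz)
  rw [sum_insert (by simp), sum_singleton] at h
  have ha := atomBound_le (k := k) hlo h1 h2
  have p1 := poiProb_le_one (k := k) hz k
  have p2 := poiProb_le_one (k := k) hz (k + 1)
  have q1 := poiProb_nonneg (k := k) hz.le k
  have q2 := poiProb_nonneg (k := k) hz.le (k + 1)
  push_cast at h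
  set P := poiProb k z k
  set Q := poiProb k z (k + 1)
  set x := (k : ℝ) - mPoi k z
  have e : (k : ℝ) + 1 - mPoi k z = x + 1 := by ring
  rw [e] at h
  have r1 : P * Q ≤ P := by nlinarith
  have r2 : P * Q ≤ Q := by nlinarith
  have r3 : x ^ 2 * (P * Q) + (x + 1) ^ 2 * (P * Q) ≤ x ^ 2 * P + (x + 1) ^ 2 * Q := by gcongr
  nlinarith [mul_nonneg (mul_nonneg q1 q2) (sq_nonneg (2 * x + 1))]

lemma vPoi_le (hk : 2 ≤ k) (hlo : 0 < zlo) (h1 : zlo ≤ z) (h2 : z ≤ zhi) :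
    vPoi k z ≤ momBound k zlo zhi 2 := by
  obtain ⟨g, hg, hb⟩ := centred_moment (by omega : 1 ≤ k) hlo h1 h2 2
  rw [(hasSum_sq_mul_poiProb hk (hlo.trans_le h1)).unique hg]
  exact (le_abs_self _).trans hb

lemma vPoi_pos (hk : 2 ≤ k) (hz : 0 < z) : 0 < vPoi k z :=
  (half_pos (atomBound_pos hz)).trans_le (atomBound_le_vPoi hk hz le_rfl le_rfl)

/-- Local limit theorem, uniformly over a compact range of parameters. -/
lemma exists_local_limit (hk : 2 ≤ k) (hlo : 0 < zlo) (hhi : zlo ≤ zhi) :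
    ∃ C : ℝ, 0 < C ∧ ∀ z, zlo ≤ z → z ≤ zhi → ∀ n : ℕ, 2 ≤ n → ∀ m : ℕ,
      |convPow (poiProb k z) n m * √(2 * π * n * vPoi k z) - 1| ≤
        C * (1 + ((m : ℝ) - n * mPoi k z) ^ 2) / n := by
  have hhi0 : 0 ≤ zhi := hlo.le.trans hhi
  set B := momBound k zlo zhi with hB
  have hB0 : ∀ r, 0 ≤ B r := fun r => momBound_nonneg hlo hhi0 r
  set κ := atomBound k zlo zhi / 8 with hκdef
  have hκ : 0 < κ := by have := atomBound_pos (k := k) (zhi := zhi) hlo; positivity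
  set D := 4 * B 4 + 3 * (B 2 + B 3) ^ 2 + B 3 with hD
  have hD0 : 0 ≤ D := by have := hB0 2; have := hB0 3; have := hB0 4; positivity
  set K := (32 * D / κ ^ 2 + 384 * D ^ 2 / κ ^ 3 + 4 / κ) * √(2 * B 2 / κ) with hK
  have hK0 : 0 ≤ K := by positivity
  refine ⟨K + 1, by positivity, fun z hz1 hz2 n hn m => ?_⟩
  have hz : 0 < z := hlo.trans_le hz1
  have hk1 : 1 ≤ k := by omega
  obtain ⟨g, hg, hgB⟩ := centred_moment hk1 hlo hz1 hz2 3
  obtain ⟨m4, hm4, hm4B⟩ := centred_moment hk1 hlo hz1 hz2 4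
  have hv := atomBound_le_vPoi hk hlo hz1 hz2
  have hv2 := vPoi_le hk hlo hz1 hz2
  have hv0 := vPoi_pos hk hz
  have hat := atomBound_le (k := k) hlo hz1 hz2
  have hpi : (1 : ℝ) / 8 ≤ 2 / π ^ 2 := by
    rw [div_le_div_iff₀ (by norm_num) (by positivity)]
    nlinarith [Real.pi_le_four, Real.pi_pos]
  have hκp : κ ≤ 2 / π ^ 2 * (poiProb k z k * poiProb k z (k + 1)) := by
    have h0 := atomBound_pos (k := k) (zhi := zhi) hlo
    calc κ = 1 / 8 * atomBound k zlo zhi := by rw [hκdef]; ring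
      _ ≤ _ := by gcongr
  have hmB : m4 ≤ B 4 := (le_abs_self _).trans hm4B
  have key := abs_convPow_mul_sqrt_sub_one_le (fun j => poiProb_nonneg hz.le j)
    (hasSum_poiProb hz) (hasSum_sub_mul_poiProb hk1 hz) (hasSum_sq_mul_poiProb hk hz) hg hm4
    hκ hκp (by linarith) (D := D)
    (by
      rw [hD]
      have h3 := hB0 3
      have : (vPoi k z + |g|) ^ 2 ≤ (B 2 + B 3) ^ 2 := by gcongr
      linarith)
    (by
      rw [hD]
      have := hB0 2; have := hB0 3; have := hB0 4
      have : 0 ≤ 4 * B 4 + 3 * (B 2 + B 3) ^ 2 := by positivity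
      linarith) hn m
  refine key.trans ?_
  set a2 := ((m : ℝ) - n * mPoi k z) ^ 2 with ha2
  have ha0 : 0 ≤ a2 := sq_nonneg _
  calc _ ≤ ((32 * D / κ ^ 2 + 384 * D ^ 2 / κ ^ 3 + 4 / κ) * (1 + a2)) / n * √(2 * B 2 / κ) := by
        gcongr
        have e1 : 0 ≤ 32 * D / κ ^ 2 * a2 := by positivity
        have e2 : 0 ≤ 384 * D ^ 2 / κ ^ 3 * a2 := by positivity
        have e3 : 1 / κ ≤ 4 / κ := by gcongr; norm_num
        have e4 : 4 * a2 / κ = 4 / κ * a2 := by ring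
        nlinarith
    _ = K * (1 + a2) / n := by rw [hK]; ring
    _ ≤ _ := by gcongr; linarith

end

end DicoreCount

namespace DicoreCount

open Finset PowerSeries

section degrees

variable {E V : Type*} [Fintype E] [DecidableEq V]

/-- Size of the fibre of `t` over `v`. -/
def deg (t : E → V) (v : V) : ℕ := #{e | t e = v}

lemma deg_comp_equiv {E' : Type*} [Fintype E'] (t : E → V) (σ : E' ≃ E) (v : V) :
    deg (t ∘ σ) v = deg t v := by
  unfold deg
  refine card_bij (fun e _ => σ e) (by simp) (fun _ _ _ _ h => σ.injective h) fun e he => ?_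
  exact ⟨σ.symm e, by simpa using he, by simp⟩

lemma deg_perm_comp {V' : Type*} [DecidableEq V'] (t : E → V) (π : V ≃ V') (v : V') :
    deg (π ∘ t) v = deg t (π.symm v) := by
  unfold deg
  congr 1; ext e; simp [Equiv.eq_symm_apply]

lemma sum_deg (t : E → V) (S : Finset V) : ∑ v ∈ S, deg t v = #{e | t e ∈ S} := by
  unfold deg
  rw [card_eq_sum_card_fiberwise (f := t) (t := S) (by intro e; simp)]
  refine sum_congr rfl fun v hv => ?_
  congr 1; ext e; simp only [mem_filter, mem_univ, true_and]
  constructor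
  · rintro rfl; exact ⟨hv, rfl⟩
  · exact fun h => h.2

variable [Fintype V]

lemma sum_deg_univ (t : E → V) : ∑ v, deg t v = Fintype.card E := by
  rw [sum_deg]; simp

lemma deg_eq_sum (t : E → V) (v : V) : deg t v = ∑ e, if t e = v then 1 else 0 := by
  unfold deg; rw [card_filter]

lemma deg_cons {M : ℕ} (u : V) (t : Fin M → V) (v : V) :
    deg (Fin.cons u t : Fin (M + 1) → V) v = (if u = v then 1 else 0) + deg t v := by
  rw [deg_eq_sum, deg_eq_sum, Fin.sum_univ_succ]
  simp only [Fin.cons_zero, Fin.cons_succ]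

lemma derivative_prod_sdiff (F : V → ℝ⟦X⟧) (s : Finset V) :
    d⁄dX ℝ (∏ v ∈ s, F v) = ∑ u ∈ s, d⁄dX ℝ (F u) * ∏ v ∈ s \ {u}, F v := by
  induction s using Finset.induction_on with
  | empty => simp
  | insert a s ha ih =>
    rw [prod_insert ha, Derivation.leibniz, ih, sum_insert ha, smul_eq_mul, smul_eq_mul, add_comm]
    congr 1
    · rw [insert_sdiff_of_mem _ (mem_singleton_self a), sdiff_singleton_eq_erase, erase_eq_of_notMem ha, mul_comm]
    · rw [mul_sum]
      refine sum_congr rfl fun u hu => ?_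
      have hau : a ∉ ({u} : Finset V) := by
        rw [mem_singleton]; rintro rfl; exact ha hu
      rw [insert_sdiff_of_notMem _ hau, prod_insert (by simp [ha])]
      ring

lemma coeff_succ_prod (F : V → ℝ⟦X⟧) (M : ℕ) :
    ((M : ℝ) + 1) * coeff (M + 1) (∏ v, F v) =
      ∑ u, coeff M (∏ v, Function.update F u (d⁄dX ℝ (F u)) v) := by
  rw [mul_comm, ← coeff_derivative, derivative_prod_sdiff, map_sum]
  refine sum_congr rfl fun u _ => ?_
  rw [prod_update_of_mem (mem_univ u)]

/-- Exponential formula: the sum over all maps of products of weights depending on the fibre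
sizes is a coefficient of a product of power series. -/
lemma sum_fin_prod_deg (M : ℕ) (F : V → ℝ⟦X⟧) :
    ∑ t : Fin M → V, ∏ v, ((deg t v).factorial * coeff (deg t v) (F v)) =
      M.factorial * coeff M (∏ v, F v) := by
  induction M generalizing F with
  | zero =>
    have h0 : ∀ t : Fin 0 → V, ∀ v, deg t v = 0 := fun t v => by simp [deg]
    simp [h0, map_prod]
  | succ M ih =>
    rw [← (Fin.consEquiv fun _ : Fin (M + 1) => V).sum_comp, Fintype.sum_prod_type,
      Nat.factorial_succ, Nat.cast_mul, mul_comm ((M + 1 : ℕ) : ℝ), mul_assoc]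
    push_cast
    rw [coeff_succ_prod, mul_sum]
    refine sum_congr rfl fun u _ => ?_
    rw [← ih]
    refine sum_congr rfl fun t _ => prod_congr rfl fun v _ => ?_
    have hc : (Fin.consEquiv fun _ : Fin (M + 1) => V) (u, t) = (Fin.cons u t : Fin (M + 1) → V) :=
      rfl
    rw [hc, deg_cons]
    by_cases h : u = v
    · subst h
      rw [if_pos rfl, Function.update_self, coeff_derivative, add_comm 1, Nat.factorial_succ]
      push_cast; ring
    · rw [if_neg h, zero_add, Function.update_of_ne (Ne.symm h)]

lemma sum_prod_deg [DecidableEq E] (F : V → ℝ⟦X⟧) :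
    ∑ t : E → V, ∏ v, ((deg t v).factorial * coeff (deg t v) (F v)) =
      (Fintype.card E).factorial * coeff (Fintype.card E) (∏ v, F v) := by
  rw [← sum_fin_prod_deg]
  refine Fintype.sum_equiv ((Fintype.equivFin E).arrowCongr (Equiv.refl V)) _ _ fun t => ?_
  refine prod_congr rfl fun v _ => ?_
  have : (Fintype.equivFin E).arrowCongr (Equiv.refl V) t = t ∘ (Fintype.equivFin E).symm := rfl
  rw [this, deg_comp_equiv]

end degrees

lemma coeff_mk_pow (p : ℕ → ℝ) (n m : ℕ) : coeff m (mk p ^ n) = convPow p n m := by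
  induction n generalizing m with
  | zero => rw [pow_zero, coeff_one]; rfl
  | succ n ih =>
    rw [pow_succ', coeff_mul, Nat.sum_antidiagonal_eq_sum_range_succ_mk]
    simp only [coeff_mk, ih]
    rfl

section ksurj

variable {E V : Type*} [Fintype E] [Fintype V] [DecidableEq V] [DecidableEq E]

/-- Maps all of whose fibres have at least `k` elements. -/
def ksurj (k : ℕ) (E V : Type*) [Fintype E] [Fintype V] [DecidableEq V] [DecidableEq E] :
    Finset (E → V) :=
  univ.filter fun t => ∀ v, k ≤ deg t v

lemma mem_ksurj {k : ℕ} {t : E → V} : t ∈ ksurj k E V ↔ ∀ v, k ≤ deg t v := by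
  simp [ksurj]

/-- Weighted count of `ksurj`. -/
lemma sum_ksurj_prod {k : ℕ} {z : ℝ} (hz : 0 < z) (w : V → ℕ → ℝ) :
    ∑ t ∈ ksurj k E V, ∏ v, w v (deg t v) =
      (Fintype.card E).factorial * fk k z ^ Fintype.card V / z ^ Fintype.card E *
        coeff (Fintype.card E) (∏ v, mk fun j => poiProb k z j * w v j) := by
  have h := sum_prod_deg (E := E) fun v : V => mk fun j => poiProb k z j * w v j
  have hf := fk_pos k hz
  rw [mul_div_right_comm, mul_assoc, mul_comm (fk k z ^ _), ← mul_assoc, div_mul_eq_mul_div, ← h,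
    ksurj, sum_filter, sum_div, sum_mul]
  refine sum_congr rfl fun t _ => ?_
  simp only [coeff_mk]
  split_ifs with ht
  · have : ∀ v, ((deg t v).factorial : ℝ) * (poiProb k z (deg t v) * w v (deg t v)) =
        z ^ deg t v * (fk k z)⁻¹ * w v (deg t v) := fun v => by
      rw [poiProb, expTerm, if_pos (ht v)]
      have : ((deg t v).factorial : ℝ) ≠ 0 := by positivity
      field_simp
    simp only [this, prod_mul_distrib, prod_const, card_univ, prod_pow_eq_pow_sum, sum_deg_univ, inv_pow]
    field_simp
  · push Not at ht
    obtain ⟨v, hv⟩ := ht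
    rw [prod_eq_zero (mem_univ v)]
    · simp
    · rw [poiProb_eq_zero hv]; simp

lemma card_ksurj {k : ℕ} {z : ℝ} (hz : 0 < z) :
    (#(ksurj k E V) : ℝ) = (Fintype.card E).factorial * fk k z ^ Fintype.card V /
      z ^ Fintype.card E * convPow (poiProb k z) (Fintype.card V) (Fintype.card E) := by
  have h := sum_ksurj_prod (E := E) (V := V) (k := k) hz fun _ _ => 1
  simp only [prod_const_one, sum_const, nsmul_eq_mul, mul_one, prod_const, card_univ] at h
  rw [h]
  congr 1
  exact coeff_mk_pow _ _ _

/-- Chernoff-type bound on the number of maps with large fibres. -/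
lemma card_ksurj_le {k : ℕ} {u : ℝ} (hu : 0 < u) :
    (#(ksurj k E V) : ℝ) ≤ (Fintype.card E).factorial * fk k u ^ Fintype.card V /
      u ^ Fintype.card E := by
  rw [card_ksurj hu]
  have := fk_pos k hu
  exact mul_le_of_le_one_right (by positivity)
    (convPow_le_one (fun j => poiProb_nonneg hu.le j) (hasSum_poiProb hu) _ _)

end ksurj

end DicoreCount

namespace DicoreCount

open Finset PowerSeries
open scoped Real

/-- Parameters in the range under consideration: `z` lies in a compact interval and is tuned so
that the mean of the conditioned Poisson law is `M / N`. -/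
structure Tuned (k : ℕ) (zlo zhi z : ℝ) (N M : ℕ) : Prop where
  lo : zlo ≤ z
  hi : z ≤ zhi
  mean : mPoi k z * N = M
  le : 2 * N ≤ M

/-- The normalised probability that `N` conditioned Poisson variables sum to `M`. -/
noncomputable abbrev hitProb (k : ℕ) (z : ℝ) (N M : ℕ) : ℝ := convPow (poiProb k z) N M

section

variable {k : ℕ} {zlo zhi : ℝ}

lemma exists_hitProb_lower (hk : 2 ≤ k) (hlo : 0 < zlo) (hhi : zlo ≤ zhi) :
    ∃ N0 : ℕ, 2 ≤ N0 ∧ ∀ z N M, Tuned k zlo zhi z N M → N0 ≤ N →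
      1 / 2 ≤ hitProb k z N M * √(2 * π * N * vPoi k z) := by
  obtain ⟨C, hC, h⟩ := exists_local_limit hk hlo hhi
  refine ⟨max 2 ⌈2 * C⌉₊, le_max_left _ _, fun z N M hT hN => ?_⟩
  have hN2 : 2 ≤ N := (le_max_left _ _).trans hN
  have hNC : 2 * C ≤ N := (Nat.le_ceil _).trans (by exact_mod_cast (le_max_right _ _).trans hN)
  have h1 := h z hT.lo hT.hi N hN2 M
  have hN0 : (0 : ℝ) < N := by positivity
  have : (M : ℝ) - N * mPoi k z = 0 := by rw [← hT.mean]; ring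
  rw [this] at h1
  have h2 : C * (1 + 0 ^ 2) / N ≤ 1 / 2 := by
    rw [div_le_iff₀ hN0]; linarith
  have := (abs_le.1 (h1.trans h2)).1
  linarith

set_option maxHeartbeats 1000000 in
/-- Removing `r ≤ 2` summands changes the hitting probability only slightly. -/
lemma exists_peel (hk : 2 ≤ k) (hlo : 0 < zlo) (hhi : zlo ≤ zhi) :
    ∃ C : ℝ, 0 < C ∧ ∃ N0 : ℕ, 4 ≤ N0 ∧ ∀ z N M, Tuned k zlo zhi z N M → N0 ≤ N →
      0 < hitProb k z N M ∧
      ∀ r : ℕ, r ≤ 2 → ∀ (W : ℕ → ℝ) (B : ℝ), Summable (fun J : ℕ => |W J| * (1 + (J : ℝ)) ^ 2) →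
        ∑' J : ℕ, |W J| * (1 + (J : ℝ)) ^ 2 ≤ B →
        |∑ J ∈ range (M + 1), W J * hitProb k z (N - r) (M - J)| ≤ C * B * hitProb k z N M ∧
        (HasSum W 0 → |∑ J ∈ range (M + 1), W J * hitProb k z (N - r) (M - J)| ≤
          C * B / N * hitProb k z N M) := by
  obtain ⟨N1, hN1, hlow⟩ := exists_hitProb_lower hk hlo hhi
  obtain ⟨C0, hC0, hlim⟩ := exists_local_limit hk hlo hhi
  have hzhi : 0 < zhi := hlo.trans_le hhi
  set X : ℝ := 1 + (2 * (k + zhi) + 1) ^ 2 with hX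
  have hX0 : 0 < X := by positivity
  set C : ℝ := 4 * (1 + 2 * C0 * X) with hC
  refine ⟨C, by positivity, max N1 4, le_max_right _ _, fun z N M hT hN => ?_⟩
  have hN4 : 4 ≤ N := (le_max_right _ _).trans hN
  have hN4' : (4 : ℝ) ≤ N := by exact_mod_cast hN4
  have hz : 0 < z := hlo.trans_le hT.lo
  have hv := vPoi_pos hk hz
  have hN0 : (0 : ℝ) < N := by linarith
  have hq := hlow z N M hT ((le_max_left _ _).trans hN)
  set s := √(2 * π * N * vPoi k z) with hs
  have hs0 : 0 < s := Real.sqrt_pos.2 (by positivity)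
  have hq0 : 0 < hitProb k z N M := by
    by_contra h
    push Not at h
    have := mul_nonpos_of_nonpos_of_nonneg h hs0.le
    linarith
  refine ⟨hq0, fun r hr W B hW hWB => ?_⟩
  have hrN : (r : ℝ) ≤ 2 := by exact_mod_cast hr
  set n := N - r with hn
  have hnN : (n : ℝ) = N - r := by rw [hn, Nat.cast_sub (by omega)]
  have hn2 : 2 ≤ n := by omega
  have hnhalf : (N : ℝ) / 2 ≤ n := by rw [hnN]; linarith
  have hn0 : (0 : ℝ) < n := by linarith
  set Q := √(2 * π * n * vPoi k z) with hQ
  have hQ0 : 0 < Q := Real.sqrt_pos.2 (by positivity)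
  have hsQ : s ≤ 2 * Q := by
    rw [hs, hQ, show (2 : ℝ) = √4 by rw [show (4 : ℝ) = 2 ^ 2 by norm_num]; simp,
      ← Real.sqrt_mul (by norm_num)]
    refine Real.sqrt_le_sqrt ?_
    have : 0 < √4 * π * vPoi k z := by positivity
    nlinarith
  have hQq : 1 ≤ 4 * Q * hitProb k z N M := by nlinarith
  have hc0 := mPoi_pos (k := k) hz
  have hc1 : mPoi k z ≤ k + zhi := by
    have := mPoi_sub_le (by omega : 1 ≤ k) hz; linarith [hT.hi]
  have herr : ∀ J ∈ range (M + 1), |hitProb k z n (M - J) * Q - 1| ≤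
      2 * C0 * X / N * (1 + (J : ℝ)) ^ 2 := by
    intro J hJ
    have hJM : J ≤ M := by have := mem_range.1 hJ; omega
    refine (hlim z hT.lo hT.hi n hn2 (M - J)).trans ?_
    have e : ((M - J : ℕ) : ℝ) - n * mPoi k z = r * mPoi k z - J := by
      rw [Nat.cast_sub hJM, hnN, ← hT.mean]; ring
    rw [e]
    have hJ0 : (0 : ℝ) ≤ J := by positivity
    have hr0 : (0 : ℝ) ≤ r := by positivity
    have hkz : 0 ≤ (k : ℝ) + zhi := by positivity
    have hrc : r * mPoi k z ≤ 2 * (k + zhi) := mul_le_mul hrN hc1 hc0.le (by norm_num)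
    have h1 : |r * mPoi k z - J| ≤ (2 * (k + zhi) + 1) * (1 + J) := by
      rw [abs_le]
      constructor <;> nlinarith [mul_nonneg hr0 hc0.le, mul_nonneg hkz hJ0]
    have h2 : (r * mPoi k z - J) ^ 2 ≤ (2 * (k + zhi) + 1) ^ 2 * (1 + J) ^ 2 := by
      rw [← sq_abs, ← mul_pow]; gcongr
    have h3 : 1 + (r * mPoi k z - J) ^ 2 ≤ X * (1 + (J : ℝ)) ^ 2 := by
      rw [hX]; nlinarith [one_le_pow₀ (n := 2) (by linarith : (1 : ℝ) ≤ 1 + J)]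
    calc C0 * (1 + (r * mPoi k z - J) ^ 2) / n ≤ C0 * (X * (1 + (J : ℝ)) ^ 2) / (N / 2) := by gcongr
      _ = _ := by field_simp
  have hpart : ∀ g : ℕ → ℝ, (∀ J, 0 ≤ g J) → Summable g → ∑ J ∈ range (M + 1), g J ≤ ∑' J, g J :=
    fun g hg hs => hs.sum_le_tsum _ fun J _ => hg J
  have hWpart : ∑ J ∈ range (M + 1), |W J| * (1 + (J : ℝ)) ^ 2 ≤ B :=
    (hpart _ (fun J => by positivity) hW).trans hWB
  have hB0 : 0 ≤ B := le_trans (tsum_nonneg fun J => by positivity) hWB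
  set T := ∑ J ∈ range (M + 1), W J * hitProb k z n (M - J) with hT'
  have hsplit : T * Q = ∑ J ∈ range (M + 1), W J +
      ∑ J ∈ range (M + 1), W J * (hitProb k z n (M - J) * Q - 1) := by
    rw [hT', sum_mul, ← sum_add_distrib]
    exact sum_congr rfl fun J _ => by ring
  have herrsum : |∑ J ∈ range (M + 1), W J * (hitProb k z n (M - J) * Q - 1)| ≤
      2 * C0 * X / N * B := by
    refine (abs_sum_le_sum_abs _ _).trans ?_
    calc _ ≤ ∑ J ∈ range (M + 1), 2 * C0 * X / N * (|W J| * (1 + (J : ℝ)) ^ 2) := by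
          refine sum_le_sum fun J hJ => ?_
          rw [abs_mul]
          calc _ ≤ |W J| * (2 * C0 * X / N * (1 + (J : ℝ)) ^ 2) := by
                gcongr; exact herr J hJ
            _ = _ := by ring
      _ = 2 * C0 * X / N * ∑ J ∈ range (M + 1), |W J| * (1 + (J : ℝ)) ^ 2 := by rw [mul_sum]
      _ ≤ _ := by gcongr
  have hfinish : ∀ δ : ℝ, 0 ≤ δ → |T * Q| ≤ δ → |T| ≤ 4 * δ * hitProb k z N M := by
    intro δ hδ h
    rw [abs_mul, abs_of_pos hQ0] at h
    calc |T| ≤ |T| * (4 * Q * hitProb k z N M) := le_mul_of_one_le_right (abs_nonneg _) hQq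
      _ = 4 * (|T| * Q) * hitProb k z N M := by ring
      _ ≤ _ := by gcongr
  have hNle : 2 * C0 * X / N ≤ 2 * C0 * X := div_le_self (by positivity) (by linarith)
  constructor
  · have h6 : |∑ J ∈ range (M + 1), W J| ≤ B := by
      refine (abs_sum_le_sum_abs _ _).trans (le_trans (sum_le_sum fun J _ => ?_) hWpart)
      exact le_mul_of_one_le_right (abs_nonneg _)
        (one_le_pow₀ (by linarith [Nat.cast_nonneg (α := ℝ) J]))
    refine (hfinish (B + 2 * C0 * X * B) (by positivity) ?_).trans (le_of_eq (by rw [hC]; ring))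
    rw [hsplit]
    refine (abs_add_le _ _).trans (add_le_add h6 (herrsum.trans ?_))
    gcongr
  · intro hW0
    have hWs : Summable fun J => |W J| := Summable.of_nonneg_of_le (fun J => abs_nonneg _)
      (fun J => le_mul_of_one_le_right (abs_nonneg (W J))
        (one_le_pow₀ (n := 2) (by linarith [Nat.cast_nonneg (α := ℝ) J]))) hW
    have h6 : |∑ J ∈ range (M + 1), W J| ≤ B / N := by
      have h7 := hW0.summable.sum_add_tsum_nat_add (M + 1)
      rw [hW0.tsum_eq] at h7
      rw [show ∑ J ∈ range (M + 1), W J = -∑' i, W (i + (M + 1)) by linarith, abs_neg]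
      have hsh : Summable fun i => |W (i + (M + 1))| * (1 + ((i + (M + 1) : ℕ) : ℝ)) ^ 2 :=
        (summable_nat_add_iff (f := fun J : ℕ => |W J| * (1 + (J : ℝ)) ^ 2) (M + 1)).2 hW
      have h8 : ∑' i, |W (i + (M + 1))| * (1 + ((i + (M + 1) : ℕ) : ℝ)) ^ 2 ≤ B := by
        have h9 := hW.sum_add_tsum_nat_add (M + 1)
        have : 0 ≤ ∑ J ∈ range (M + 1), |W J| * (1 + (J : ℝ)) ^ 2 :=
          sum_nonneg fun J _ => by positivity
        linarith
      have hMN : (N : ℝ) ≤ M := by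
        have := hT.le
        exact_mod_cast (by omega : N ≤ M)
      have hbd : ∀ i, ‖W (i + (M + 1))‖ ≤
          (|W (i + (M + 1))| * (1 + ((i + (M + 1) : ℕ) : ℝ)) ^ 2) / N := by
        intro i
        rw [Real.norm_eq_abs, mul_div_assoc]
        refine le_mul_of_one_le_right (abs_nonneg _) ?_
        rw [one_le_div hN0]
        push_cast
        nlinarith [Nat.cast_nonneg (α := ℝ) i]
      refine (tsum_of_norm_bounded (hsh.div_const (N : ℝ)).hasSum hbd).trans ?_
      rw [tsum_div_const]
      gcongr
    refine (hfinish (B / N + 2 * C0 * X / N * B) (by positivity) ?_).trans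
      (le_of_eq (by rw [hC]; ring))
    rw [hsplit]
    exact (abs_add_le _ _).trans (add_le_add h6 herrsum)

end

end DicoreCount

namespace DicoreCount

open Finset PowerSeries
open scoped Real

section counting

variable {k N M : ℕ} {z : ℝ}

/-- Normalising constant for the number of maps with large fibres. -/
noncomputable def normConst (k : ℕ) (z : ℝ) (N M : ℕ) : ℝ := M.factorial * fk k z ^ N / z ^ M

lemma normConst_pos (hz : 0 < z) : 0 < normConst k z N M := by
  have := fk_pos k hz
  unfold normConst; positivity

lemma card_ksurj_fin (hz : 0 < z) :
    (#(ksurj k (Fin M) (Fin N)) : ℝ) = normConst k z N M * hitProb k z N M := by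
  rw [card_ksurj hz]; simp [normConst]

lemma sum_ksurj_deg (hz : 0 < z) (φ : ℕ → ℝ) (v : Fin N) :
    ∑ t ∈ ksurj k (Fin M) (Fin N), φ (deg t v) =
      normConst k z N M * ∑ J ∈ range (M + 1), (poiProb k z J * φ J) * hitProb k z (N - 1) (M - J) := by
  have h := sum_ksurj_prod (E := Fin M) (V := Fin N) (k := k) hz
    fun v' j => if v' = v then φ j else 1
  simp only [prod_ite_eq', mem_univ, if_true, Fintype.card_fin] at h
  rw [h, normConst]
  congr 1
  rw [← mul_prod_erase univ _ (mem_univ v), coeff_mul, Nat.sum_antidiagonal_eq_sum_range_succ_mk]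
  refine sum_congr rfl fun J _ => ?_
  rw [coeff_mk, if_pos rfl]
  congr 1
  rw [prod_congr rfl (g := fun _ => mk (poiProb k z)), prod_const, card_erase_of_mem (mem_univ v),
    card_univ, Fintype.card_fin, coeff_mk_pow]
  intro v' hv'
  simp [ne_of_mem_erase hv']

lemma sum_ksurj_deg_deg (hz : 0 < z) (φ ψ : ℕ → ℝ) {u v : Fin N} (huv : u ≠ v) :
    ∑ t ∈ ksurj k (Fin M) (Fin N), φ (deg t u) * ψ (deg t v) =
      normConst k z N M * ∑ J ∈ range (M + 1),
        (∑ x ∈ antidiagonal J, (poiProb k z x.1 * φ x.1) * (poiProb k z x.2 * ψ x.2)) *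
          hitProb k z (N - 2) (M - J) := by
  have h := sum_ksurj_prod (E := Fin M) (V := Fin N) (k := k) hz
    fun v' j => (if v' = u then φ j else 1) * (if v' = v then ψ j else 1)
  simp only [prod_mul_distrib, prod_ite_eq', mem_univ, if_true, Fintype.card_fin] at h
  rw [h, normConst]
  congr 1
  have hv : v ∈ univ.erase u := by simp [huv.symm]
  rw [← mul_prod_erase univ _ (mem_univ u), ← mul_prod_erase _ _ hv, ← mul_assoc, coeff_mul,
    Nat.sum_antidiagonal_eq_sum_range_succ_mk]
  refine sum_congr rfl fun J _ => ?_
  congr 1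
  · rw [coeff_mul]
    refine sum_congr rfl fun x _ => ?_
    simp [huv, huv.symm]
  · rw [prod_congr rfl (g := fun _ => mk (poiProb k z)), prod_const, card_erase_of_mem hv,
      card_erase_of_mem (mem_univ u), card_univ, Fintype.card_fin, coeff_mk_pow]
    · rfl
    intro v' hv'
    have h1 := ne_of_mem_erase hv'
    have h2 := ne_of_mem_erase (mem_of_mem_erase hv')
    simp [h1, h2]

end counting

section weights

/-- Cauchy products inherit second-moment summability. -/
lemma cauchy_weight {a b : ℕ → ℝ} {A B : ℝ}
    (ha : Summable fun j : ℕ => |a j| * (1 + (j : ℝ)) ^ 2)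
    (hb : Summable fun j : ℕ => |b j| * (1 + (j : ℝ)) ^ 2)
    (hA : ∑' j : ℕ, |a j| * (1 + (j : ℝ)) ^ 2 ≤ A) (hB : ∑' j : ℕ, |b j| * (1 + (j : ℝ)) ^ 2 ≤ B)
    (ha0 : HasSum a 0) :
    (Summable fun J : ℕ => |∑ x ∈ antidiagonal J, a x.1 * b x.2| * (1 + (J : ℝ)) ^ 2) ∧
    (∑' J : ℕ, |∑ x ∈ antidiagonal J, a x.1 * b x.2| * (1 + (J : ℝ)) ^ 2 ≤ A * B) ∧
    HasSum (fun J : ℕ => ∑ x ∈ antidiagonal J, a x.1 * b x.2) 0 := by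
  have hnn : ∀ c : ℕ → ℝ, ∀ j : ℕ, ‖|c j| * (1 + (j : ℝ)) ^ 2‖ = |c j| * (1 + (j : ℝ)) ^ 2 :=
    fun c j => by rw [Real.norm_eq_abs, abs_of_nonneg (by positivity)]
  have hna : Summable fun j : ℕ => ‖|a j| * (1 + (j : ℝ)) ^ 2‖ := by simpa only [hnn] using ha
  have hnb : Summable fun j : ℕ => ‖|b j| * (1 + (j : ℝ)) ^ 2‖ := by simpa only [hnn] using hb
  have hprod := (summable_norm_sum_mul_antidiagonal_of_summable_norm hna hnb).of_norm
  have hts := tsum_mul_tsum_eq_tsum_sum_antidiagonal_of_summable_norm hna hnb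
  have hle : ∀ J : ℕ, |∑ x ∈ antidiagonal J, a x.1 * b x.2| * (1 + (J : ℝ)) ^ 2 ≤
      ∑ x ∈ antidiagonal J, |a x.1| * (1 + (x.1 : ℝ)) ^ 2 * (|b x.2| * (1 + (x.2 : ℝ)) ^ 2) := by
    intro J
    calc _ ≤ (∑ x ∈ antidiagonal J, |a x.1 * b x.2|) * (1 + (J : ℝ)) ^ 2 := by
          gcongr; exact abs_sum_le_sum_abs _ _
      _ ≤ _ := by
          rw [sum_mul]
          refine sum_le_sum fun x hx => ?_
          have hJ : (J : ℝ) = x.1 + x.2 := by rw [← mem_antidiagonal.1 hx]; push_cast; ring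
          have h1 : 1 + (J : ℝ) ≤ (1 + x.1) * (1 + x.2) := by
            rw [hJ]; nlinarith [mul_nonneg (Nat.cast_nonneg (α := ℝ) x.1) (Nat.cast_nonneg (α := ℝ) x.2)]
          rw [abs_mul]
          calc |a x.1| * |b x.2| * (1 + (J : ℝ)) ^ 2 ≤
              |a x.1| * |b x.2| * ((1 + x.1) * (1 + x.2)) ^ 2 := by gcongr
            _ = _ := by ring
  have hs : Summable fun J : ℕ => |∑ x ∈ antidiagonal J, a x.1 * b x.2| * (1 + (J : ℝ)) ^ 2 :=
    Summable.of_nonneg_of_le (fun J => by positivity) hle hprod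
  have hweak : ∀ c : ℕ → ℝ, (Summable fun j : ℕ => |c j| * (1 + (j : ℝ)) ^ 2) →
      Summable fun j => ‖c j‖ := fun c hc => Summable.of_nonneg_of_le (fun j => norm_nonneg _)
      (fun j => le_mul_of_one_le_right (abs_nonneg _)
        (one_le_pow₀ (by linarith [Nat.cast_nonneg (α := ℝ) j]))) hc
  refine ⟨hs, (hs.tsum_le_tsum hle hprod).trans ?_, ?_⟩
  · rw [← hts]
    exact mul_le_mul hA hB (tsum_nonneg fun j => by positivity)
      (le_trans (tsum_nonneg fun j => by positivity) hA)
  · have h3 := (summable_norm_sum_mul_antidiagonal_of_summable_norm (hweak a ha)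
      (hweak b hb)).of_norm.hasSum
    rw [← tsum_mul_tsum_eq_tsum_sum_antidiagonal_of_summable_norm (hweak a ha) (hweak b hb),
      ha0.tsum_eq, zero_mul] at h3
    exact h3

variable {k : ℕ} {z zlo zhi : ℝ}

lemma poi_weight (hlo : 0 < zlo) (h1 : zlo ≤ z) (h2 : z ≤ zhi) {φ ω : ℕ → ℝ}
    (hω : ∀ j, |φ j| * (1 + (j : ℝ)) ^ 2 ≤ ω j)
    (hs : Summable fun j => ω j * poiDom k zlo zhi j) :
    (Summable fun j : ℕ => |poiProb k z j * φ j| * (1 + (j : ℝ)) ^ 2) ∧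
    ∑' j : ℕ, |poiProb k z j * φ j| * (1 + (j : ℝ)) ^ 2 ≤ ∑' j, ω j * poiDom k zlo zhi j := by
  have hz : 0 < z := hlo.trans_le h1
  have hle : ∀ j : ℕ, |poiProb k z j * φ j| * (1 + (j : ℝ)) ^ 2 ≤ ω j * poiDom k zlo zhi j := by
    intro j
    have hω0 : 0 ≤ ω j := le_trans (by positivity) (hω j)
    rw [abs_mul, abs_of_nonneg (poiProb_nonneg hz.le j), mul_assoc, mul_comm]
    exact mul_le_mul (hω j) (poiProb_le_poiDom hlo h1 h2 j) (poiProb_nonneg hz.le j) hω0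
  have hs' := Summable.of_nonneg_of_le (fun j => by positivity) hle hs
  exact ⟨hs', hs'.tsum_le_tsum hle hs⟩

end weights

section moments

variable {k : ℕ} {zlo zhi : ℝ}

/-- Number of ordered pairs of distinct elements lying in a common fibre. -/
def pairCount {E V : Type*} [Fintype E] [Fintype V] [DecidableEq V] (t : E → V) : ℝ :=
  ∑ v, (deg t v : ℝ) * (deg t v - 1)

/-- Second factorial moment of the conditioned Poisson law. -/
noncomputable def facMom (k : ℕ) (z : ℝ) : ℝ := z ^ 2 * fk (k - 2) z / fk k z

lemma facMom_nonneg {z : ℝ} (hz : 0 < z) : 0 ≤ facMom k z := by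
  have := fk_pos k hz; have := fk_pos (k - 2) hz
  unfold facMom; positivity

lemma facMom_le (hk : 2 ≤ k) {z : ℝ} (hlo : 0 < zlo) (h1 : zlo ≤ z) (h2 : z ≤ zhi) :
    facMom k z ≤ ∑' j : ℕ, (1 + (j : ℝ)) ^ 2 * poiDom k zlo zhi j := by
  have hz : 0 < z := hlo.trans_le h1
  have h := hasSum_mul_pred_mul_poiProb (z := z) hk
  have hhi : 0 ≤ zhi := hz.le.trans h2
  refine hasSum_le (fun j => ?_) h (summable_pow_mul_poiDom k hlo hhi 2).hasSum
  have h3 : (j : ℝ) * (j - 1) ≤ (1 + j) ^ 2 := by nlinarith [Nat.cast_nonneg (α := ℝ) j]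
  exact mul_le_mul h3 (poiProb_le_poiDom hlo h1 h2 j) (poiProb_nonneg hz.le j) (by positivity)

/-- Concentration of the pair count. -/
lemma exists_pairCount_bounds (hk : 2 ≤ k) (hlo : 0 < zlo) (hhi : zlo ≤ zhi) :
    ∃ C : ℝ, 0 < C ∧ ∃ N0 : ℕ, 4 ≤ N0 ∧ ∀ z N M, Tuned k zlo zhi z N M → N0 ≤ N →
      |∑ t ∈ ksurj k (Fin M) (Fin N), (pairCount t - N * facMom k z)| ≤
          C * #(ksurj k (Fin M) (Fin N)) ∧
      ∑ t ∈ ksurj k (Fin M) (Fin N), (pairCount t - N * facMom k z) ^ 2 ≤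
          C * N * #(ksurj k (Fin M) (Fin N)) := by
  obtain ⟨C0, hC0, N0, hN0, hpeel⟩ := exists_peel hk hlo hhi
  have hhi0 : 0 ≤ zhi := hlo.le.trans hhi
  set μ0 := ∑' j : ℕ, (1 + (j : ℝ)) ^ 2 * poiDom k zlo zhi j with hμ0
  have hμ00 : 0 ≤ μ0 := tsum_nonneg fun j => mul_nonneg (by positivity) (poiDom_nonneg hlo hhi0 j)
  set B1 := ∑' j : ℕ, ((1 + μ0) * (1 + (j : ℝ)) ^ 4) * poiDom k zlo zhi j with hB1
  set B2 := ∑' j : ℕ, ((1 + μ0) ^ 2 * (1 + (j : ℝ)) ^ 6) * poiDom k zlo zhi j with hB2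
  have hs1 : Summable fun j : ℕ => ((1 + μ0) * (1 + (j : ℝ)) ^ 4) * poiDom k zlo zhi j := by
    simpa only [mul_assoc] using (summable_pow_mul_poiDom k hlo hhi0 4).mul_left (1 + μ0)
  have hs2 : Summable fun j : ℕ => ((1 + μ0) ^ 2 * (1 + (j : ℝ)) ^ 6) * poiDom k zlo zhi j := by
    simpa only [mul_assoc] using (summable_pow_mul_poiDom k hlo hhi0 6).mul_left ((1 + μ0) ^ 2)
  have hB10 : 0 ≤ B1 := tsum_nonneg fun j => mul_nonneg (by positivity) (poiDom_nonneg hlo hhi0 j)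
  have hB20 : 0 ≤ B2 := tsum_nonneg fun j => mul_nonneg (by positivity) (poiDom_nonneg hlo hhi0 j)
  refine ⟨C0 * (B1 + B2 + B1 * B1) + 1, by positivity, N0, hN0, fun z N M hT hN => ?_⟩
  obtain ⟨hq, hp⟩ := hpeel z N M hT hN
  have hz : 0 < z := hlo.trans_le hT.lo
  have hN4 : 4 ≤ N := hN0.trans hN
  have hNpos : (0 : ℝ) < N := by positivity
  have hA := normConst_pos (k := k) (N := N) (M := M) hz
  set K := ksurj k (Fin M) (Fin N) with hK
  have hKc : (#K : ℝ) = normConst k z N M * hitProb k z N M := card_ksurj_fin hz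
  set Φ : ℕ → ℝ := fun j => (j : ℝ) * (j - 1) - facMom k z with hΦ
  have hfm0 := facMom_nonneg (k := k) hz
  have hfm1 : facMom k z ≤ μ0 := facMom_le hk hlo hT.lo hT.hi
  have hΦb : ∀ j, |Φ j| ≤ (1 + μ0) * (1 + (j : ℝ)) ^ 2 := by
    intro j
    have hj : (0 : ℝ) ≤ j := Nat.cast_nonneg j
    have h5 : 0 ≤ (j : ℝ) * (j - 1) := by
      rcases Nat.eq_zero_or_pos j with h | h
      · simp [h]
      · have : (1 : ℝ) ≤ j := by exact_mod_cast h
        exact mul_nonneg hj (by linarith)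
    have h6 : (j : ℝ) * (j - 1) ≤ (1 + j) ^ 2 := by nlinarith
    have h7 : μ0 ≤ μ0 * (1 + (j : ℝ)) ^ 2 :=
      le_mul_of_one_le_right hμ00 (one_le_pow₀ (by linarith))
    rw [hΦ, abs_le]
    constructor <;> [nlinarith; nlinarith]
  have hΦ0 : HasSum (fun j => poiProb k z j * Φ j) 0 := by
    have h := (hasSum_mul_pred_mul_poiProb (z := z) hk).sub ((hasSum_poiProb (k := k) hz).mul_right
      (facMom k z))
    rw [one_mul, ← facMom, sub_self] at h
    exact hasSum_of_eq h fun j => by simp only [hΦ]; ring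
  obtain ⟨w1, w2⟩ := poi_weight (k := k) hlo hT.lo hT.hi (φ := Φ)
    (ω := fun j => (1 + μ0) * (1 + (j : ℝ)) ^ 4) (fun j => by
      calc _ ≤ (1 + μ0) * (1 + (j : ℝ)) ^ 2 * (1 + (j : ℝ)) ^ 2 := by gcongr; exact hΦb j
        _ = _ := by ring) hs1
  obtain ⟨w3, w4⟩ := poi_weight (k := k) hlo hT.lo hT.hi (φ := fun j => Φ j * Φ j)
    (ω := fun j => (1 + μ0) ^ 2 * (1 + (j : ℝ)) ^ 6) (fun j => by
      rw [abs_mul]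
      calc _ ≤ ((1 + μ0) * (1 + (j : ℝ)) ^ 2) * ((1 + μ0) * (1 + (j : ℝ)) ^ 2) *
              (1 + (j : ℝ)) ^ 2 := by gcongr <;> exact hΦb j
        _ = _ := by ring) hs2
  obtain ⟨w5, w6, w7⟩ := cauchy_weight w1 w1 w2 w2 hΦ0
  have hone : ∀ v : Fin N, |∑ t ∈ K, Φ (deg t v)| ≤ C0 * B1 / N * #K := by
    intro v
    rw [hK, sum_ksurj_deg hz, abs_mul, abs_of_pos hA, ← hK, hKc]
    have := ((hp 1 (by norm_num) _ B1 w1 w2).2 hΦ0)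
    calc _ ≤ normConst k z N M * (C0 * B1 / N * hitProb k z N M) := by gcongr
      _ = _ := by ring
  have hsq : ∀ v : Fin N, ∑ t ∈ K, Φ (deg t v) * Φ (deg t v) ≤ C0 * B2 * #K := by
    intro v
    refine (le_abs_self _).trans ?_
    rw [hK, sum_ksurj_deg hz (fun j => Φ j * Φ j), abs_mul, abs_of_pos hA, ← hK, hKc]
    have := ((hp 1 (by norm_num) _ B2 w3 w4).1)
    calc _ ≤ normConst k z N M * (C0 * B2 * hitProb k z N M) := by gcongr
      _ = _ := by ring
  have htwo : ∀ u v : Fin N, u ≠ v → ∑ t ∈ K, Φ (deg t u) * Φ (deg t v) ≤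
      C0 * (B1 * B1) / N * #K := by
    intro u v huv
    refine (le_abs_self _).trans ?_
    rw [hK, sum_ksurj_deg_deg hz _ _ huv, abs_mul, abs_of_pos hA, ← hK, hKc]
    have := ((hp 2 (by norm_num) _ (B1 * B1) w5 w6).2 w7)
    calc _ ≤ normConst k z N M * (C0 * (B1 * B1) / N * hitProb k z N M) := by gcongr
      _ = _ := by ring
  have hcent : ∀ t : Fin M → Fin N, pairCount t - N * facMom k z = ∑ v, Φ (deg t v) := by
    intro t
    simp [pairCount, hΦ, sum_sub_distrib]
  have hKnn : (0 : ℝ) ≤ #K := by positivity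
  have hNc : ∑ _v : Fin N, (1 : ℝ) = N := by simp
  simp only [hcent]
  constructor
  · rw [sum_comm]
    refine (abs_sum_le_sum_abs _ _).trans ((sum_le_sum fun v _ => hone v).trans ?_)
    rw [sum_const, card_univ, Fintype.card_fin, nsmul_eq_mul]
    have e1 : (N : ℝ) * (C0 * B1 / N * #K) = C0 * B1 * #K := by field_simp
    rw [e1]
    gcongr
    have : 0 ≤ C0 * (B2 + B1 * B1) := by positivity
    linarith
  · have hexp : ∀ t : Fin M → Fin N, (∑ v, Φ (deg t v)) ^ 2 =
        ∑ u, ∑ v, Φ (deg t u) * Φ (deg t v) := fun t => by rw [sq, sum_mul_sum]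
    simp only [hexp]
    rw [sum_comm]
    have hrow : ∀ u : Fin N, ∑ t ∈ K, ∑ v, Φ (deg t u) * Φ (deg t v) ≤
        (C0 * B2 + C0 * (B1 * B1)) * #K := by
      intro u
      rw [sum_comm, ← add_sum_erase univ _ (mem_univ u)]
      have h8 : ∑ v ∈ univ.erase u, ∑ t ∈ K, Φ (deg t u) * Φ (deg t v) ≤ C0 * (B1 * B1) * #K := by
        refine (sum_le_sum fun v hv => htwo u v (ne_of_mem_erase hv).symm).trans ?_
        rw [sum_const, nsmul_eq_mul, card_erase_of_mem (mem_univ u), card_univ, Fintype.card_fin]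
        have h9 : ((N - 1 : ℕ) : ℝ) ≤ N := by exact_mod_cast Nat.sub_le _ _
        calc _ ≤ (N : ℝ) * (C0 * (B1 * B1) / N * #K) := by gcongr
          _ = _ := by field_simp
      have := hsq u
      linarith
    refine (sum_le_sum fun u _ => hrow u).trans ?_
    rw [sum_const, card_univ, Fintype.card_fin, nsmul_eq_mul]
    have h10 : 0 ≤ C0 * B1 := by positivity
    calc (N : ℝ) * ((C0 * B2 + C0 * (B1 * B1)) * #K)
        = (C0 * B2 + C0 * (B1 * B1)) * N * #K := by ring
      _ ≤ (C0 * (B1 + B2 + B1 * B1) + 1) * N * #K := by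
        have h11 : C0 * B2 + C0 * (B1 * B1) ≤ C0 * (B1 + B2 + B1 * B1) + 1 := by
          have h12 : C0 * (B1 + B2 + B1 * B1) = C0 * B1 + C0 * B2 + C0 * (B1 * B1) := by ring
          linarith
        gcongr

/-- Exponential tail of the largest fibre. -/
lemma exists_maxDeg_bound (hk : 2 ≤ k) (hlo : 0 < zlo) (hhi : zlo ≤ zhi) :
    ∃ C : ℝ, 0 < C ∧ ∃ N0 : ℕ, 4 ≤ N0 ∧ ∀ z N M, Tuned k zlo zhi z N M → N0 ≤ N → ∀ L : ℝ,
      (#((ksurj k (Fin M) (Fin N)).filter fun t => ∃ v, L < deg t v) : ℝ) ≤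
          C * N * Real.exp (-L / 2) * #(ksurj k (Fin M) (Fin N)) := by
  obtain ⟨C0, hC0, N0, hN0, hpeel⟩ := exists_peel hk hlo hhi
  have hhi0 : 0 ≤ zhi := hlo.le.trans hhi
  set B := ∑' j : ℕ, (16 * Real.exp j) * poiDom k zlo zhi j with hB
  have hs : Summable fun j : ℕ => (16 * Real.exp j) * poiDom k zlo zhi j := by
    simpa only [mul_assoc] using (summable_exp_mul_poiDom k zlo zhi).mul_left 16
  have hB0 : 0 ≤ B := tsum_nonneg fun j => mul_nonneg (by positivity) (poiDom_nonneg hlo hhi0 j)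
  refine ⟨C0 * B + 1, by positivity, N0, hN0, fun z N M hT hN L => ?_⟩
  obtain ⟨hq, hp⟩ := hpeel z N M hT hN
  have hz : 0 < z := hlo.trans_le hT.lo
  have hA := normConst_pos (k := k) (N := N) (M := M) hz
  set K := ksurj k (Fin M) (Fin N) with hK
  have hKc : (#K : ℝ) = normConst k z N M * hitProb k z N M := card_ksurj_fin hz
  obtain ⟨w1, w2⟩ := poi_weight (k := k) hlo hT.lo hT.hi (φ := fun j => Real.exp ((j : ℝ) / 2))
    (ω := fun j => 16 * Real.exp j) (fun j => by
      rw [abs_of_pos (Real.exp_pos _)]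
      have h1 := Real.add_one_le_exp ((j : ℝ) / 4)
      have h2 : (1 + (j : ℝ)) ^ 2 ≤ (4 * Real.exp ((j : ℝ) / 4)) ^ 2 := by
        gcongr; linarith [Nat.cast_nonneg (α := ℝ) j]
      calc _ ≤ Real.exp ((j : ℝ) / 2) * (4 * Real.exp ((j : ℝ) / 4)) ^ 2 := by gcongr
        _ = 16 * Real.exp j := by
          rw [mul_pow, ← Real.exp_nat_mul]
          rw [show (j : ℝ) = (j : ℝ) / 2 + ((2 : ℕ) : ℝ) * ((j : ℝ) / 4) by push_cast; ring,
            Real.exp_add]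
          ring_nf) hs
  have hone : ∀ v : Fin N, ∑ t ∈ K, Real.exp ((deg t v : ℝ) / 2) ≤ C0 * B * #K := by
    intro v
    refine (le_abs_self _).trans ?_
    rw [hK, sum_ksurj_deg hz (fun j => Real.exp ((j : ℝ) / 2)), abs_mul, abs_of_pos hA, ← hK, hKc]
    have := (hp 1 (by norm_num) _ B w1 w2).1
    calc _ ≤ normConst k z N M * (C0 * B * hitProb k z N M) := by gcongr
      _ = _ := by ring
  have hind : ∀ t : Fin M → Fin N, (if ∃ v, L < deg t v then (1 : ℝ) else 0) ≤
      ∑ v, Real.exp (-L / 2) * Real.exp ((deg t v : ℝ) / 2) := by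
    intro t
    split_ifs with h
    · obtain ⟨v, hv⟩ := h
      refine le_trans ?_ (single_le_sum (fun v _ => by positivity) (mem_univ v))
      rw [← Real.exp_add]
      exact Real.one_le_exp (by linarith)
    · exact sum_nonneg fun v _ => by positivity
  rw [card_filter]
  push_cast
  calc _ ≤ ∑ t ∈ K, ∑ v, Real.exp (-L / 2) * Real.exp ((deg t v : ℝ) / 2) :=
        sum_le_sum fun t _ => hind t
    _ = ∑ v : Fin N, Real.exp (-L / 2) * ∑ t ∈ K, Real.exp ((deg t v : ℝ) / 2) := by
        rw [sum_comm]; simp only [mul_sum]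
    _ ≤ ∑ v : Fin N, Real.exp (-L / 2) * (C0 * B * #K) := by
        gcongr with v; exact hone v
    _ = C0 * B * N * Real.exp (-L / 2) * #K := by
        rw [sum_const, card_univ, Fintype.card_fin, nsmul_eq_mul]; ring
    _ ≤ _ := by gcongr; linarith

end moments

end DicoreCount

namespace DicoreCount

open Finset

lemma abs_pow_sub_pow_le {s : ℝ} (h0 : 0 ≤ s) (h1 : s ≤ 1) (a b : ℕ) :
    |s ^ a - s ^ b| ≤ |(a : ℝ) - b| := by
  have key : ∀ a d : ℕ, |s ^ a - s ^ (a + d)| ≤ d := by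
    intro a d
    have hb : 1 - s ^ d ≤ d := by
      have := one_add_mul_sub_le_pow (a := s) (by linarith) d
      have h3 : (d : ℝ) * (1 - s) ≤ d * 1 := by gcongr; linarith
      linarith
    have hd : s ^ d ≤ 1 := pow_le_one₀ h0 h1
    have ha : s ^ a ≤ 1 := pow_le_one₀ h0 h1
    have ha0 : 0 ≤ s ^ a := by positivity
    rw [pow_add, show s ^ a - s ^ a * s ^ d = s ^ a * (1 - s ^ d) by ring,
      abs_of_nonneg (mul_nonneg ha0 (by linarith))]
    calc s ^ a * (1 - s ^ d) ≤ 1 * (1 - s ^ d) := by gcongr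
      _ ≤ d := by linarith
  rcases le_total a b with h | h
  · obtain ⟨d, rfl⟩ := Nat.exists_eq_add_of_le h
    refine (key a d).trans (le_of_eq ?_)
    push_cast
    rw [show (a : ℝ) - (a + d) = -d by ring, abs_neg, Nat.abs_cast]
  · obtain ⟨d, rfl⟩ := Nat.exists_eq_add_of_le h
    rw [abs_sub_comm]
    refine (key b d).trans (le_of_eq ?_)
    push_cast
    rw [show (b : ℝ) + d - b = d by ring, Nat.abs_cast]

/-- Poisson approximation by size-bias coupling. -/
lemma poisson_approx {Ω A : Type*} [Fintype Ω] (I : Finset A) (X : Ω → ℕ) {p δ : ℝ} (hp : 0 ≤ p)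
    (T : A → Ω → Ω)
    (hsize : ∀ F : ℕ → ℝ, ∑ ω, (X ω : ℝ) * F (X ω) = p * ∑ a ∈ I, ∑ ω, F (X (T a ω)))
    (hpos : ∀ a ∈ I, ∀ ω, 1 ≤ X (T a ω))
    (herr : p * ∑ a ∈ I, ∑ ω, |(X (T a ω) : ℝ) - 1 - X ω| ≤ δ * Fintype.card Ω) :
    |(#{ω | X ω = 0} : ℝ) - Real.exp (-(p * #I)) * Fintype.card Ω| ≤ δ * Fintype.card Ω := by
  set lam := p * #I with hlam
  have hlam0 : 0 ≤ lam := by positivity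
  set φ : ℝ → ℝ := fun s => ∑ ω, s ^ X ω with hφ
  have hφ' : ∀ s, HasDerivAt φ (∑ ω, (X ω : ℝ) * s ^ (X ω - 1)) s := fun s =>
    HasDerivAt.fun_sum fun ω _ => hasDerivAt_pow (X ω) s
  set g : ℝ → ℝ := fun s => φ s * Real.exp (-lam * s) with hg
  have hg' : ∀ s, HasDerivAt g ((∑ ω, (X ω : ℝ) * s ^ (X ω - 1) - lam * φ s) *
      Real.exp (-lam * s)) s := by
    intro s
    have h1 : HasDerivAt (fun s : ℝ => Real.exp (-lam * s)) (Real.exp (-lam * s) * (-lam * 1)) s :=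
      ((hasDerivAt_id s).const_mul (-lam)).exp
    exact ((hφ' s).mul h1).congr_deriv (by ring)
  have hbd : ∀ s ∈ Set.Icc (0 : ℝ) 1, ‖(∑ ω, (X ω : ℝ) * s ^ (X ω - 1) - lam * φ s) *
      Real.exp (-lam * s)‖ ≤ δ * Fintype.card Ω := by
    rintro s ⟨h0, h1⟩
    have hE : Real.exp (-lam * s) ≤ 1 := Real.exp_le_one_iff.2 (by nlinarith)
    have hlamφ : lam * φ s = p * ∑ a ∈ I, ∑ ω, s ^ X ω := by
      rw [sum_const, nsmul_eq_mul, hlam, hφ]; ring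
    rw [norm_mul, Real.norm_eq_abs, Real.norm_eq_abs, abs_of_pos (Real.exp_pos _)]
    calc _ ≤ |∑ ω, (X ω : ℝ) * s ^ (X ω - 1) - lam * φ s| * 1 := by gcongr
      _ = |p * ∑ a ∈ I, ∑ ω, (s ^ (X (T a ω) - 1) - s ^ X ω)| := by
          rw [mul_one, hsize fun x => s ^ (x - 1), hlamφ, ← mul_sub]
          simp only [sum_sub_distrib]
      _ ≤ p * ∑ a ∈ I, ∑ ω, |(X (T a ω) : ℝ) - 1 - X ω| := by
          rw [abs_mul, abs_of_nonneg hp]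
          gcongr
          refine (abs_sum_le_sum_abs _ _).trans (sum_le_sum fun a ha => ?_)
          refine (abs_sum_le_sum_abs _ _).trans (sum_le_sum fun ω _ => ?_)
          refine (abs_pow_sub_pow_le h0 h1 _ _).trans (le_of_eq ?_)
          rw [Nat.cast_sub (hpos a ha ω), Nat.cast_one]
      _ ≤ _ := herr
  have hmv := (convex_Icc (0 : ℝ) 1).norm_image_sub_le_of_norm_hasDerivWithin_le
    (fun s _ => (hg' s).hasDerivWithinAt) hbd (Set.left_mem_Icc.2 zero_le_one)
    (Set.right_mem_Icc.2 zero_le_one)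
  have hg0 : g 0 = #{ω | X ω = 0} := by
    simp only [hg, hφ, mul_zero, Real.exp_zero, mul_one, zero_pow_eq]
    rw [Finset.sum_boole]
  have hg1 : g 1 = Real.exp (-lam) * Fintype.card Ω := by
    simp [hg, hφ, mul_comm]
  rw [hg0, hg1] at hmv
  rw [abs_sub_comm]
  simpa using hmv

variable {V : Type*} [Fintype V] [DecidableEq V]

/-- Permutations with prescribed values on a set. -/
lemma card_perm_eqOn_le (Z : Finset V) (g : V → V) :
    #{σ : Equiv.Perm V | ∀ z ∈ Z, σ z = g z} ≤ (Fintype.card V - #Z).factorial := by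
  rcases Finset.eq_empty_or_nonempty ({σ : Equiv.Perm V | ∀ z ∈ Z, σ z = g z} : Finset _)
    with h | ⟨σ0, h0⟩
  · rw [h]; simp
  simp only [mem_filter, mem_univ, true_and] at h0
  have hc : Fintype.card (Equiv.Perm {a // a ∉ Z}) = (Fintype.card V - #Z).factorial := by
    rw [Fintype.card_perm]
    congr 1
    rw [Fintype.card_subtype_compl, Fintype.card_coe]
  rw [← hc, Fintype.card_congr (Equiv.Perm.subtypeEquivSubtypePerm (fun a => a ∉ Z)),
    ← Fintype.card_coe]
  refine Fintype.card_le_of_injective (fun σ => ⟨σ0⁻¹ * σ.1, fun a ha => ?_⟩) ?_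
  · have := σ.2
    simp only [mem_filter, mem_univ, true_and] at this
    rw [not_not] at ha
    rw [Equiv.Perm.mul_apply, this a ha, ← h0 a ha, Equiv.Perm.inv_def, Equiv.symm_apply_apply]
  · intro a b hab
    exact Subtype.ext (mul_left_cancel (congrArg Subtype.val hab))

lemma card_perm_one_le (x g : V) :
    #{σ : Equiv.Perm V | σ x = g} ≤ (Fintype.card V - 1).factorial := by
  have := card_perm_eqOn_le {x} (fun _ => g)
  simpa using this

lemma card_perm_two_le {x y : V} (hxy : x ≠ y) (g g' : V) :
    #{σ : Equiv.Perm V | σ x = g ∧ σ y = g'} ≤ (Fintype.card V - 2).factorial := by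
  have := card_perm_eqOn_le {x, y} (fun v => if v = x then g else g')
  simpa [hxy.symm, card_pair hxy] using this

lemma card_perm_three_le {x y w : V} (hxy : x ≠ y) (hxw : x ≠ w) (hyw : y ≠ w) (g g' g'' : V) :
    #{σ : Equiv.Perm V | σ x = g ∧ σ y = g' ∧ σ w = g''} ≤ (Fintype.card V - 3).factorial := by
  have := card_perm_eqOn_le {x, y, w} (fun v => if v = x then g else if v = y then g' else g'')
  have hc : #({x, y, w} : Finset V) = 3 := card_eq_three.2 ⟨x, y, w, hxy, hxw, hyw, rfl⟩
  simpa [hxy.symm, hxw.symm, hyw.symm, hc] using this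

/-- Forcing the value of a permutation at one point by a transposition. -/
lemma sum_perm_swap (a b : V) (F : Equiv.Perm V → ℝ) (S : Finset (Equiv.Perm V)) (Z : Finset V)
    (hS : ∀ σ ∈ S, σ a ∈ Z) (hb : b ∈ Z)
    (hinv : ∀ σ ∈ S, ∀ c ∈ Z, ∀ d ∈ Z, Equiv.swap c d * σ ∈ S) :
    ∑ σ ∈ S, F (Equiv.swap (σ a) b * σ) = #Z * ∑ σ ∈ S with σ a = b, F σ := by
  rw [← sum_fiberwise_of_maps_to hS, ← nsmul_eq_mul, ← sum_const]
  refine sum_congr rfl fun c hc => ?_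
  refine sum_nbij' (fun σ => Equiv.swap c b * σ) (fun σ => Equiv.swap c b * σ) ?_ ?_ ?_ ?_ ?_
  · intro σ hσ
    rw [mem_filter] at hσ ⊢
    exact ⟨hinv σ hσ.1 c hc b hb, by rw [Equiv.Perm.mul_apply, hσ.2, Equiv.swap_apply_left]⟩
  · intro σ hσ
    rw [mem_filter] at hσ ⊢
    exact ⟨hinv σ hσ.1 c hc b hb, by rw [Equiv.Perm.mul_apply, hσ.2, Equiv.swap_apply_right]⟩
  · intro σ _; rw [← mul_assoc, Equiv.swap_mul_self, one_mul]
  · intro σ _; rw [← mul_assoc, Equiv.swap_mul_self, one_mul]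
  · intro σ hσ
    rw [mem_filter] at hσ
    rw [hσ.2]

lemma abs_card_sub_card_le {α : Type*} [DecidableEq α] {A B C : Finset α} (h1 : A \ B ⊆ C)
    (h2 : B \ A ⊆ C) : |(#A : ℝ) - #B| ≤ #C := by
  have ha : #A ≤ #B + #C := by
    have := card_le_card h1
    have := le_card_sdiff B A
    omega
  have hb : #B ≤ #A + #C := by
    have := card_le_card h2
    have := le_card_sdiff A B
    omega
  have ha' : (#A : ℝ) ≤ #B + #C := by exact_mod_cast ha
  have hb' : (#B : ℝ) ≤ #A + #C := by exact_mod_cast hb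
  rw [abs_le]
  constructor <;> linarith

end DicoreCount

namespace DicoreCount

open Finset

variable {N M : ℕ}

lemma sum_card_filter_comm {α β : Type*} (s : Finset α) (r : Finset β) (P : α → β → Prop)
    [∀ a b, Decidable (P a b)] :
    ∑ a ∈ s, #{b ∈ r | P a b} = ∑ b ∈ r, #{a ∈ s | P a b} := by
  simp only [card_filter]
  exact sum_comm

lemma factorial_sub_one_eq (hN : 1 ≤ N) : ((N - 1).factorial : ℝ) = N.factorial / N := by
  obtain ⟨n, rfl⟩ := Nat.exists_eq_add_of_le' hN
  rw [Nat.add_sub_cancel, Nat.factorial_succ]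
  push_cast
  field_simp

lemma factorial_sub_two_le (hN : 2 ≤ N) :
    ((N - 2).factorial : ℝ) ≤ 2 * N.factorial / (N : ℝ) ^ 2 := by
  obtain ⟨n, rfl⟩ := Nat.exists_eq_add_of_le' hN
  rw [Nat.add_sub_cancel, Nat.factorial_succ, Nat.factorial_succ, le_div_iff₀ (by positivity)]
  push_cast
  have : ((n : ℝ) + 2) ^ 2 ≤ 2 * ((n + 1 + 1) * (n + 1)) := by
    have : (0 : ℝ) ≤ n := by positivity
    nlinarith
  have h2 : (0 : ℝ) ≤ n.factorial := by positivity
  calc (n.factorial : ℝ) * (n + 2) ^ 2 ≤ n.factorial * (2 * ((n + 1 + 1) * (n + 1))) := by gcongr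
    _ = _ := by ring

lemma factorial_sub_three_le (hN : 4 ≤ N) :
    ((N - 3).factorial : ℝ) ≤ 3 * N.factorial / (N : ℝ) ^ 3 := by
  obtain ⟨n, rfl⟩ := Nat.exists_eq_add_of_le' hN
  rw [show n + 4 - 3 = n + 1 by omega, Nat.factorial_succ (n + 3), Nat.factorial_succ (n + 2),
    Nat.factorial_succ (n + 1), le_div_iff₀ (by positivity)]
  push_cast
  have h0 : (0 : ℝ) ≤ n := by positivity
  have : ((n : ℝ) + 4) ^ 3 ≤ 3 * ((n + 3 + 1) * ((n + 2 + 1) * (n + 1 + 1))) := by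
    have h2 : (0 : ℝ) ≤ (n : ℝ) ^ 2 := by positivity
    have h3 : (0 : ℝ) ≤ (n : ℝ) ^ 3 := by positivity
    ring_nf
    linarith
  have h2 : (0 : ℝ) ≤ (n + 1).factorial := by positivity
  calc ((n + 1).factorial : ℝ) * (n + 4) ^ 3
      ≤ (n + 1).factorial * (3 * ((n + 3 + 1) * ((n + 2 + 1) * (n + 1 + 1)))) := by gcongr
    _ = _ := by ring

/-- Number of edges that become loops when the heads are relabelled by `π`. -/
def loopCount (t h : Fin M → Fin N) (π : Equiv.Perm (Fin N)) : ℕ := #{e | π (h e) = t e}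

lemma loopCount_size (hN : 1 ≤ N) (t h : Fin M → Fin N) (F : ℕ → ℝ) :
    ∑ π, (loopCount t h π : ℝ) * F (loopCount t h π) = (1 / N : ℝ) * ∑ e ∈ (univ : Finset (Fin M)),
      ∑ π, F (loopCount t h (Equiv.swap (π (h e)) (t e) * π)) := by
  have h1 : ∀ e : Fin M, ∑ π, F (loopCount t h (Equiv.swap (π (h e)) (t e) * π)) =
      N * ∑ π with π (h e) = t e, F (loopCount t h π) := fun e => by
    have := sum_perm_swap (h e) (t e) (fun π => F (loopCount t h π)) univ univ
      (fun _ _ => mem_univ _) (mem_univ _) (fun _ _ _ _ _ _ => mem_univ _)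
    rwa [card_univ, Fintype.card_fin] at this
  simp only [h1]
  rw [← mul_sum, ← mul_assoc, one_div_mul_cancel (by positivity), one_mul]
  simp only [sum_filter]
  rw [sum_comm]
  refine sum_congr rfl fun π _ => ?_
  rw [← sum_filter, sum_const, nsmul_eq_mul, loopCount]

lemma loopCount_err (t h : Fin M → Fin N)
    (hinj : Function.Injective fun e => (t e, h e)) (e : Fin M) (π : Equiv.Perm (Fin N)) :
    |(loopCount t h (Equiv.swap (π (h e)) (t e) * π) : ℝ) - 1 - loopCount t h π| ≤
      ((#{e' | h e ≠ h e' ∧ π (h e) = t e' ∧ π (h e') = t e} +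
        #{e' | h e' = h e ∧ π (h e) = t e'} + #{e' | t e' = t e ∧ π (h e') = t e} : ℕ) : ℝ) := by
  set τ := Equiv.swap (π (h e)) (t e) * π with hτ
  have hτe : τ (h e) = t e := by simp [hτ]
  have hmem : e ∈ ({e' | τ (h e') = t e'} : Finset (Fin M)) := by simpa using hτe
  have h1 : (loopCount t h τ : ℝ) - 1 = #(({e' | τ (h e') = t e'} : Finset (Fin M)).erase e) := by
    rw [cast_card_erase_of_mem hmem, loopCount]
  rw [h1, loopCount]
  refine (abs_card_sub_card_le (C := ({e' | h e ≠ h e' ∧ π (h e) = t e' ∧ π (h e') = t e} : Finset (Fin M)) ∪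
        ({e' | h e' = h e ∧ π (h e) = t e'} : Finset (Fin M)) ∪
        ({e' | t e' = t e ∧ π (h e') = t e} : Finset (Fin M))) ?_ ?_).trans ?_
  · intro x hx
    simp only [mem_sdiff, mem_erase, mem_filter, mem_univ, true_and, mem_union] at hx ⊢
    obtain ⟨⟨hxe, hx1⟩, hx2⟩ := hx
    rw [hτ, Equiv.Perm.mul_apply, Equiv.swap_apply_def] at hx1
    split_ifs at hx1 with h3 h4
    · have h5 := π.injective h3
      exact absurd (hinj (Prod.ext hx1.symm h5)) hxe
    · exact Or.inl (Or.inl ⟨fun h6 => h3 (by rw [h6]), hx1, h4⟩)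
    · exact absurd hx1 hx2
  · intro x hx
    simp only [mem_sdiff, mem_erase, mem_filter, mem_univ, true_and, mem_union, not_and] at hx ⊢
    obtain ⟨hx1, hx2⟩ := hx
    by_cases h3 : h x = h e
    · exact Or.inl (Or.inr ⟨h3, by rw [← h3, hx1]⟩)
    by_cases h4 : t x = t e
    · exact Or.inr ⟨h4, by rw [hx1, h4]⟩
    · refine absurd ?_ (hx2 fun h5 => h3 (by rw [h5]))
      rw [hτ, Equiv.Perm.mul_apply, Equiv.swap_apply_of_ne_of_ne, hx1]
      · exact fun h5 => h3 (π.injective h5)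
      · rw [hx1]; exact h4
  · exact_mod_cast (card_union_le _ _).trans (Nat.add_le_add_right (card_union_le _ _) _)

lemma loopCount_total_err (t h : Fin M → Fin N) {Δ : ℕ}
    (ht : ∀ v, deg t v ≤ Δ) (hh : ∀ v, deg h v ≤ Δ) (e : Fin M) :
    ∑ π : Equiv.Perm (Fin N), (#{e' | h e ≠ h e' ∧ π (h e) = t e' ∧ π (h e') = t e} +
        #{e' | h e' = h e ∧ π (h e) = t e'} + #{e' | t e' = t e ∧ π (h e') = t e}) ≤
      M * (N - 2).factorial + 2 * Δ * (N - 1).factorial := by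
  have key : ∀ (P : Fin M → Prop) [DecidablePred P]
      (Q : Fin M → Equiv.Perm (Fin N) → Prop) [∀ a b, Decidable (Q a b)] (B : ℕ),
      (∀ e', P e' → #{π | Q e' π} ≤ B) →
      ∑ π, #{e' | P e' ∧ Q e' π} ≤ #{e' | P e'} * B := by
    intro P _ Q _ B hB
    rw [sum_card_filter_comm, card_eq_sum_ones, sum_mul, sum_filter]
    refine sum_le_sum fun e' _ => ?_
    split_ifs with hP
    · simpa [hP] using hB e' hP
    · simp [hP]
  rw [sum_add_distrib, sum_add_distrib]
  have h1 := key (fun e' => h e ≠ h e') (fun e' π => π (h e) = t e' ∧ π (h e') = t e)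
    (N - 2).factorial (fun e' he' => by simpa using card_perm_two_le he' (t e') (t e))
  have h2 := key (fun e' => h e' = h e) (fun e' π => π (h e) = t e')
    (N - 1).factorial (fun e' he' => by simpa using card_perm_one_le (h e) (t e'))
  have h3 := key (fun e' => t e' = t e) (fun e' π => π (h e') = t e)
    (N - 1).factorial (fun e' he' => by simpa using card_perm_one_le (h e') (t e))
  have c1 : #{e' | h e ≠ h e'} ≤ M := (card_filter_le _ _).trans (by simp)
  have c2 : #{e' | h e' = h e} ≤ Δ := hh (h e)
  have c3 : #{e' | t e' = t e} ≤ Δ := ht (t e)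
  calc _ ≤ M * (N - 2).factorial + Δ * (N - 1).factorial + Δ * (N - 1).factorial :=
        Nat.add_le_add (Nat.add_le_add (h1.trans (Nat.mul_le_mul_right _ c1))
          (h2.trans (Nat.mul_le_mul_right _ c2))) (h3.trans (Nat.mul_le_mul_right _ c3))
    _ = _ := by ring

/-- Relabelling the heads uniformly, the number of loops is nearly Poisson of mean `M / N`. -/
lemma loops_approx (hN : 2 ≤ N) (t h : Fin M → Fin N)
    (hinj : Function.Injective fun e => (t e, h e)) {Δ : ℕ}
    (ht : ∀ v, deg t v ≤ Δ) (hh : ∀ v, deg h v ≤ Δ) :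
    |(#{π : Equiv.Perm (Fin N) | ∀ e, π (h e) ≠ t e} : ℝ) -
        Real.exp (-((M : ℝ) / N)) * N.factorial| ≤
      (M / N * (2 * (M / N) + 2 * Δ) / N : ℝ) * N.factorial := by
  have hN0 : (0 : ℝ) < N := by positivity
  have h := poisson_approx (Ω := Equiv.Perm (Fin N)) (univ : Finset (Fin M)) (loopCount t h)
    (p := 1 / N) (δ := M / N * (2 * (M / N) + 2 * Δ) / N) (by positivity)
    (fun e π => Equiv.swap (π (h e)) (t e) * π)
    (loopCount_size (by omega) t h)
    (fun e _ π => card_pos.2 ⟨e, mem_filter.2 ⟨mem_univ _, by simp⟩⟩) ?_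
  · rw [Fintype.card_perm, Fintype.card_fin, card_univ, Fintype.card_fin] at h
    rw [show (1 / N : ℝ) * M = M / N by ring] at h
    convert h using 6
    simp [loopCount, card_eq_zero, filter_eq_empty_iff]
  · rw [Fintype.card_perm, Fintype.card_fin]
    have h2 : ∀ e : Fin M, ∑ π, |(loopCount t h (Equiv.swap (π (h e)) (t e) * π) : ℝ) - 1 -
        loopCount t h π| ≤ M * (2 * N.factorial / (N : ℝ) ^ 2) + 2 * Δ * (N.factorial / N) := by
      intro e
      refine (sum_le_sum fun π _ => loopCount_err t h hinj e π).trans ?_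
      rw [← Nat.cast_sum]
      refine (Nat.cast_le.2 (loopCount_total_err t h ht hh e)).trans ?_
      push_cast
      rw [factorial_sub_one_eq (by omega)]
      gcongr
      exact factorial_sub_two_le hN
    calc _ ≤ (1 / N : ℝ) * ∑ e : Fin M,
          (M * (2 * N.factorial / (N : ℝ) ^ 2) + 2 * Δ * (N.factorial / N)) := by
            gcongr with e _
            exact h2 e
      _ = _ := by
        rw [sum_const, card_univ, Fintype.card_fin, nsmul_eq_mul]
        field_simp

end DicoreCount

namespace DicoreCount

open Finset

variable {N M : ℕ}

section counts

variable {t h : Fin M → Fin N} {Δ : ℕ}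

lemma card_perm_image_le (hh : ∀ v, deg h v ≤ Δ) (y : Fin M) (c : Fin N) :
    #{σ : Equiv.Perm (Fin M) | h (σ y) = c} ≤ Δ * (M - 1).factorial := by
  calc #{σ : Equiv.Perm (Fin M) | h (σ y) = c}
      ≤ #(({g | h g = c} : Finset (Fin M)).biUnion
          fun g => {σ : Equiv.Perm (Fin M) | σ y = g}) := by
        refine card_le_card fun σ hσ => ?_
        simpa using hσ
    _ ≤ #{g | h g = c} * (M - 1).factorial := card_biUnion_le_card_mul _ _ _ fun g _ => by
        simpa using card_perm_one_le y g
    _ ≤ _ := Nat.mul_le_mul_right _ (hh c)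

lemma card_perm_fix_image_le (hh : ∀ v, deg h v ≤ Δ) {x y : Fin M} (hxy : x ≠ y) (f : Fin M)
    (c : Fin N) :
    #{σ : Equiv.Perm (Fin M) | σ x = f ∧ h (σ y) = c} ≤ Δ * (M - 2).factorial := by
  calc #{σ : Equiv.Perm (Fin M) | σ x = f ∧ h (σ y) = c}
      ≤ #(({g | h g = c} : Finset (Fin M)).biUnion
          fun g => {σ : Equiv.Perm (Fin M) | σ x = f ∧ σ y = g}) := by
        refine card_le_card fun σ hσ => ?_
        simpa [and_comm] using hσ
    _ ≤ #{g | h g = c} * (M - 2).factorial := card_biUnion_le_card_mul _ _ _ fun g _ => by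
        simpa using card_perm_two_le hxy f g
    _ ≤ _ := Nat.mul_le_mul_right _ (hh c)

lemma card_perm_two_fix_image_le (hh : ∀ v, deg h v ≤ Δ) {x w y : Fin M} (hxw : x ≠ w)
    (hxy : x ≠ y) (hwy : w ≠ y) (f f' : Fin M) (c : Fin N) :
    #{σ : Equiv.Perm (Fin M) | σ x = f ∧ σ w = f' ∧ h (σ y) = c} ≤ Δ * (M - 3).factorial := by
  calc #{σ : Equiv.Perm (Fin M) | σ x = f ∧ σ w = f' ∧ h (σ y) = c}
      ≤ #(({g | h g = c} : Finset (Fin M)).biUnion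
          fun g => {σ : Equiv.Perm (Fin M) | σ x = f ∧ σ w = f' ∧ σ y = g}) := by
        refine card_le_card fun σ hσ => ?_
        simp only [mem_filter, mem_univ, true_and, mem_biUnion] at hσ ⊢
        exact ⟨_, hσ.2.2, hσ.1, hσ.2.1, rfl⟩
    _ ≤ #{g | h g = c} * (M - 3).factorial := card_biUnion_le_card_mul _ _ _ fun g _ => by
        simpa using card_perm_three_le hxw hxy hwy f f' g
    _ ≤ _ := Nat.mul_le_mul_right _ (hh c)

lemma card_perm_coincide_le (hh : ∀ v, deg h v ≤ Δ) {x y : Fin M} (hxy : x ≠ y) :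
    #{σ : Equiv.Perm (Fin M) | h (σ y) = h (σ x)} ≤ M * (Δ * (M - 2).factorial) := by
  calc #{σ : Equiv.Perm (Fin M) | h (σ y) = h (σ x)}
      ≤ #((univ : Finset (Fin M)).biUnion
          fun f => {σ : Equiv.Perm (Fin M) | σ x = f ∧ h (σ y) = h f}) := by
        refine card_le_card fun σ hσ => ?_
        simpa using hσ
    _ ≤ #(univ : Finset (Fin M)) * _ := card_biUnion_le_card_mul _ _ _ fun f _ =>
        card_perm_fix_image_le hh hxy f (h f)
    _ = _ := by rw [card_univ, Fintype.card_fin]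

lemma card_perm_fix_coincide_le (hh : ∀ v, deg h v ≤ Δ) {x w y : Fin M} (hxw : x ≠ w)
    (hxy : x ≠ y) (hwy : w ≠ y) (f : Fin M) :
    #{σ : Equiv.Perm (Fin M) | σ x = f ∧ h (σ y) = h (σ w)} ≤ M * (Δ * (M - 3).factorial) := by
  calc #{σ : Equiv.Perm (Fin M) | σ x = f ∧ h (σ y) = h (σ w)}
      ≤ #((univ : Finset (Fin M)).biUnion
          fun f' => {σ : Equiv.Perm (Fin M) | σ x = f ∧ σ w = f' ∧ h (σ y) = h f'}) := by
        refine card_le_card fun σ hσ => ?_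
        simpa using hσ
    _ ≤ #(univ : Finset (Fin M)) * _ := card_biUnion_le_card_mul _ _ _ fun f' _ =>
        card_perm_two_fix_image_le hh hxw hxy hwy f f' (h f')
    _ = _ := by rw [card_univ, Fintype.card_fin]

lemma sum_perm_symm {β : Type*} [AddCommMonoid β] (F : Equiv.Perm (Fin M) → β) :
    ∑ σ : Equiv.Perm (Fin M), F σ.symm = ∑ σ, F σ :=
  Fintype.sum_equiv (Equiv.inv (Equiv.Perm (Fin M))) _ _ fun _ => rfl

lemma card_perm_symm (P : Equiv.Perm (Fin M) → Prop) [DecidablePred P] :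
    #{σ : Equiv.Perm (Fin M) | P σ.symm} = #{σ | P σ} := by
  simp only [card_filter]
  exact sum_perm_symm fun σ => if P σ then 1 else 0

/-- Common form of the first-moment bounds below. -/
lemma sum_card_and_le {Ω : Type*} [Fintype Ω] {B : ℕ} (P : Fin M → Prop) [DecidablePred P]
    (Q : Fin M → Ω → Prop) [∀ a b, Decidable (Q a b)] (hB : ∀ y, P y → #{σ | Q y σ} ≤ B) :
    ∑ σ, #{y | P y ∧ Q y σ} ≤ #{y | P y} * B := by
  rw [sum_card_filter_comm, card_eq_sum_ones, sum_mul, sum_filter]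
  refine sum_le_sum fun e' _ => ?_
  split_ifs with hP
  · simpa [hP] using hB e' hP
  · simp [hP]

lemma sum_near_one_le (ht : ∀ v, deg t v ≤ Δ) (hh : ∀ v, deg h v ≤ Δ) (u c : Fin N) :
    ∑ σ : Equiv.Perm (Fin M), #{y | t y = u ∧ h (σ y) = c} ≤
      Δ * (Δ * (M - 1).factorial) :=
  (sum_card_and_le _ _ fun y _ => card_perm_image_le hh y c).trans
    (Nat.mul_le_mul_right _ (ht u))

lemma sum_near_two_le (ht : ∀ v, deg t v ≤ Δ) (hh : ∀ v, deg h v ≤ Δ) (u : Fin N) (e : Fin M) :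
    ∑ σ : Equiv.Perm (Fin M), #{y | (t y = u ∧ y ≠ e) ∧ h (σ y) = h (σ e)} ≤
      Δ * (M * (Δ * (M - 2).factorial)) :=
  (sum_card_and_le _ _ fun _ hy => card_perm_coincide_le hh hy.2.symm).trans
    (Nat.mul_le_mul_right _ ((card_le_card (monotone_filter_right _ fun _ _ h => h.1)).trans (ht u)))

lemma sum_near_two_symm_le (ht : ∀ v, deg t v ≤ Δ) (hh : ∀ v, deg h v ≤ Δ) (u : Fin N)
    (f : Fin M) :
    ∑ σ : Equiv.Perm (Fin M), #{y | (h (σ y) = u ∧ σ y ≠ f) ∧ t y = t (σ.symm f)} ≤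
      Δ * (M * (Δ * (M - 2).factorial)) := by
  refine le_trans (le_of_eq ?_) (sum_near_two_le hh ht u f)
  rw [← sum_perm_symm]
  refine sum_congr rfl fun σ _ => ?_
  refine card_equiv σ.symm fun y => ?_
  simp

lemma sum_near_three_le (ht : ∀ v, deg t v ≤ Δ) (hh : ∀ v, deg h v ≤ Δ) (e f : Fin M) :
    ∑ σ : Equiv.Perm (Fin M), #{y | (σ y ≠ f ∧ y ≠ e) ∧ t y = t (σ.symm f) ∧ h (σ y) = h (σ e)} ≤
      M * (Δ * (M * (Δ * (M - 3).factorial) + Δ * (M - 2).factorial)) := by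
  calc _ ≤ ∑ σ : Equiv.Perm (Fin M), ∑ x : Fin M,
        #{y | (t y = t x ∧ y ≠ x ∧ y ≠ e) ∧ σ x = f ∧ h (σ y) = h (σ e)} := by
        refine sum_le_sum fun σ _ => ?_
        refine le_trans (card_le_card fun y hy => ?_)
          (single_le_sum (f := fun x => #{y | (t y = t x ∧ y ≠ x ∧ y ≠ e) ∧ σ x = f ∧
            h (σ y) = h (σ e)}) (fun _ _ => Nat.zero_le _) (mem_univ (σ.symm f)))
        simp only [mem_filter, mem_univ, true_and, Equiv.apply_symm_apply] at hy ⊢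
        exact ⟨⟨hy.2.1, fun h3 => hy.1.1 (by rw [h3, Equiv.apply_symm_apply]), hy.1.2⟩, hy.2.2⟩
    _ = ∑ x : Fin M, ∑ σ : Equiv.Perm (Fin M),
        #{y | (t y = t x ∧ y ≠ x ∧ y ≠ e) ∧ σ x = f ∧ h (σ y) = h (σ e)} := sum_comm
    _ ≤ ∑ _x : Fin M, Δ * (M * (Δ * (M - 3).factorial) + Δ * (M - 2).factorial) := by
        refine sum_le_sum fun x _ => ?_
        refine (sum_card_and_le _ _ fun y hy => ?_).trans (Nat.mul_le_mul_right _
          ((card_le_card (monotone_filter_right _ fun _ _ h => h.1)).trans (ht (t x))))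
        obtain ⟨_, h1, h2⟩ := hy
        by_cases hxe : x = e
        · refine le_trans (le_trans (card_le_card fun σ hσ => ?_)
            (card_perm_fix_image_le hh h1.symm f (h f))) (Nat.le_add_left _ _)
          simp only [mem_filter, mem_univ, true_and] at hσ ⊢
          exact ⟨hσ.1, by rw [hσ.2, ← hxe, hσ.1]⟩
        · exact (card_perm_fix_coincide_le hh hxe h1.symm h2.symm f).trans (Nat.le_add_right _ _)
    _ = _ := by rw [sum_const, card_univ, Fintype.card_fin, smul_eq_mul]

end counts

end DicoreCount

namespace DicoreCount

open Finset

variable {N M : ℕ}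

/-- Ordered pairs of distinct elements with equal images. -/
def twins (t : Fin M → Fin N) : Finset (Fin M × Fin M) := {q | q.1 ≠ q.2 ∧ t q.1 = t q.2}

/-- Increasing pairs with equal images. -/
def ltTwins (t : Fin M → Fin N) : Finset (Fin M × Fin M) := {q | q.1 < q.2 ∧ t q.1 = t q.2}

lemma card_twins (t : Fin M → Fin N) : (#(twins t) : ℝ) = pairCount t := by
  have h1 : ∀ v, #{q : Fin M × Fin M | (q.1 ≠ q.2 ∧ t q.1 = t q.2) ∧ t q.1 = v} =
      deg t v * deg t v - deg t v := by
    intro v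
    rw [show deg t v = #{e | t e = v} from rfl, ← offDiag_card]
    congr 1
    ext q
    simp only [mem_filter, mem_univ, true_and, mem_offDiag]
    constructor
    · rintro ⟨⟨h1, h2⟩, h3⟩; exact ⟨h3, h2 ▸ h3, h1⟩
    · rintro ⟨h1, h2, h3⟩; exact ⟨⟨h3, h1.trans h2.symm⟩, h1⟩
  have h2 : #(twins t) = ∑ v, (deg t v * deg t v - deg t v) := by
    rw [twins, card_eq_sum_card_fiberwise (f := fun q => t q.1) (t := univ) (fun _ _ => mem_univ _)]
    refine sum_congr rfl fun v _ => ?_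
    rw [← h1 v, filter_filter]
  rw [h2, pairCount, Nat.cast_sum]
  refine sum_congr rfl fun v _ => ?_
  rw [Nat.cast_sub (Nat.le_mul_self _)]
  push_cast
  ring

lemma card_ltTwins (t : Fin M → Fin N) : (#(ltTwins t) : ℝ) = pairCount t / 2 := by
  have h : #(twins t) = #(ltTwins t) + #(ltTwins t) := by
    have h1 : twins t = ltTwins t ∪ (ltTwins t).map (Equiv.prodComm _ _).toEmbedding := by
      ext ⟨a, b⟩
      simp only [twins, ltTwins, mem_filter, mem_univ, true_and, mem_union, mem_map_equiv,
        Equiv.prodComm_symm, Equiv.prodComm_apply, Prod.swap]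
      rw [lt_or_lt_iff_ne.symm]
      constructor
      · rintro ⟨h | h, h2⟩
        exacts [Or.inl ⟨h, h2⟩, Or.inr ⟨h, h2.symm⟩]
      · rintro (⟨h, h2⟩ | ⟨h, h2⟩)
        exacts [⟨Or.inl h, h2⟩, ⟨Or.inr h, h2.symm⟩]
    rw [h1, card_union_of_disjoint, card_map]
    rw [disjoint_left]
    rintro ⟨a, b⟩ hab
    simp only [ltTwins, mem_filter, mem_univ, true_and, mem_map_equiv, Equiv.prodComm_symm,
      Equiv.prodComm_apply, Prod.swap, not_and] at hab ⊢
    exact fun h => absurd h hab.1.asymm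
  rw [← card_twins, h]
  push_cast
  ring

lemma card_twins_le {t : Fin M → Fin N} {Δ : ℕ} (ht : ∀ v, deg t v ≤ Δ) :
    #(twins t) ≤ M * Δ := by
  calc #(twins t) ≤ #((univ : Finset (Fin M)).biUnion
        fun x => ({y | t y = t x} : Finset (Fin M)).image fun y => (x, y)) := by
        refine card_le_card fun q hq => ?_
        simp only [twins, mem_filter, mem_univ, true_and] at hq
        simp only [mem_biUnion, mem_univ, true_and, mem_image, mem_filter]
        exact ⟨q.1, q.2, hq.2.symm, rfl⟩
    _ ≤ #(univ : Finset (Fin M)) * Δ := card_biUnion_le_card_mul _ _ _ fun x _ =>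
        card_image_le.trans (ht (t x))
    _ = _ := by rw [card_univ, Fintype.card_fin]

/-- Number of repeated edges when the heads are permuted by `σ`. -/
def dblCount (t h : Fin M → Fin N) (σ : Equiv.Perm (Fin M)) : ℕ :=
  #{q ∈ ltTwins t | h (σ q.1) = h (σ q.2)}

lemma dblCount_eq_zero (t h : Fin M → Fin N) (σ : Equiv.Perm (Fin M)) :
    dblCount t h σ = 0 ↔ Function.Injective fun e => (t e, h (σ e)) := by
  rw [dblCount, card_eq_zero, filter_eq_empty_iff]
  simp only [ltTwins, mem_filter, mem_univ, true_and, Prod.forall, and_imp]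
  constructor
  · intro H a b hab
    simp only [Prod.mk.injEq] at hab
    rcases lt_trichotomy a b with h1 | h1 | h1
    · exact absurd hab.2 (H a b h1 hab.1)
    · exact h1
    · exact absurd hab.2.symm (H b a h1 hab.1.symm)
  · intro H a b hab h1 h2
    exact hab.ne (H (Prod.ext h1 h2))

/-- Force `σ q.1 = r.1` and `σ q.2 = r.2` by two transpositions. -/
def force (q r : Fin M × Fin M) (σ : Equiv.Perm (Fin M)) : Equiv.Perm (Fin M) :=
  Equiv.swap ((Equiv.swap (σ q.1) r.1 * σ) q.2) r.2 * (Equiv.swap (σ q.1) r.1 * σ)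

lemma sum_force {q r : Fin M × Fin M} (hq : q.1 ≠ q.2) (hr : r.1 ≠ r.2)
    (F : Equiv.Perm (Fin M) → ℝ) :
    ∑ σ, F (force q r σ) =
      ((M : ℝ) * (M - 1)) * ∑ σ with σ q.1 = r.1 ∧ σ q.2 = r.2, F σ := by
  have h1 := sum_perm_swap q.1 r.1 (fun ρ => F (Equiv.swap (ρ q.2) r.2 * ρ)) univ univ
      (fun _ _ => mem_univ _) (mem_univ _) (fun _ _ _ _ _ _ => mem_univ _)
  have h2 := sum_perm_swap q.2 r.2 F {σ | σ q.1 = r.1} (univ.erase r.1)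
    (fun σ hσ => by
      simp only [mem_filter, mem_univ, true_and] at hσ
      simp only [mem_erase, mem_univ, and_true, ← hσ]
      exact fun h => hq (σ.injective h).symm) (by simpa using hr.symm)
    (fun σ hσ c hc d hd => by
      simp only [mem_filter, mem_univ, true_and] at hσ ⊢
      simp only [mem_erase, mem_univ, and_true] at hc hd
      rw [Equiv.Perm.mul_apply, hσ, Equiv.swap_apply_of_ne_of_ne hc.symm hd.symm])
  have hM : 1 ≤ M := Fin.pos q.1
  rw [card_erase_of_mem (mem_univ _), card_univ, Fintype.card_fin, filter_filter] at h2
  rw [h2, card_univ, Fintype.card_fin, Nat.cast_sub hM, Nat.cast_one, ← mul_assoc] at h1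
  exact h1

lemma dblCount_size (hM : 2 ≤ M) (t h : Fin M → Fin N) (F : ℕ → ℝ) :
    ∑ σ, (dblCount t h σ : ℝ) * F (dblCount t h σ) =
      (1 / ((M : ℝ) * (M - 1))) * ∑ a ∈ ltTwins t ×ˢ twins h,
        ∑ σ, F (dblCount t h (force a.1 a.2 σ)) := by
  have hM1 : (2 : ℝ) ≤ M := by exact_mod_cast hM
  have h1 : ∀ a ∈ ltTwins t ×ˢ twins h, ∑ σ, F (dblCount t h (force a.1 a.2 σ)) =
      ((M : ℝ) * (M - 1)) * ∑ σ with σ a.1.1 = a.2.1 ∧ σ a.1.2 = a.2.2, F (dblCount t h σ) := by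
    intro a ha
    simp only [mem_product, ltTwins, twins, mem_filter, mem_univ, true_and] at ha
    exact sum_force ha.1.1.ne ha.2.1 fun σ => F (dblCount t h σ)
  rw [sum_congr rfl h1, ← mul_sum, ← mul_assoc, one_div_mul_cancel
    (mul_pos (by linarith) (by linarith)).ne', one_mul]
  simp only [sum_filter]
  rw [sum_comm]
  refine sum_congr rfl fun σ _ => ?_
  rw [sum_product, dblCount, ← nsmul_eq_mul, ← sum_const, sum_filter]
  refine sum_congr rfl fun q hq => ?_
  simp only [ltTwins, mem_filter, mem_univ, true_and] at hq
  rw [← sum_filter]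
  have h3 : {r ∈ twins h | σ q.1 = r.1 ∧ σ q.2 = r.2} =
      if h (σ q.1) = h (σ q.2) then {(σ q.1, σ q.2)} else ∅ := by
    split_ifs with h4
    · ext r
      simp only [twins, mem_filter, mem_univ, true_and, mem_singleton]
      constructor
      · rintro ⟨_, h5, h6⟩; rw [h5, h6]
      · rintro rfl; exact ⟨⟨fun h5 => hq.1.ne (σ.injective h5), h4⟩, rfl, rfl⟩
    · rw [filter_eq_empty_iff]
      rintro r hr ⟨h5, h6⟩
      simp only [twins, mem_filter, mem_univ, true_and] at hr
      exact h4 (by rw [h5, h6, hr.2])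
  rw [h3]
  split_ifs with h4
  · rw [sum_singleton]
  · rw [sum_empty]

section coupling

variable {t h : Fin M → Fin N} {e e' f f' : Fin M} {σ : Equiv.Perm (Fin M)}

/-- The points where forcing may change the permutation. -/
def touched (e e' f f' : Fin M) (σ : Equiv.Perm (Fin M)) : Finset (Fin M) :=
  {e, e', σ.symm f, σ.symm f'}

lemma force_fst (he : e ≠ e') (hf : f ≠ f') : force (e, e') (f, f') σ e = f := by
  have h1 : (Equiv.swap (σ e) f * σ) e = f := by simp
  rw [force, Equiv.Perm.mul_apply, h1, Equiv.swap_apply_of_ne_of_ne _ hf]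
  intro h2
  exact he ((Equiv.swap (σ e) f * σ).injective (h1.trans h2))

lemma force_snd : force (e, e') (f, f') σ e' = f' := by
  rw [force, Equiv.Perm.mul_apply, Equiv.swap_apply_left]

lemma force_of_notMem {x : Fin M} (hx : x ∉ touched e e' f f' σ) :
    force (e, e') (f, f') σ x = σ x := by
  simp only [touched, mem_insert, mem_singleton, not_or] at hx
  obtain ⟨h1, h2, h3, h4⟩ := hx
  have h5 : (Equiv.swap (σ e) f * σ) x = σ x := by
    rw [Equiv.Perm.mul_apply, Equiv.swap_apply_of_ne_of_ne]
    · exact fun h => h1 (σ.injective h)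
    · rintro rfl; simp at h3
  rw [force, Equiv.Perm.mul_apply, h5, Equiv.swap_apply_of_ne_of_ne]
  · rw [← h5]
    exact fun h => h2 ((Equiv.swap (σ e) f * σ).injective h)
  · rintro rfl; simp at h4

lemma symm_force_mem {x : Fin M} (hx : x ∈ touched e e' f f' σ) :
    σ.symm (force (e, e') (f, f') σ x) ∈ touched e e' f f' σ := by
  by_contra hc
  have h1 := force_of_notMem hc
  rw [Equiv.apply_symm_apply] at h1
  rw [(force (e, e') (f, f') σ).injective h1] at hc
  exact hc hx

/-- Outside points sharing both a tail and a head with touched points. -/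
def near (t h : Fin M → Fin N) (e e' f f' : Fin M) (σ : Equiv.Perm (Fin M)) : Finset (Fin M) :=
  {y | y ∉ touched e e' f f' σ ∧ (∃ a ∈ touched e e' f f' σ, t y = t a) ∧
    ∃ b ∈ touched e e' f f' σ, h (σ y) = h (σ b)}

/-- Exceptional coincidences among the touched points. -/
def clash (t h : Fin M → Fin N) (e e' f f' : Fin M) (σ : Equiv.Perm (Fin M)) : Prop :=
  h (σ e) = h (σ e') ∨ t (σ.symm f) = t (σ.symm f') ∨
    t (σ.symm f) = t e ∨ t (σ.symm f) = t e' ∨ t (σ.symm f') = t e ∨ t (σ.symm f') = t e'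

instance : Decidable (clash t h e e' f f' σ) := by unfold clash; infer_instance

lemma clash_of_twins {x y : Fin M} (hx : x ∈ touched e e' f f' σ) (hy : y ∈ touched e e' f f' σ)
    (hxy : x < y) (he : e < e') (ht : t x = t y) (hne : (x, y) ≠ (e, e')) :
    clash t h e e' f f' σ := by
  simp only [touched, mem_insert, mem_singleton] at hx hy
  unfold clash
  rcases hx with rfl | rfl | rfl | rfl <;> rcases hy with rfl | rfl | rfl | rfl <;>
    first
      | exact absurd hxy (lt_irrefl _)
      | exact absurd rfl hne
      | exact absurd hxy he.asymm
      | simp [ht]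

lemma dblCount_err (he : e < e') (hte : t e = t e') (hf : f ≠ f') (hhf : h f = h f') :
    |(dblCount t h (force (e, e') (f, f') σ) : ℝ) - 1 - dblCount t h σ| ≤
      ((8 * #(near t h e e' f f' σ) + 16 * if clash t h e e' f f' σ then 1 else 0 : ℕ) : ℝ) := by
  set τ := force (e, e') (f, f') σ with hτ
  set A := touched e e' f f' σ with hA
  set R := near t h e e' f f' σ with hR
  have heA : e ∈ A := by simp [hA, touched]
  have hAc : #A ≤ 4 := card_le_four
  have hmem : (e, e') ∈ ({q ∈ ltTwins t | h (τ q.1) = h (τ q.2)} : Finset _) := by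
    simp only [ltTwins, mem_filter, mem_univ, true_and]
    exact ⟨⟨he, hte⟩, by rw [hτ, force_fst he.ne hf, force_snd, hhf]⟩
  have h1 : (dblCount t h τ : ℝ) - 1 =
      #(({q ∈ ltTwins t | h (τ q.1) = h (τ q.2)} : Finset _).erase (e, e')) := by
    rw [cast_card_erase_of_mem hmem, dblCount]
  set B : Finset (Fin M × Fin M) := if clash t h e e' f f' σ then A ×ˢ A else ∅ with hB
  have memR : ∀ x y : Fin M, x ∈ A → y ∉ A → t y = t x → (∃ b ∈ A, h (σ y) = h (σ b)) → y ∈ R := by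
    intro x y hx hy hty hb
    simp only [hR, near, mem_filter, mem_univ, true_and]
    exact ⟨hy, ⟨x, hx, hty⟩, hb⟩
  have hnew : ∀ x y, x ∈ A → y ∉ A → h (τ y) = h (τ x) → ∃ b ∈ A, h (σ y) = h (σ b) := by
    intro x y hx hy hxy
    refine ⟨σ.symm (τ x), symm_force_mem hx, ?_⟩
    rw [Equiv.apply_symm_apply, ← hxy, hτ, force_of_notMem hy]
  rw [h1, dblCount]
  refine (abs_card_sub_card_le (C := A ×ˢ R ∪ R ×ˢ A ∪ B) ?_ ?_).trans ?_
  · rintro ⟨x, y⟩ hq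
    simp only [mem_sdiff, mem_erase, ltTwins, mem_filter, mem_univ, true_and, not_and] at hq
    obtain ⟨⟨hne, ⟨hxy, hty⟩, hh⟩, hold⟩ := hq
    simp only [mem_union, mem_product]
    by_cases hx : x ∈ A <;> by_cases hy : y ∈ A
    · have hcl : clash t h e e' f f' σ := clash_of_twins hx hy hxy he hty hne
      exact Or.inr (by simp [hB, hcl, hx, hy])
    · exact Or.inl (Or.inl ⟨hx, memR x y hx hy hty.symm (hnew x y hx hy hh.symm)⟩)
    · exact Or.inl (Or.inr ⟨memR y x hy hx hty (hnew y x hy hx hh), hy⟩)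
    · refine absurd ?_ (hold ⟨hxy, hty⟩)
      rwa [hτ, force_of_notMem hx, force_of_notMem hy] at hh
  · rintro ⟨x, y⟩ hq
    simp only [mem_sdiff, mem_erase, ltTwins, mem_filter, mem_univ, true_and, not_and] at hq
    obtain ⟨⟨⟨hxy, hty⟩, hh⟩, hnw⟩ := hq
    simp only [mem_union, mem_product]
    by_cases hx : x ∈ A <;> by_cases hy : y ∈ A
    · have hcl : clash t h e e' f f' σ := by
        by_cases hne : (x, y) = (e, e')
        · simp only [Prod.mk.injEq] at hne
          rw [hne.1, hne.2] at hh
          exact Or.inl hh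
        · exact clash_of_twins hx hy hxy he hty hne
      exact Or.inr (by simp [hB, hcl, hx, hy])
    · exact Or.inl (Or.inl ⟨hx, memR x y hx hy hty.symm ⟨x, hx, hh.symm⟩⟩)
    · exact Or.inl (Or.inr ⟨memR y x hy hx hty ⟨y, hy, hh⟩, hy⟩)
    · refine absurd ?_ (hnw ?_ ⟨hxy, hty⟩)
      · rw [hτ, force_of_notMem hx, force_of_notMem hy]; exact hh
      · intro h3
        simp only [Prod.mk.injEq] at h3
        exact hx (h3.1 ▸ heA)
  · refine Nat.cast_le.2 ?_
    have hBc : #B ≤ 16 * if clash t h e e' f f' σ then 1 else 0 := by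
      rw [hB]
      split_ifs
      · rw [card_product]; exact (Nat.mul_le_mul hAc hAc).trans (by norm_num)
      · simp
    calc _ ≤ #(A ×ˢ R) + #(R ×ˢ A) + #B :=
          (card_union_le _ _).trans (Nat.add_le_add_right (card_union_le _ _) _)
      _ ≤ 4 * #R + #R * 4 + 16 * (if clash t h e e' f f' σ then 1 else 0) := by
          rw [card_product, card_product]
          gcongr
      _ = _ := by ring

end coupling

end DicoreCount

namespace DicoreCount

open Finset

variable {N M : ℕ} {t h : Fin M → Fin N} {Δ : ℕ} {e e' f f' : Fin M}

lemma mem_touched {σ : Equiv.Perm (Fin M)} {a : Fin M} (ha : a ∈ touched e e' f f' σ) :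
    a ∈ ({e, e'} : Finset (Fin M)) ∨ ∃ f0 ∈ ({f, f'} : Finset (Fin M)), a = σ.symm f0 := by
  simp only [touched, mem_insert, mem_singleton] at ha ⊢
  rcases ha with h | h | h | h
  · exact Or.inl (Or.inl h)
  · exact Or.inl (Or.inr h)
  · exact Or.inr ⟨f, Or.inl rfl, h⟩
  · exact Or.inr ⟨f', Or.inr rfl, h⟩

lemma symm_mem_touched {σ : Equiv.Perm (Fin M)} {f0 : Fin M}
    (hf : f0 ∈ ({f, f'} : Finset (Fin M))) : σ.symm f0 ∈ touched e e' f f' σ := by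
  simp only [touched, mem_insert, mem_singleton] at hf ⊢
  rcases hf with rfl | rfl <;> simp

lemma left_mem_touched {σ : Equiv.Perm (Fin M)} {e0 : Fin M}
    (he : e0 ∈ ({e, e'} : Finset (Fin M))) : e0 ∈ touched e e' f f' σ := by
  simp only [touched, mem_insert, mem_singleton] at he ⊢
  rcases he with rfl | rfl <;> simp

lemma card_near_le (σ : Equiv.Perm (Fin M)) : #(near t h e e' f f' σ) ≤
    ∑ p ∈ ({e, e'} : Finset (Fin M)) ×ˢ ({f, f'} : Finset (Fin M)),
        #{y | t y = t p.1 ∧ h (σ y) = h p.2} +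
    ∑ p ∈ ({e, e'} : Finset (Fin M)) ×ˢ ({e, e'} : Finset (Fin M)),
        #{y | (t y = t p.1 ∧ y ≠ p.2) ∧ h (σ y) = h (σ p.2)} +
    ∑ p ∈ ({f, f'} : Finset (Fin M)) ×ˢ ({f, f'} : Finset (Fin M)),
        #{y | (h (σ y) = h p.1 ∧ σ y ≠ p.2) ∧ t y = t (σ.symm p.2)} +
    ∑ p ∈ ({e, e'} : Finset (Fin M)) ×ˢ ({f, f'} : Finset (Fin M)),
        #{y | (σ y ≠ p.2 ∧ y ≠ p.1) ∧ t y = t (σ.symm p.2) ∧ h (σ y) = h (σ p.1)} := by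
  refine le_trans (card_le_card (t :=
    (({e, e'} : Finset (Fin M)) ×ˢ ({f, f'} : Finset (Fin M))).biUnion (fun p =>
        {y | t y = t p.1 ∧ h (σ y) = h p.2}) ∪
    (({e, e'} : Finset (Fin M)) ×ˢ ({e, e'} : Finset (Fin M))).biUnion (fun p =>
        {y | (t y = t p.1 ∧ y ≠ p.2) ∧ h (σ y) = h (σ p.2)}) ∪
    (({f, f'} : Finset (Fin M)) ×ˢ ({f, f'} : Finset (Fin M))).biUnion (fun p =>
        {y | (h (σ y) = h p.1 ∧ σ y ≠ p.2) ∧ t y = t (σ.symm p.2)}) ∪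
    (({e, e'} : Finset (Fin M)) ×ˢ ({f, f'} : Finset (Fin M))).biUnion (fun p =>
        {y | (σ y ≠ p.2 ∧ y ≠ p.1) ∧ t y = t (σ.symm p.2) ∧ h (σ y) = h (σ p.1)})) ?_)
    ((card_union_le _ _).trans (Nat.add_le_add
    ((card_union_le _ _).trans (Nat.add_le_add ((card_union_le _ _).trans (Nat.add_le_add
    card_biUnion_le card_biUnion_le)) card_biUnion_le)) card_biUnion_le))
  intro y hy
  simp only [near, mem_filter, mem_univ, true_and] at hy
  obtain ⟨hyA, ⟨a, ha, hta⟩, b, hb, htb⟩ := hy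
  simp only [mem_union, mem_biUnion, mem_filter, mem_univ, true_and, mem_product, Prod.exists]
  have hne : ∀ f0 ∈ ({f, f'} : Finset (Fin M)), σ y ≠ f0 := by
    rintro f0 hf0 rfl
    exact hyA (by simpa using symm_mem_touched (σ := σ) (e := e) (e' := e') hf0)
  have hne' : ∀ e0 ∈ ({e, e'} : Finset (Fin M)), y ≠ e0 := by
    rintro e0 he0 rfl
    exact hyA (left_mem_touched he0)
  rcases mem_touched ha with ha | ⟨f0, hf0, rfl⟩ <;> rcases mem_touched hb with hb | ⟨f1, hf1, rfl⟩
  · exact Or.inl (Or.inl (Or.inr ⟨a, b, ⟨ha, hb⟩, ⟨hta, hne' b hb⟩, htb⟩))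
  · rw [Equiv.apply_symm_apply] at htb
    exact Or.inl (Or.inl (Or.inl ⟨a, f1, ⟨ha, hf1⟩, hta, htb⟩))
  · exact Or.inr ⟨b, f0, ⟨hb, hf0⟩, ⟨hne f0 hf0, hne' b hb⟩, hta, htb⟩
  · rw [Equiv.apply_symm_apply] at htb
    exact Or.inl (Or.inr ⟨f1, f0, ⟨hf1, hf0⟩, ⟨htb, hne f0 hf0⟩, hta⟩)

lemma card_pair_product_le (a b c d : Fin M) :
    #(({a, b} : Finset (Fin M)) ×ˢ ({c, d} : Finset (Fin M))) ≤ 4 := by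
  rw [card_product]
  exact (Nat.mul_le_mul card_le_two card_le_two).trans (by norm_num)

lemma sum_near_le (ht : ∀ v, deg t v ≤ Δ) (hh : ∀ v, deg h v ≤ Δ) :
    ∑ σ : Equiv.Perm (Fin M), #(near t h e e' f f' σ) ≤
      4 * (Δ * (Δ * (M - 1).factorial)) + 4 * (Δ * (M * (Δ * (M - 2).factorial))) +
      4 * (Δ * (M * (Δ * (M - 2).factorial))) +
      4 * (M * (Δ * (M * (Δ * (M - 3).factorial) + Δ * (M - 2).factorial))) := by
  have key : ∀ (s : Finset (Fin M × Fin M)) (G : Equiv.Perm (Fin M) → Fin M × Fin M → ℕ) (B : ℕ),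
      #s ≤ 4 → (∀ p, ∑ σ, G σ p ≤ B) → ∑ σ, ∑ p ∈ s, G σ p ≤ 4 * B := by
    intro s G B hs hB
    rw [sum_comm]
    refine (sum_le_card_nsmul s _ B fun p _ => hB p).trans ?_
    rw [smul_eq_mul]
    exact Nat.mul_le_mul_right _ hs
  refine (sum_le_sum fun σ _ => card_near_le σ).trans ?_
  rw [sum_add_distrib, sum_add_distrib, sum_add_distrib]
  refine Nat.add_le_add (Nat.add_le_add (Nat.add_le_add ?_ ?_) ?_) ?_
  · exact key _ _ _ (card_pair_product_le ..) fun p => sum_near_one_le ht hh _ _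
  · exact key _ _ _ (card_pair_product_le ..) fun p => sum_near_two_le ht hh _ _
  · exact key _ _ _ (card_pair_product_le ..) fun p => sum_near_two_symm_le ht hh _ _
  · exact key _ _ _ (card_pair_product_le ..) fun p => sum_near_three_le ht hh _ _

lemma sum_clash_le (ht : ∀ v, deg t v ≤ Δ) (hh : ∀ v, deg h v ≤ Δ) (he : e ≠ e') (hf : f ≠ f') :
    ∑ σ : Equiv.Perm (Fin M), (if clash t h e e' f f' σ then 1 else 0) ≤
      2 * (M * (Δ * (M - 2).factorial)) + 4 * (Δ * (M - 1).factorial) := by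
  have h1 : #{σ : Equiv.Perm (Fin M) | h (σ e) = h (σ e')} ≤ M * (Δ * (M - 2).factorial) :=
    card_perm_coincide_le hh he.symm
  have h2 : #{σ : Equiv.Perm (Fin M) | t (σ.symm f) = t (σ.symm f')} ≤
      M * (Δ * (M - 2).factorial) := by
    rw [card_perm_symm fun σ => t (σ f) = t (σ f')]
    exact card_perm_coincide_le ht hf.symm
  have h3 : ∀ f0 e0 : Fin M, #{σ : Equiv.Perm (Fin M) | t (σ.symm f0) = t e0} ≤
      Δ * (M - 1).factorial := fun f0 e0 => by
    rw [card_perm_symm fun σ => t (σ f0) = t e0]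
    exact card_perm_image_le ht f0 _
  rw [← card_filter]
  unfold clash
  simp only [filter_or]
  have a1 := h3 f e
  have a2 := h3 f e'
  have a3 := h3 f' e
  have a4 := h3 f' e'
  calc _ ≤ _ + (_ + (_ + (_ + (_ + _)))) :=
        (card_union_le _ _).trans <| Nat.add_le_add_left ((card_union_le _ _).trans <|
        Nat.add_le_add_left ((card_union_le _ _).trans <|
        Nat.add_le_add_left ((card_union_le _ _).trans <|
        Nat.add_le_add_left (card_union_le _ _) _) _) _) _
    _ ≤ _ := by omega

lemma sum_dblCount_err_le (hM : 4 ≤ M) (ht : ∀ v, deg t v ≤ Δ) (hh : ∀ v, deg h v ≤ Δ)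
    (he : e < e') (hte : t e = t e') (hf : f ≠ f') (hhf : h f = h f') :
    ∑ σ, |(dblCount t h (force (e, e') (f, f') σ) : ℝ) - 1 - dblCount t h σ| ≤
      500 * (Δ : ℝ) ^ 2 * (M.factorial / M) := by
  refine (sum_le_sum fun σ _ => dblCount_err he hte hf hhf).trans ?_
  rw [← Nat.cast_sum, sum_add_distrib, ← mul_sum, ← mul_sum]
  have h1 := Nat.add_le_add (Nat.mul_le_mul_left 8 (sum_near_le (e := e) (e' := e') (f := f)
    (f' := f') ht hh)) (Nat.mul_le_mul_left 16 (sum_clash_le ht hh he.ne hf))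
  refine (Nat.cast_le.2 h1).trans ?_
  push_cast
  have hM0 : (0 : ℝ) < M := by positivity
  have f1 := factorial_sub_one_eq (N := M) (by omega)
  have f2 : (M : ℝ) * (M - 2).factorial ≤ 2 * (M.factorial / M) := by
    have := factorial_sub_two_le (N := M) (by omega)
    calc (M : ℝ) * (M - 2).factorial ≤ M * (2 * M.factorial / (M : ℝ) ^ 2) := by gcongr
      _ = _ := by field_simp
  have f3 : (M : ℝ) ^ 2 * (M - 3).factorial ≤ 3 * (M.factorial / M) := by
    have := factorial_sub_three_le (N := M) (by omega)
    calc (M : ℝ) ^ 2 * (M - 3).factorial ≤ M ^ 2 * (3 * M.factorial / (M : ℝ) ^ 3) := by gcongr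
      _ = _ := by field_simp
  have hΔ : (Δ : ℝ) ≤ (Δ : ℝ) ^ 2 := by exact_mod_cast Nat.le_self_pow two_ne_zero Δ
  set D := (M.factorial : ℝ) / M with hD
  have hD0 : 0 ≤ D := by positivity
  rw [f1]
  calc _ = 32 * (Δ : ℝ) ^ 2 * D + 96 * (Δ : ℝ) ^ 2 * (M * (M - 2).factorial) +
        32 * (Δ : ℝ) ^ 2 * (M ^ 2 * (M - 3).factorial) +
        Δ * (32 * (M * (M - 2).factorial) + 64 * D) := by ring
    _ ≤ 32 * (Δ : ℝ) ^ 2 * D + 96 * (Δ : ℝ) ^ 2 * (2 * D) + 32 * (Δ : ℝ) ^ 2 * (3 * D) +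
        (Δ : ℝ) ^ 2 * (32 * (2 * D) + 64 * D) := by gcongr
    _ ≤ _ := by nlinarith [mul_nonneg (sq_nonneg (Δ : ℝ)) hD0]

/-- Permuting the heads uniformly, the number of repeated edges is nearly Poisson. -/
lemma doubles_approx (hM : 4 ≤ M) (ht : ∀ v, deg t v ≤ Δ) (hh : ∀ v, deg h v ≤ Δ) :
    |(#{σ : Equiv.Perm (Fin M) | Function.Injective fun e => (t e, h (σ e))} : ℝ) -
        Real.exp (-(pairCount t * pairCount h / (2 * (M * (M - 1))))) * M.factorial| ≤
      (1000 * (Δ : ℝ) ^ 4 / M) * M.factorial := by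
  have hM0 : (4 : ℝ) ≤ M := by exact_mod_cast hM
  have hMM : (0 : ℝ) < M * (M - 1) := mul_pos (by linarith) (by linarith)
  have hP := poisson_approx (Ω := Equiv.Perm (Fin M)) (ltTwins t ×ˢ twins h) (dblCount t h)
    (p := 1 / (M * (M - 1))) (δ := 1000 * (Δ : ℝ) ^ 4 / M) (by positivity)
    (fun a σ => force a.1 a.2 σ) (dblCount_size (by omega) t h) ?_ ?_
  · rw [Fintype.card_perm, Fintype.card_fin, card_product] at hP
    push_cast at hP
    rw [card_ltTwins, card_twins, show 1 / ((M : ℝ) * (M - 1)) * (pairCount t / 2 * pairCount h) =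
      pairCount t * pairCount h / (2 * (M * (M - 1))) by field_simp] at hP
    convert hP using 6
    rw [dblCount_eq_zero]
  · rintro ⟨⟨e, e'⟩, ⟨f, f'⟩⟩ ha σ
    simp only [mem_product, ltTwins, twins, mem_filter, mem_univ, true_and] at ha
    refine card_pos.2 ⟨(e, e'), ?_⟩
    simp only [ltTwins, mem_filter, mem_univ, true_and]
    exact ⟨ha.1, by rw [force_fst ha.1.1.ne ha.2.1, force_snd, ha.2.2]⟩
  · rw [Fintype.card_perm, Fintype.card_fin]
    have h2 : ∀ a ∈ ltTwins t ×ˢ twins h, ∑ σ, |(dblCount t h (force a.1 a.2 σ) : ℝ) - 1 -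
        dblCount t h σ| ≤ 500 * (Δ : ℝ) ^ 2 * (M.factorial / M) := by
      rintro ⟨⟨e, e'⟩, ⟨f, f'⟩⟩ ha
      simp only [mem_product, ltTwins, twins, mem_filter, mem_univ, true_and] at ha
      exact sum_dblCount_err_le hM ht hh ha.1.1 ha.1.2 ha.2.1 ha.2.2
    have hc : (#(ltTwins t ×ˢ twins h) : ℝ) ≤ (M * Δ) * (M * Δ) := by
      rw [card_product]
      have c1 : #(ltTwins t) ≤ M * Δ := le_trans (card_le_card fun q hq => by
        simp only [twins, ltTwins, mem_filter, mem_univ, true_and] at hq ⊢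
        exact ⟨hq.1.ne, hq.2⟩) (card_twins_le ht)
      exact_mod_cast Nat.mul_le_mul c1 (card_twins_le hh)
    have h3 := sum_le_sum h2
    rw [sum_const, nsmul_eq_mul] at h3
    calc _ ≤ 1 / ((M : ℝ) * (M - 1)) * (((M * Δ) * (M * Δ)) *
          (500 * (Δ : ℝ) ^ 2 * (M.factorial / M))) := by
            gcongr
            exact h3.trans (by gcongr)
      _ = (M / (M - 1)) * (500 * (Δ : ℝ) ^ 4 / M * M.factorial) := by
          have : (M : ℝ) - 1 ≠ 0 := by linarith
          field_simp
      _ ≤ 2 * (500 * (Δ : ℝ) ^ 4 / M * M.factorial) := by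
          gcongr
          rw [div_le_iff₀ (by linarith)]
          linarith
      _ = _ := by ring

end DicoreCount

namespace DicoreCount

open Finset

lemma abs_exp_neg_sub_le {l l0 : ℝ} (hl : 0 ≤ l) (hl0 : 0 ≤ l0) :
    |Real.exp (-l) - Real.exp (-l0) * (1 - (l - l0))| ≤ (l - l0) ^ 2 := by
  have key : ∀ x : ℝ, 0 ≤ x → Real.exp (-x) - 1 + x ≤ x ^ 2 := by
    intro x hx
    have h1 : Real.exp (-x) * (1 + x) ≤ 1 := by
      rw [Real.exp_neg, inv_mul_le_one₀ (Real.exp_pos _)]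
      linarith [Real.add_one_le_exp x]
    have h3 : Real.exp (-x) * (1 + x) ≤ (1 - x + x ^ 2) * (1 + x) := by
      have : (1 - x + x ^ 2) * (1 + x) = 1 + x ^ 3 := by ring
      rw [this]
      have : 0 ≤ x ^ 3 := by positivity
      linarith
    linarith [le_of_mul_le_mul_right h3 (by linarith)]
  set x := l - l0 with hx
  have e1 : Real.exp (-l) - Real.exp (-l0) * (1 - x) = Real.exp (-l0) * (Real.exp (-x) - 1 + x) := by
    have : Real.exp (-l) = Real.exp (-l0) * Real.exp (-x) := by rw [← Real.exp_add]; congr 1; ring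
    rw [this]; ring
  have h0 : 0 ≤ Real.exp (-x) - 1 + x := by linarith [Real.add_one_le_exp (-x)]
  rw [e1, abs_of_nonneg (by positivity)]
  rcases le_total 0 x with h | h
  · have h2 : Real.exp (-l0) ≤ 1 := Real.exp_le_one_iff.2 (by linarith)
    calc _ ≤ 1 * (Real.exp (-x) - 1 + x) := by gcongr
      _ ≤ _ := by rw [one_mul]; exact key x h
  · have h2 : Real.exp (-l0) ≤ Real.exp x := Real.exp_le_exp.2 (by linarith)
    calc _ ≤ Real.exp x * (Real.exp (-x) - 1 + x) := by gcongr
      _ = 1 - Real.exp x * (1 - x) := by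
          have : Real.exp x * Real.exp (-x) = 1 := by rw [← Real.exp_add]; simp
          linear_combination this
      _ ≤ 1 - (1 + x) * (1 - x) := by
          have := Real.add_one_le_exp x
          have h4 : (1 + x) * (1 - x) ≤ Real.exp x * (1 - x) := by gcongr <;> linarith
          linarith
      _ = x ^ 2 := by ring

lemma four_sq_le (a b c d : ℝ) : (a + b + c + d) ^ 2 ≤ 4 * (a ^ 2 + b ^ 2 + c ^ 2 + d ^ 2) := by
  nlinarith [sq_nonneg (a - b), sq_nonneg (a - c), sq_nonneg (a - d), sq_nonneg (b - c),
    sq_nonneg (b - d), sq_nonneg (c - d)]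

set_option maxHeartbeats 1000000 in
/-- Averaging `exp (-S U / D)` over concentrated independent `S`, `U`. -/
lemma exp_mean_approx {α β : Type*} (s : Finset α) (r : Finset β) {S : α → ℝ} {U : β → ℝ}
    (hS : ∀ t, 0 ≤ S t) (hU : ∀ h, 0 ≤ U h) {a b B C n m : ℝ} (hn : 2 ≤ n) (hm : n ≤ m)
    (ha : 0 ≤ a) (hb : 0 ≤ b) (haB : a ≤ n * B) (hbB : b ≤ n * B) (hC : 0 ≤ C)
    (hS1 : |∑ t ∈ s, (S t - a)| ≤ C * #s) (hU1 : |∑ h ∈ r, (U h - b)| ≤ C * #r)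
    (hS2 : ∑ t ∈ s, (S t - a) ^ 2 ≤ C * n * #s) (hU2 : ∑ h ∈ r, (U h - b) ^ 2 ≤ C * n * #r) :
    |∑ t ∈ s, ∑ h ∈ r, Real.exp (-(S t * U h / (2 * (m * (m - 1))))) -
        Real.exp (-(a * b / (2 * m ^ 2))) * (#s * #r)| ≤
      ((B + C) ^ 2 + 4 * (B ^ 2 + C) ^ 2) / n * (#s * #r) := by
  have hn0 : 0 < n := by linarith
  have hm0 : 0 < m := by linarith
  have hB : 0 ≤ B := by nlinarith
  set D := 2 * (m * (m - 1)) with hD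
  have hDn : n ^ 2 ≤ D := by nlinarith
  have hD0 : 0 < D := lt_of_lt_of_le (by positivity) hDn
  set l0 := a * b / (2 * m ^ 2) with hl0
  set x : α → ℝ := fun t => S t - a with hx
  set y : β → ℝ := fun h => U h - b with hy
  set g : ℝ := a * b / m with hg
  have hg0 : 0 ≤ g := by positivity
  have hgB : g ≤ n * B ^ 2 := by
    rw [hg, div_le_iff₀ hm0]
    calc a * b ≤ (n * B) * (n * B) := by gcongr
      _ = n * B ^ 2 * n := by ring
      _ ≤ _ := by gcongr
  have hdiff : ∀ t h, S t * U h / D - l0 = (g + a * y h + b * x t + x t * y h) / D := by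
    intro t h
    have hm1 : m - 1 ≠ 0 := by linarith
    simp only [hD, hl0, hx, hy, hg]
    field_simp
    ring
  have hstep : ∀ t h, |Real.exp (-(S t * U h / D)) - Real.exp (-l0) * (1 - (S t * U h / D - l0))| ≤
      (S t * U h / D - l0) ^ 2 := fun t h =>
    abs_exp_neg_sub_le (by have := hS t; have := hU h; positivity) (by positivity)
  have hlin : |∑ t ∈ s, ∑ h ∈ r, (S t * U h / D - l0)| ≤ (B + C) ^ 2 / n * (#s * #r) := by
    have e1 : ∑ t ∈ s, ∑ h ∈ r, (S t * U h / D - l0) =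
        (g * (#s * #r) + a * #s * ∑ h ∈ r, y h + b * #r * ∑ t ∈ s, x t +
          (∑ t ∈ s, x t) * ∑ h ∈ r, y h) / D := by
      simp only [hdiff, ← sum_div, sum_add_distrib, sum_const, nsmul_eq_mul, ← mul_sum, ← sum_mul]
      ring
    rw [e1, abs_div, abs_of_pos hD0]
    have e2 : |g * (#s * #r) + a * #s * ∑ h ∈ r, y h + b * #r * ∑ t ∈ s, x t +
          (∑ t ∈ s, x t) * ∑ h ∈ r, y h| ≤ n * (B + C) ^ 2 * (#s * #r) := by
      have q1 : |g * (#s * #r)| ≤ n * B ^ 2 * (#s * #r) := by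
        rw [abs_of_nonneg (by positivity)]; gcongr
      have q2 : |a * #s * ∑ h ∈ r, y h| ≤ n * B * #s * (C * #r) := by
        rw [abs_mul, abs_of_nonneg (by positivity)]; gcongr
      have q3 : |b * #r * ∑ t ∈ s, x t| ≤ n * B * #r * (C * #s) := by
        rw [abs_mul, abs_of_nonneg (by positivity)]; gcongr
      have q4 : |(∑ t ∈ s, x t) * ∑ h ∈ r, y h| ≤ n * ((C * #s) * (C * #r)) := by
        rw [abs_mul]
        calc _ ≤ (C * #s) * (C * #r) := by gcongr
          _ = 1 * ((C * #s) * (C * #r)) := by ring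
          _ ≤ _ := by gcongr; linarith
      calc _ ≤ |g * (#s * #r)| + |a * #s * ∑ h ∈ r, y h| + |b * #r * ∑ t ∈ s, x t| +
          |(∑ t ∈ s, x t) * ∑ h ∈ r, y h| :=
            (abs_add_le _ _).trans (add_le_add_left ((abs_add_le _ _).trans
              (add_le_add_left (abs_add_le _ _) _)) _)
        _ ≤ n * B ^ 2 * (#s * #r) + n * B * #s * (C * #r) + n * B * #r * (C * #s) +
            n * ((C * #s) * (C * #r)) := by gcongr
        _ = _ := by ring
    calc _ ≤ n * (B + C) ^ 2 * (#s * #r) / n ^ 2 := by gcongr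
      _ = _ := by field_simp
  have hquad : ∑ t ∈ s, ∑ h ∈ r, (S t * U h / D - l0) ^ 2 ≤
      4 * (B ^ 2 + C) ^ 2 / n * (#s * #r) := by
    have e1 : ∀ t h, (S t * U h / D - l0) ^ 2 ≤
        4 * (g ^ 2 + a ^ 2 * y h ^ 2 + b ^ 2 * x t ^ 2 + x t ^ 2 * y h ^ 2) / n ^ 4 := by
      intro t h
      rw [hdiff, div_pow]
      calc _ ≤ 4 * (g ^ 2 + (a * y h) ^ 2 + (b * x t) ^ 2 + (x t * y h) ^ 2) / (n ^ 2) ^ 2 := by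
            gcongr
            exact four_sq_le _ _ _ _
        _ = _ := by ring
    have hY0 : 0 ≤ ∑ h ∈ r, y h ^ 2 := sum_nonneg fun _ _ => sq_nonneg _
    have hX0 : 0 ≤ ∑ t ∈ s, x t ^ 2 := sum_nonneg fun _ _ => sq_nonneg _
    have e2 : ∑ t ∈ s, ∑ h ∈ r, 4 * (g ^ 2 + a ^ 2 * y h ^ 2 + b ^ 2 * x t ^ 2 + x t ^ 2 * y h ^ 2) /
        n ^ 4 = 4 * (g ^ 2 * (#s * #r) + a ^ 2 * #s * ∑ h ∈ r, y h ^ 2 + b ^ 2 * #r * ∑ t ∈ s, x t ^ 2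
          + (∑ t ∈ s, x t ^ 2) * ∑ h ∈ r, y h ^ 2) / n ^ 4 := by
      simp only [← sum_div, ← mul_sum, sum_add_distrib, sum_const, nsmul_eq_mul, ← sum_mul]
      ring
    have hn23 : n ^ 2 ≤ n ^ 3 := pow_le_pow_right₀ (by linarith) (by norm_num)
    calc _ ≤ _ := sum_le_sum fun t _ => sum_le_sum fun h _ => e1 t h
      _ = _ := e2
      _ ≤ 4 * ((n * B ^ 2) ^ 2 * (#s * #r) + (n * B) ^ 2 * #s * (C * n * #r) +
            (n * B) ^ 2 * #r * (C * n * #s) + (C * n * #s) * (C * n * #r)) / n ^ 4 := by gcongr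
      _ = 4 * (n ^ 2 * (B ^ 4 + C ^ 2) + n ^ 3 * (2 * B ^ 2 * C)) * (#s * #r) / n ^ 4 := by ring
      _ ≤ 4 * (n ^ 3 * (B ^ 4 + C ^ 2) + n ^ 3 * (2 * B ^ 2 * C)) * (#s * #r) / n ^ 4 := by gcongr
      _ = _ := by field_simp; ring
  have hsum : ∑ t ∈ s, ∑ h ∈ r, Real.exp (-(S t * U h / D)) - Real.exp (-l0) * (#s * #r) =
      ∑ t ∈ s, ∑ h ∈ r, (Real.exp (-(S t * U h / D)) -
        Real.exp (-l0) * (1 - (S t * U h / D - l0))) -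
      Real.exp (-l0) * ∑ t ∈ s, ∑ h ∈ r, (S t * U h / D - l0) := by
    simp only [sum_sub_distrib, mul_sub, mul_one, sum_const, nsmul_eq_mul, mul_sum]
    ring
  rw [hsum]
  have hE : Real.exp (-l0) ≤ 1 := Real.exp_le_one_iff.2 (by simp only [hl0, Left.neg_nonpos_iff]; positivity)
  refine (abs_sub _ _).trans ?_
  have p1 : |∑ t ∈ s, ∑ h ∈ r, (Real.exp (-(S t * U h / D)) -
        Real.exp (-l0) * (1 - (S t * U h / D - l0)))| ≤ 4 * (B ^ 2 + C) ^ 2 / n * (#s * #r) :=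
    (abs_sum_le_sum_abs _ _).trans ((sum_le_sum fun t _ => (abs_sum_le_sum_abs _ _).trans
      (sum_le_sum fun h _ => hstep t h)).trans hquad)
  have p2 : |Real.exp (-l0) * ∑ t ∈ s, ∑ h ∈ r, (S t * U h / D - l0)| ≤
      (B + C) ^ 2 / n * (#s * #r) := by
    rw [abs_mul, abs_of_pos (Real.exp_pos _)]
    calc _ ≤ 1 * |∑ t ∈ s, ∑ h ∈ r, (S t * U h / D - l0)| := by gcongr
      _ ≤ _ := by rw [one_mul]; exact hlin
  calc _ ≤ _ := add_le_add p1 p2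
    _ = _ := by ring

end DicoreCount

namespace DicoreCount

open Finset

variable {N M : ℕ}

/-- The edge list with tails `t` and heads `h` is that of a simple digraph. -/
def Simple (t h : Fin M → Fin N) : Prop :=
  (Function.Injective fun e => (t e, h e)) ∧ ∀ e, h e ≠ t e

instance (t h : Fin M → Fin N) : Decidable (Simple t h) := by unfold Simple; infer_instance

/-- Elements of `ksurj` whose fibres have at most `Δ` elements. -/
def ksurjLe (k Δ : ℕ) (N M : ℕ) : Finset (Fin M → Fin N) :=
  {t ∈ ksurj k (Fin M) (Fin N) | ∀ v, deg t v ≤ Δ}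

lemma mem_ksurjLe {k Δ : ℕ} {t : Fin M → Fin N} :
    t ∈ ksurjLe k Δ N M ↔ (∀ v, k ≤ deg t v) ∧ ∀ v, deg t v ≤ Δ := by
  rw [ksurjLe, mem_filter, mem_ksurj]

lemma comp_mem_ksurjLe {k Δ : ℕ} {t : Fin M → Fin N} (σ : Equiv.Perm (Fin M)) :
    t ∘ σ ∈ ksurjLe k Δ N M ↔ t ∈ ksurjLe k Δ N M := by
  simp only [mem_ksurjLe, deg_comp_equiv]

lemma perm_comp_mem_ksurjLe {k Δ : ℕ} {t : Fin M → Fin N} (π : Equiv.Perm (Fin N)) :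
    π ∘ t ∈ ksurjLe k Δ N M ↔ t ∈ ksurjLe k Δ N M := by
  simp only [mem_ksurjLe, deg_perm_comp]
  rw [π.symm.forall_congr_right (q := fun v => k ≤ deg t v),
    π.symm.forall_congr_right (q := fun v => deg t v ≤ Δ)]

/-- Pairs of tail and head maps without repeated edges. -/
def injPairs (K K' : Finset (Fin M → Fin N)) : Finset ((Fin M → Fin N) × (Fin M → Fin N)) :=
  {p ∈ K ×ˢ K' | Function.Injective fun e => (p.1 e, p.2 e)}

/-- Pairs of tail and head maps of simple digraphs. -/
def simplePairs (K K' : Finset (Fin M → Fin N)) : Finset ((Fin M → Fin N) × (Fin M → Fin N)) :=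
  {p ∈ K ×ˢ K' | Simple p.1 p.2}

lemma card_injPairs (K : Finset (Fin M → Fin N)) (k' Δ : ℕ) :
    (M.factorial : ℝ) * #(injPairs K (ksurjLe k' Δ N M)) =
      ∑ t ∈ K, ∑ h ∈ ksurjLe k' Δ N M,
        (#{σ : Equiv.Perm (Fin M) | Function.Injective fun e => (t e, h (σ e))} : ℝ) := by
  have h1 : ∀ σ : Equiv.Perm (Fin M), #(injPairs K (ksurjLe k' Δ N M)) =
      #{p ∈ K ×ˢ ksurjLe k' Δ N M | Function.Injective fun e => (p.1 e, p.2 (σ e))} := by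
    intro σ
    refine (card_equiv ((Equiv.refl _).prodCongr (σ.arrowCongr (Equiv.refl _))) ?_)
    rintro ⟨t, h⟩
    have h2 : (h ∘ σ.symm) ∈ ksurjLe k' Δ N M ↔ h ∈ ksurjLe k' Δ N M := comp_mem_ksurjLe σ.symm
    rw [injPairs, mem_filter, mem_filter, mem_product, mem_product]
    change _ ↔ (t ∈ K ∧ h ∘ σ.symm ∈ ksurjLe k' Δ N M) ∧
      Function.Injective fun e => (t e, h (σ.symm (σ e)))
    simp only [h2, Equiv.symm_apply_apply]
  have h2 : M.factorial * #(injPairs K (ksurjLe k' Δ N M)) =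
      ∑ p ∈ K ×ˢ ksurjLe k' Δ N M,
        #{σ : Equiv.Perm (Fin M) | Function.Injective fun e => (p.1 e, p.2 (σ e))} := by
    rw [← sum_card_filter_comm, ← sum_congr rfl fun σ _ => h1 σ, sum_const, card_univ,
      Fintype.card_perm, Fintype.card_fin, smul_eq_mul]
  rw [sum_product] at h2
  exact_mod_cast h2

lemma card_simplePairs (k k' Δ : ℕ) :
    (N.factorial : ℝ) * #(simplePairs (ksurjLe k Δ N M) (ksurjLe k' Δ N M)) =
      ∑ p ∈ injPairs (ksurjLe k Δ N M) (ksurjLe k' Δ N M),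
        (#{π : Equiv.Perm (Fin N) | ∀ e, π (p.2 e) ≠ p.1 e} : ℝ) := by
  have h1 : ∀ π : Equiv.Perm (Fin N), #(simplePairs (ksurjLe k Δ N M) (ksurjLe k' Δ N M)) =
      #{p ∈ injPairs (ksurjLe k Δ N M) (ksurjLe k' Δ N M) | ∀ e, π (p.2 e) ≠ p.1 e} := by
    intro π
    refine (card_equiv ((Equiv.refl _).prodCongr ((Equiv.refl _).arrowCongr π.symm)) ?_)
    rintro ⟨t, h⟩
    have h2 : (π.symm ∘ h) ∈ ksurjLe k' Δ N M ↔ h ∈ ksurjLe k' Δ N M := perm_comp_mem_ksurjLe π.symm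
    have h3 : (Function.Injective fun e => (t e, π.symm (h e))) ↔
        Function.Injective fun e => (t e, h e) :=
      Function.Injective.of_comp_iff
        ((Function.injective_id.prodMap π.symm.injective)) (fun e => (t e, h e))
    rw [injPairs, simplePairs, mem_filter, mem_filter, mem_filter, mem_product, mem_product]
    change (t ∈ ksurjLe k Δ N M ∧ h ∈ ksurjLe k' Δ N M) ∧
        ((Function.Injective fun e => (t e, h e)) ∧ ∀ e, h e ≠ t e) ↔
      ((t ∈ ksurjLe k Δ N M ∧ π.symm ∘ h ∈ ksurjLe k' Δ N M) ∧
        Function.Injective fun e => (t e, π.symm (h e))) ∧ ∀ e, π (π.symm (h e)) ≠ t e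
    rw [h2, h3, and_assoc (c := ∀ e, π (π.symm (h e)) ≠ t e)]
    simp only [Equiv.apply_symm_apply]
  have h2 : N.factorial * #(simplePairs (ksurjLe k Δ N M) (ksurjLe k' Δ N M)) =
      ∑ p ∈ injPairs (ksurjLe k Δ N M) (ksurjLe k' Δ N M),
        #{π : Equiv.Perm (Fin N) | ∀ e, π (p.2 e) ≠ p.1 e} := by
    rw [← sum_card_filter_comm, ← sum_congr rfl fun σ _ => h1 σ, sum_const, card_univ,
      Fintype.card_perm, Fintype.card_fin, smul_eq_mul]
  exact_mod_cast h2

/-- The proportion of simple pairs among pairs of bounded degree. -/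
lemma abs_card_simplePairs_sub_le (hN : 2 ≤ N) (hM : 4 ≤ M) (k k' Δ : ℕ) :
    |(#(simplePairs (ksurjLe k Δ N M) (ksurjLe k' Δ N M)) : ℝ) -
      Real.exp (-((M : ℝ) / N)) * ∑ t ∈ ksurjLe k Δ N M, ∑ h ∈ ksurjLe k' Δ N M,
        Real.exp (-(pairCount t * pairCount h / (2 * (M * (M - 1)))))| ≤
      ((M / N * (2 * (M / N) + 2 * Δ) / N : ℝ) + 1000 * (Δ : ℝ) ^ 4 / M) *
        (#(ksurjLe k Δ N M) * #(ksurjLe k' Δ N M)) := by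
  set K := ksurjLe k Δ N M with hK
  set K' := ksurjLe k' Δ N M with hK'
  have hNf : (0 : ℝ) < N.factorial := by positivity
  have hMf : (0 : ℝ) < M.factorial := by positivity
  set δ1 : ℝ := M / N * (2 * (M / N) + 2 * Δ) / N
  set δ2 : ℝ := 1000 * (Δ : ℝ) ^ 4 / M
  have hδ1 : 0 ≤ δ1 := by positivity
  have hδ2 : 0 ≤ δ2 := by positivity
  set E := Real.exp (-((M : ℝ) / N)) with hE
  have hE1 : E ≤ 1 := Real.exp_le_one_iff.2 (by rw [Left.neg_nonpos_iff]; positivity)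
  have hI : (#(injPairs K K') : ℝ) ≤ #K * #K' := by
    exact_mod_cast (card_filter_le _ _).trans (card_product K K').le
  have hs : |(#(simplePairs K K') : ℝ) - E * #(injPairs K K')| ≤ δ1 * #(injPairs K K') := by
    have h1 : |(N.factorial : ℝ) * #(simplePairs K K') - E * (#(injPairs K K') * N.factorial)| ≤
        δ1 * (#(injPairs K K') * N.factorial) := by
      rw [card_simplePairs, show E * ((#(injPairs K K') : ℝ) * N.factorial) =
        ∑ p ∈ injPairs K K', E * N.factorial by rw [sum_const, nsmul_eq_mul]; ring,
        ← sum_sub_distrib]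
      refine (abs_sum_le_sum_abs _ _).trans ?_
      refine (sum_le_sum (g := fun _ => δ1 * N.factorial) fun p hp => ?_).trans
        (le_of_eq (by rw [sum_const, nsmul_eq_mul]; ring))
      simp only [injPairs, mem_filter, mem_product] at hp
      exact loops_approx hN p.1 p.2 hp.2 (mem_ksurjLe.1 hp.1.1).2 (mem_ksurjLe.1 hp.1.2).2
    rw [show (N.factorial : ℝ) * #(simplePairs K K') - E * (#(injPairs K K') * N.factorial) =
      (#(simplePairs K K') - E * #(injPairs K K')) * N.factorial by ring, abs_mul,
      abs_of_pos hNf, ← mul_assoc] at h1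
    exact le_of_mul_le_mul_right h1 hNf
  set W := ∑ t ∈ K, ∑ h ∈ K', Real.exp (-(pairCount t * pairCount h / (2 * ((M : ℝ) * (M - 1)))))
    with hW
  have hi : |(#(injPairs K K') : ℝ) - W| ≤ δ2 * (#K * #K') := by
    have h1 : |(M.factorial : ℝ) * #(injPairs K K') - W * M.factorial| ≤
        δ2 * (#K * #K') * M.factorial := by
      rw [card_injPairs, hW, sum_mul]
      simp only [sum_mul]
      rw [← sum_sub_distrib]
      refine (abs_sum_le_sum_abs _ _).trans ?_
      refine (sum_le_sum (g := fun _ => #K' * (δ2 * M.factorial)) fun t ht => ?_).trans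
        (le_of_eq (by rw [sum_const, nsmul_eq_mul]; ring))
      rw [← sum_sub_distrib]
      refine (abs_sum_le_sum_abs _ _).trans ?_
      refine (sum_le_sum (g := fun _ => δ2 * M.factorial) fun h hh => ?_).trans
        (le_of_eq (by rw [sum_const, nsmul_eq_mul]))
      exact doubles_approx hM (mem_ksurjLe.1 ht).2 (mem_ksurjLe.1 hh).2
    rw [show (M.factorial : ℝ) * #(injPairs K K') - W * M.factorial =
      (#(injPairs K K') - W) * M.factorial by ring, abs_mul, abs_of_pos hMf] at h1
    exact le_of_mul_le_mul_right h1 hMf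
  calc |(#(simplePairs K K') : ℝ) - E * W|
      = |(#(simplePairs K K') - E * #(injPairs K K')) + E * (#(injPairs K K') - W)| := by
        congr 1; ring
    _ ≤ δ1 * #(injPairs K K') + E * |(#(injPairs K K') : ℝ) - W| := by
        refine (abs_add_le _ _).trans (add_le_add hs ?_)
        rw [abs_mul, abs_of_pos (Real.exp_pos _)]
    _ ≤ δ1 * (#K * #K') + 1 * (δ2 * (#K * #K')) := by gcongr
    _ = _ := by ring

end DicoreCount

namespace DicoreCount

open Finset

variable {N M k k' : ℕ} {zlo zhi : ℝ}

/-- The degree cutoff used for typical pairs. -/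
noncomputable def cutoff (N : ℕ) : ℕ := ⌊4 * Real.log N⌋₊

lemma one_le_log {N : ℕ} (hN : 4 ≤ N) : 1 ≤ Real.log N := by
  rw [Real.le_log_iff_exp_le (by positivity)]
  have h := Real.exp_one_lt_d9
  have : (4 : ℝ) ≤ N := by exact_mod_cast hN
  linarith

lemma cutoff_le (hN : 4 ≤ N) : (cutoff N : ℝ) ≤ 4 * Real.log N :=
  Nat.floor_le (by linarith [one_le_log hN])

lemma ksurjLe_subset (k Δ N M : ℕ) : ksurjLe k Δ N M ⊆ ksurj k (Fin M) (Fin N) :=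
  filter_subset _ _

lemma exists_ksurjLe_bound (hk : 2 ≤ k) (hlo : 0 < zlo) (hhi : zlo ≤ zhi) :
    ∃ C : ℝ, 0 < C ∧ ∃ N0 : ℕ, 4 ≤ N0 ∧ ∀ z N M, Tuned k zlo zhi z N M → N0 ≤ N →
      (#(ksurj k (Fin M) (Fin N)) : ℝ) - #(ksurjLe k (cutoff N) N M) ≤
        C / N * #(ksurj k (Fin M) (Fin N)) := by
  obtain ⟨C, hC, N0, hN0, h⟩ := exists_maxDeg_bound hk hlo hhi
  refine ⟨C, hC, N0, hN0, fun z N M hT hN => ?_⟩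
  have hN4 : 4 ≤ N := hN0.trans hN
  have hNp : (0 : ℝ) < N := by positivity
  have h1 := h z N M hT hN (4 * Real.log N)
  have h2 : Real.exp (-(4 * Real.log N) / 2) = ((N : ℝ) ^ 2)⁻¹ := by
    rw [show -(4 * Real.log N) / 2 = -(2 * Real.log N) by ring, Real.exp_neg]
    congr 1
    rw [show 2 * Real.log N = Real.log N + Real.log N by ring, Real.exp_add, Real.exp_log hNp]
    ring
  have h3 : C * N * ((N : ℝ) ^ 2)⁻¹ = C / N := by field_simp
  rw [h2, h3] at h1
  refine le_trans ?_ h1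
  rw [sub_le_iff_le_add]
  have h4 : ksurj k (Fin M) (Fin N) ⊆
      {t ∈ ksurj k (Fin M) (Fin N) | ∃ v, 4 * Real.log N < deg t v} ∪ ksurjLe k (cutoff N) N M := by
    intro t ht
    rw [mem_union, mem_filter]
    by_cases hh : ∃ v, 4 * Real.log N < deg t v
    · exact Or.inl ⟨ht, hh⟩
    · right
      push Not at hh
      rw [ksurjLe, mem_filter]
      exact ⟨ht, fun v => Nat.le_floor (hh v)⟩
  exact_mod_cast (card_le_card h4).trans (card_union_le _ _)

lemma mul_facMom (hz : 0 < zlo) {z : ℝ} (hT : Tuned k zlo zhi z N M) :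
    (N : ℝ) * facMom k z = M * ePoi k z := by
  have hz0 : 0 < z := hz.trans_le hT.lo
  rw [← hT.mean]
  have h1 := (fk_pos k hz0).ne'
  have h2 := (fk_pos (k - 1) hz0).ne'
  unfold facMom mPoi ePoi
  field_simp

set_option maxHeartbeats 1000000 in
/-- The proportion of bounded degree pairs, among all pairs, that are simple. -/
lemma exists_simple (hk : 2 ≤ k) (hk' : 2 ≤ k') (hlo : 0 < zlo) (hhi : zlo ≤ zhi) :
    ∃ C : ℝ, 0 < C ∧ ∃ N0 : ℕ, 4 ≤ N0 ∧ ∀ z z' N M, Tuned k zlo zhi z N M →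
      Tuned k' zlo zhi z' N M → N0 ≤ N →
      |(#(simplePairs (ksurjLe k (cutoff N) N M) (ksurjLe k' (cutoff N) N M)) : ℝ) -
        Real.exp (-((M : ℝ) / N) - 1 / 2 * ePoi k' z' * ePoi k z) *
          (#(ksurj k (Fin M) (Fin N)) * #(ksurj k' (Fin M) (Fin N)))| ≤
        C * Real.log N ^ 6 / N * (#(ksurj k (Fin M) (Fin N)) * #(ksurj k' (Fin M) (Fin N))) ∧
      (#(ksurj k (Fin M) (Fin N)) : ℝ) * #(ksurj k' (Fin M) (Fin N)) -
          #(ksurjLe k (cutoff N) N M) * #(ksurjLe k' (cutoff N) N M) ≤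
        C * Real.log N ^ 6 / N * (#(ksurj k (Fin M) (Fin N)) * #(ksurj k' (Fin M) (Fin N))) := by
  obtain ⟨A, hA, N1, hN1, hA1⟩ := exists_ksurjLe_bound hk hlo hhi
  obtain ⟨A', hA', N1', hN1', hA1'⟩ := exists_ksurjLe_bound hk' hlo hhi
  obtain ⟨C2, hC2, N2, hN2, hP⟩ := exists_pairCount_bounds hk hlo hhi
  obtain ⟨C2', hC2', N2', hN2', hP'⟩ := exists_pairCount_bounds hk' hlo hhi
  set B0 := ∑' j : ℕ, (1 + (j : ℝ)) ^ 2 * poiDom k zlo zhi j with hB0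
  set B0' := ∑' j : ℕ, (1 + (j : ℝ)) ^ 2 * poiDom k' zlo zhi j with hB0'
  set B := max B0 B0' with hB
  set C0 := max C2 C2' with hC0
  have hC00 : 0 < C0 := lt_of_lt_of_le hC2 (le_max_left _ _)
  set D := (B + C0) ^ 2 + 4 * (B ^ 2 + C0) ^ 2 with hD
  have hD0 : 0 ≤ D := by positivity
  set c := k + zhi with hc
  have hc0 : 0 ≤ c := by have := hlo.trans_le hhi; positivity
  refine ⟨c * (2 * c + 8) + 256000 + D + (A + A'), by positivity,
    max (max N1 N1') (max N2 N2'), le_max_of_le_left (le_max_of_le_left hN1),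
    fun z z' N M hT hT' hN => ?_⟩
  simp only [max_le_iff] at hN
  have hN4 : 4 ≤ N := hN1.trans hN.1.1
  have hNp : (0 : ℝ) < N := by positivity
  have hz : 0 < z := hlo.trans_le hT.lo
  have hz' : 0 < z' := hlo.trans_le hT'.lo
  have hM2 := hT.le
  set K := ksurj k (Fin M) (Fin N) with hK
  set K' := ksurj k' (Fin M) (Fin N) with hK'
  set L := ksurjLe k (cutoff N) N M with hL
  set L' := ksurjLe k' (cutoff N) N M with hL'
  have hLK : L ⊆ K := ksurjLe_subset _ _ _ _
  have hLK' : L' ⊆ K' := ksurjLe_subset _ _ _ _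
  have hLKc : (#L : ℝ) ≤ #K := by exact_mod_cast card_le_card hLK
  have hLKc' : (#L' : ℝ) ≤ #K' := by exact_mod_cast card_le_card hLK'
  have hnn : (0 : ℝ) ≤ #K * #K' := by positivity
  have hlog := one_le_log hN4
  set ℓ := Real.log N with hℓ
  have hdiff : (#K : ℝ) * #K' - #L * #L' ≤ (A + A') / N * (#K * #K') := by
    have h1 := hA1 z N M hT hN.1.1
    have h2 := hA1' z' N M hT' hN.1.2
    calc (#K : ℝ) * #K' - #L * #L' = (#K - #L) * #K' + #L * (#K' - #L') := by ring
      _ ≤ (A / N * #K) * #K' + #K * (A' / N * #K') := by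
          refine add_le_add (mul_le_mul_of_nonneg_right h1 (by positivity)) ?_
          exact mul_le_mul hLKc h2 (by linarith) (by positivity)
      _ = _ := by ring
  have hℓ6 : 1 ≤ ℓ ^ 6 := one_le_pow₀ hlog
  have hApp := abs_card_simplePairs_sub_le (N := N) (M := M) (by omega) (by omega) k k' (cutoff N)
  rw [← hL, ← hL'] at hApp
  set f : (Fin M → Fin N) → (Fin M → Fin N) → ℝ := fun t h =>
    Real.exp (-(pairCount t * pairCount h / (2 * ((M : ℝ) * (M - 1))))) with hf
  have hpc : ∀ t : Fin M → Fin N, 0 ≤ pairCount t := fun t => by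
    unfold pairCount
    refine sum_nonneg fun v _ => ?_
    rcases Nat.eq_zero_or_pos (deg t v) with h0 | h0
    · simp [h0]
    · have : (1 : ℝ) ≤ deg t v := by exact_mod_cast h0
      exact mul_nonneg (by positivity) (by linarith)
  have hM1 : (1 : ℝ) ≤ M := by exact_mod_cast (by omega : 1 ≤ M)
  have hf1 : ∀ t h, f t h ≤ 1 := fun t h => by
    refine Real.exp_le_one_iff.2 ?_
    rw [Left.neg_nonpos_iff]
    exact div_nonneg (mul_nonneg (hpc t) (hpc h))
      (mul_nonneg (by norm_num) (mul_nonneg (by linarith) (by linarith)))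
  have hf0 : ∀ t h, 0 ≤ f t h := fun t h => (Real.exp_pos _).le
  have hMean : |∑ t ∈ K, ∑ h ∈ K', f t h -
      Real.exp (-(N * facMom k z * (N * facMom k' z') / (2 * (M : ℝ) ^ 2))) * (#K * #K')| ≤
      D / N * (#K * #K') := by
    obtain ⟨p1, p2⟩ := hP z N M hT hN.2.1
    obtain ⟨q1, q2⟩ := hP' z' N M hT' hN.2.2
    have hfm := facMom_le hk hlo hT.lo hT.hi
    have hfm' := facMom_le hk' hlo hT'.lo hT'.hi
    have hfp := facMom_nonneg (k := k) hz
    have hfp' := facMom_nonneg (k := k') hz'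
    refine exp_mean_approx K K' hpc hpc (by exact_mod_cast (by omega : 2 ≤ N))
      (by exact_mod_cast (by omega : N ≤ M)) (by positivity) (by positivity)
      (mul_le_mul_of_nonneg_left (hfm.trans (le_max_left _ _)) hNp.le)
      (mul_le_mul_of_nonneg_left (hfm'.trans (le_max_right _ _)) hNp.le) hC00.le
      (p1.trans ?_) (q1.trans ?_) (p2.trans ?_) (q2.trans ?_)
    · gcongr; exact le_max_left _ _
    · gcongr; exact le_max_right _ _
    · gcongr; exact le_max_left _ _
    · gcongr; exact le_max_right _ _
  rw [mul_facMom hlo hT, mul_facMom hlo hT', show M * ePoi k z * (M * ePoi k' z') /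
    (2 * (M : ℝ) ^ 2) = 1 / 2 * ePoi k' z' * ePoi k z by field_simp] at hMean
  have hcut : |∑ t ∈ K, ∑ h ∈ K', f t h - ∑ t ∈ L, ∑ h ∈ L', f t h| ≤
      (A + A') / N * (#K * #K') := by
    refine le_trans ?_ hdiff
    simp only [← sum_product']
    have hsub : L ×ˢ L' ⊆ K ×ˢ K' := product_subset_product hLK hLK'
    rw [← sum_sdiff hsub, add_sub_cancel_right, abs_of_nonneg (sum_nonneg fun p _ => hf0 _ _)]
    refine (sum_le_sum (g := fun _ => (1 : ℝ)) fun p _ => hf1 _ _).trans (le_of_eq ?_)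
    rw [sum_const, nsmul_eq_mul, mul_one, cast_card_sdiff hsub, card_product, card_product]
    push_cast; ring
  have hc1 : (M : ℝ) / N ≤ c := by
    rw [← hT.mean, mul_div_assoc, div_self hNp.ne', mul_one]
    have := mPoi_sub_le (k := k) (by omega) hz
    linarith [hT.hi]
  have hcN : 0 ≤ (M : ℝ) / N := by positivity
  set E := Real.exp (-((M : ℝ) / N)) with hE
  have hE0 : 0 < E := Real.exp_pos _
  have hE1 : E ≤ 1 := Real.exp_le_one_iff.2 (by rw [Left.neg_nonpos_iff]; exact hcN)
  have hδ : (M / N * (2 * (M / N) + 2 * cutoff N) / N : ℝ) + 1000 * (cutoff N : ℝ) ^ 4 / M ≤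
      (c * (2 * c + 8) + 256000) * ℓ ^ 6 / N := by
    have hcu := cutoff_le hN4
    rw [← hℓ] at hcu
    have hl1 : ℓ ≤ ℓ ^ 6 := le_self_pow₀ hlog (by norm_num)
    have hl4 : ℓ ^ 4 ≤ ℓ ^ 6 := pow_le_pow_right₀ hlog (by norm_num)
    have hNM : (N : ℝ) ≤ M := by exact_mod_cast (by omega : N ≤ M)
    calc (M / N * (2 * (M / N) + 2 * cutoff N) / N : ℝ) + 1000 * (cutoff N : ℝ) ^ 4 / M
        ≤ c * (2 * c + 2 * (4 * ℓ)) / N + 1000 * (4 * ℓ) ^ 4 / N := by gcongr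
      _ = (c * (2 * c * 1 + 8 * ℓ) + 256000 * ℓ ^ 4) / N := by ring
      _ ≤ (c * (2 * c * ℓ ^ 6 + 8 * ℓ ^ 6) + 256000 * ℓ ^ 6) / N := by gcongr
      _ = _ := by ring
  refine ⟨?_, hdiff.trans ?_⟩
  · set X := (#(simplePairs L L') : ℝ)
    set E2 := Real.exp (-(1 / 2 * ePoi k' z' * ePoi k z)) with hE2
    rw [sub_eq_add_neg (-((M : ℝ) / N)), Real.exp_add, ← hE, ← hE2]
    set W := ∑ t ∈ K, ∑ h ∈ K', f t h
    set V := ∑ t ∈ L, ∑ h ∈ L', f t h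
    have hLL : (#L : ℝ) * #L' ≤ #K * #K' := by gcongr
    calc |X - E * E2 * (#K * #K')|
        = |(X - E * V) + (E * (W - E2 * (#K * #K')) + E * (V - W))| := by congr 1; ring
      _ ≤ |X - E * V| + (|E * (W - E2 * (#K * #K'))| + |E * (V - W)|) :=
          (abs_add_le _ _).trans (add_le_add le_rfl (abs_add_le _ _))
      _ = |X - E * V| + (E * |W - E2 * (#K * #K')| + E * |V - W|) := by
          rw [abs_mul, abs_mul, abs_of_pos hE0]
      _ ≤ ((c * (2 * c + 8) + 256000) * ℓ ^ 6 / N) * (#K * #K') +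
          (1 * (D / N * (#K * #K')) + 1 * ((A + A') / N * (#K * #K'))) := by
          rw [abs_sub_comm V W]
          refine add_le_add (hApp.trans (mul_le_mul hδ hLL (by positivity) (by positivity))) ?_
          gcongr
      _ = ((c * (2 * c + 8) + 256000) * ℓ ^ 6 + (D + (A + A')) * 1) / N * (#K * #K') := by ring
      _ ≤ ((c * (2 * c + 8) + 256000) * ℓ ^ 6 + (D + (A + A')) * ℓ ^ 6) / N * (#K * #K') := by
          gcongr
      _ = _ := by ring
  · refine mul_le_mul_of_nonneg_right ?_ hnn
    gcongr
    calc A + A' ≤ (A + A') * ℓ ^ 6 := le_mul_of_one_le_right (by positivity) hℓ6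
      _ ≤ _ := by
          refine mul_le_mul_of_nonneg_right ?_ (by positivity)
          linarith [mul_nonneg hc0 (by linarith : 0 ≤ 2 * c + 8)]

end DicoreCount

namespace DicoreCount

open Finset

lemma fk_zero (x : ℝ) : fk 0 x = Real.exp x := by
  have h := hasSum_expTerm 0 x
  have h2 : HasSum (fun n : ℕ => x ^ n / (n.factorial : ℝ)) (Real.exp x) := by
    rw [Real.exp_eq_exp_ℝ]; exact NormedSpace.expSeries_div_hasSum_exp x
  refine h.unique (hasSum_of_eq h2 fun j => ?_)
  simp [expTerm]

lemma hasDerivAt_fk_succ (k : ℕ) (x : ℝ) : HasDerivAt (fk (k + 1)) (fk k x) x := by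
  induction k with
  | zero =>
    have h : fk (0 + 1) = fun x => Real.exp x - 1 := by
      ext x
      have := fk_eq_add 0 x
      rw [fk_zero] at this
      simp at this ⊢
      linarith
    rw [h, fk_zero]
    exact (Real.hasDerivAt_exp x).sub_const 1
  | succ k ih =>
    have h : fk (k + 1 + 1) = fun x => fk (k + 1) x - x ^ (k + 1) / (k + 1).factorial := by
      ext x
      have := fk_eq_add (k + 1) x
      linarith
    rw [h]
    have h2 : fk (k + 1) x = fk k x - ((k + 1 : ℕ) : ℝ) * x ^ (k + 1 - 1) / (k + 1).factorial := by
      have h3 := fk_eq_add k x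
      have h4 : ((k + 1 : ℕ) : ℝ) * x ^ (k + 1 - 1) / (k + 1).factorial = x ^ k / k.factorial := by
        rw [Nat.factorial_succ, Nat.add_sub_cancel]; push_cast; field_simp
      rw [h4]; linarith
    rw [h2]
    exact ih.sub ((hasDerivAt_pow (k + 1) x).div_const _)

/-- The ratio `fk k / fk (k + 1)` is decreasing. -/
lemma fk_mul_fk_le (k : ℕ) {u z : ℝ} (hu : 0 < u) (huz : u ≤ z) :
    fk k z * fk (k + 1) u ≤ fk k u * fk (k + 1) z := by
  have hz : 0 < z := hu.trans_le huz
  have h1 : ((u / z) ^ k) * fk (k + 1) z ≥ fk (k + 1) u := by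
    refine hasSum_le (fun j => ?_) (hasSum_expTerm (k + 1) u)
      ((hasSum_expTerm (k + 1) z).mul_left ((u / z) ^ k))
    unfold expTerm
    split_ifs with h
    · obtain ⟨i, rfl⟩ : ∃ i, j = k + i := ⟨j - k, by omega⟩
      rw [pow_add u, pow_add z, div_pow, show u ^ k / z ^ k * (z ^ k * z ^ i / ((k + i).factorial : ℝ)) =
        u ^ k * z ^ i / ((k + i).factorial : ℝ) by field_simp]
      gcongr
    · simp
  rw [fk_eq_add k z, fk_eq_add k u, add_mul, add_mul]
  have h2 : z ^ k / k.factorial * fk (k + 1) u ≤ u ^ k / k.factorial * fk (k + 1) z := by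
    calc z ^ k / k.factorial * fk (k + 1) u ≤ z ^ k / k.factorial * (((u / z) ^ k) * fk (k + 1) z) := by
          gcongr
      _ = _ := by rw [div_pow]; field_simp
  linarith [mul_comm (fk (k + 1) z) (fk (k + 1) u)]

/-- Log-concavity of `fk k`: the graph of `log (fk k)` is below its tangents. -/
lemma fk_le_mul_exp {k : ℕ} (hk : 1 ≤ k) {u z : ℝ} (hu : 0 < u) (hz : 0 < z) :
    fk k u ≤ fk k z * Real.exp (mPoi k z / z * (u - z)) := by
  obtain ⟨k, rfl⟩ : ∃ m, k = m + 1 := ⟨k - 1, by omega⟩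
  have hfz := fk_pos (k + 1) hz
  set ρ := mPoi (k + 1) z / z with hρ
  have hρ' : ρ * fk (k + 1) z = fk k z := by
    rw [hρ, mPoi, Nat.add_sub_cancel]; field_simp
  set F : ℝ → ℝ := fun x => fk (k + 1) x * Real.exp (-(ρ * x)) with hF
  have hd : ∀ x, HasDerivAt F ((fk k x - ρ * fk (k + 1) x) * Real.exp (-(ρ * x))) x := fun x => by
    have h := (hasDerivAt_fk_succ k x).mul (((hasDerivAt_id x).const_mul ρ).neg.exp)
    refine h.congr_deriv ?_
    simp only [id_eq, Pi.neg_apply]; ring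
  have hcont : Continuous F := continuous_iff_continuousAt.2 fun x => (hd x).continuousAt
  have key : F u ≤ F z := by
    rcases le_total u z with h | h
    · refine (monotoneOn_of_deriv_nonneg (convex_Icc u z) hcont.continuousOn
        (fun x _ => (hd x).differentiableAt.differentiableWithinAt) fun x hx => ?_)
        (Set.left_mem_Icc.2 h) (Set.right_mem_Icc.2 h) h
      rw [interior_Icc] at hx
      rw [(hd x).deriv]
      refine mul_nonneg ?_ (Real.exp_pos _).le
      have := fk_mul_fk_le k (hu.trans hx.1) hx.2.le
      rw [← hρ'] at this
      have h3 : fk (k + 1) z * (ρ * fk (k + 1) x) ≤ fk (k + 1) z * fk k x := by linarith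
      linarith [le_of_mul_le_mul_left h3 hfz]
    · refine (antitoneOn_of_deriv_nonpos (convex_Icc z u) hcont.continuousOn
        (fun x _ => (hd x).differentiableAt.differentiableWithinAt) fun x hx => ?_)
        (Set.left_mem_Icc.2 h) (Set.right_mem_Icc.2 h) h
      rw [interior_Icc] at hx
      rw [(hd x).deriv]
      refine mul_nonpos_of_nonpos_of_nonneg ?_ (Real.exp_pos _).le
      have := fk_mul_fk_le k hz hx.1.le
      rw [← hρ'] at this
      have h3 : fk (k + 1) z * fk k x ≤ fk (k + 1) z * (ρ * fk (k + 1) x) := by linarith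
      linarith [le_of_mul_le_mul_left h3 hfz]
  have h4 : fk (k + 1) u = F u * Real.exp (ρ * u) := by
    simp only [hF]; rw [mul_assoc, ← Real.exp_add]; simp
  calc fk (k + 1) u = F u * Real.exp (ρ * u) := h4
    _ ≤ F z * Real.exp (ρ * u) := by gcongr
    _ = fk (k + 1) z * Real.exp (ρ * (u - z)) := by
        simp only [hF]; rw [mul_assoc, ← Real.exp_add]; congr 2; ring

lemma factorial_le_mul_exp {n : ℕ} (hn : 1 ≤ n) :
    (n.factorial : ℝ) ≤ Real.exp 1 * n * (n ^ n * Real.exp (-n)) := by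
  induction n, hn using Nat.le_induction with
  | base => simp [← Real.exp_add]
  | succ n hn ih =>
    have hn0 : (0 : ℝ) < n := by positivity
    have h1 : Real.exp 1 * (n : ℝ) ^ n * n ≤ ((n : ℝ) + 1) ^ n * (n + 1) := by
      have h2 : Real.exp ((n + 1 : ℝ) * (1 / (n + 1))) ≤ ((1 + 1 / n : ℝ)) ^ (n + 1) := by
        have h3 : Real.exp (1 / (n + 1 : ℝ)) ≤ 1 + 1 / n := by
          have h4 : 1 - 1 / (n + 1 : ℝ) ≤ Real.exp (-(1 / (n + 1 : ℝ))) := by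
            have := Real.add_one_le_exp (-(1 / (n + 1 : ℝ))); linarith
          rw [Real.exp_neg] at h4
          have h5 : (1 + 1 / n : ℝ) = (1 - 1 / (n + 1 : ℝ))⁻¹ := by
            have : (1 - 1 / (n + 1 : ℝ)) = n / (n + 1) := by field_simp; ring
            rw [this, inv_div]; field_simp
          rw [h5]
          have h6 : (0 : ℝ) < 1 - 1 / (n + 1 : ℝ) := by
            rw [sub_pos, div_lt_one (by positivity)]; linarith
          rwa [le_inv_comm₀ (Real.exp_pos _) h6]
        calc Real.exp ((n + 1 : ℝ) * (1 / (n + 1))) = Real.exp (1 / (n + 1 : ℝ)) ^ (n + 1) := by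
              rw [← Real.exp_nat_mul]; push_cast; rfl
          _ ≤ _ := by gcongr
      rw [mul_one_div_cancel (by positivity)] at h2
      calc Real.exp 1 * (n : ℝ) ^ n * n = Real.exp 1 * (n : ℝ) ^ (n + 1) := by ring
        _ ≤ (1 + 1 / n : ℝ) ^ (n + 1) * (n : ℝ) ^ (n + 1) := by gcongr
        _ = ((1 + 1 / n : ℝ) * n) ^ (n + 1) := by rw [mul_pow]
        _ = ((n : ℝ) + 1) ^ (n + 1) := by congr 1; field_simp
        _ = _ := by ring
    rw [Nat.factorial_succ]
    push_cast
    have h7 : Real.exp (-(n : ℝ)) = Real.exp 1 * Real.exp (-((n : ℝ) + 1)) := by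
      rw [← Real.exp_add]; congr 1; ring
    calc ((n : ℝ) + 1) * n.factorial
        ≤ (n + 1) * (Real.exp 1 * n * (n ^ n * Real.exp (-n))) := by gcongr
      _ = (n + 1) * Real.exp 1 * (Real.exp 1 * (n : ℝ) ^ n * n) * Real.exp (-((n : ℝ) + 1)) := by
          rw [h7]; ring
      _ ≤ (n + 1) * Real.exp 1 * (((n : ℝ) + 1) ^ n * (n + 1)) * Real.exp (-((n : ℝ) + 1)) := by
          gcongr
      _ = _ := by ring

lemma pow_mul_exp_neg_le_factorial (n : ℕ) :
    (n : ℝ) ^ n * Real.exp (-n) ≤ n.factorial := by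
  have h := Real.pow_div_factorial_le_exp (n : ℝ) (by positivity) n
  rw [div_le_iff₀ (by positivity)] at h
  rw [Real.exp_neg, ← div_eq_mul_inv, div_le_iff₀ (Real.exp_pos _)]
  linarith

end DicoreCount

namespace DicoreCount

open Finset

variable {N M k : ℕ} {zlo zhi z : ℝ}

lemma card_fiber_le_mul (k : ℕ) (S : Finset (Fin N)) (A : Finset (Fin M)) :
    #{t ∈ ksurj k (Fin M) (Fin N) | ∀ e, t e ∈ S ↔ e ∈ A} ≤
      #(ksurj k {e // e ∈ A} {v // v ∈ S}) * #(ksurj k {e // e ∉ A} {v // v ∉ S}) := by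
  rw [← card_product]
  let F : ({e // e ∈ A} → {v // v ∈ S}) × ({e // e ∉ A} → {v // v ∉ S}) → Fin M → Fin N :=
    fun p e => if h : e ∈ A then p.1 ⟨e, h⟩ else p.2 ⟨e, h⟩
  refine card_le_card_of_surjOn F ?_
  intro t ht
  rw [mem_coe, mem_filter, mem_ksurj] at ht
  obtain ⟨ht, hA⟩ := ht
  refine ⟨(fun e => ⟨t e, (hA e).2 e.2⟩, fun e => ⟨t e, fun h => e.2 ((hA e).1 h)⟩), ?_, ?_⟩
  · rw [mem_coe, mem_product, mem_ksurj, mem_ksurj]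
    constructor
    · intro v
      refine (ht v).trans (le_of_eq ?_)
      unfold deg
      rw [← card_map (Function.Embedding.subtype fun e => e ∈ A)]
      congr 1
      ext e
      simp only [mem_filter, mem_univ, true_and, mem_map, Subtype.ext_iff,
        Function.Embedding.coe_subtype]
      constructor
      · intro h
        exact ⟨⟨e, (hA e).1 (h ▸ v.2)⟩, h, rfl⟩
      · rintro ⟨a, h, rfl⟩
        exact h
    · intro v
      refine (ht v).trans (le_of_eq ?_)
      unfold deg
      rw [← card_map (Function.Embedding.subtype fun e => e ∉ A)]
      congr 1
      ext e
      simp only [mem_filter, mem_univ, true_and, mem_map, Subtype.ext_iff,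
        Function.Embedding.coe_subtype]
      constructor
      · intro h
        exact ⟨⟨e, fun h' => v.2 (h ▸ (hA e).2 h')⟩, h, rfl⟩
      · rintro ⟨a, h, rfl⟩
        exact h
  · ext e
    simp only [F]
    split_ifs <;> rfl

lemma mul_card_le_card_preimage {t : Fin M → Fin N} (ht : ∀ v, k ≤ deg t v) (S : Finset (Fin N)) :
    k * #S ≤ #{e | t e ∈ S} := by
  rw [← sum_deg, mul_comm, ← smul_eq_mul, ← sum_const]
  exact sum_le_sum fun v _ => ht v

lemma factorial_mul_fk_le (hk : 1 ≤ k) (hz : 0 < z) {x s : ℕ} (hx : 1 ≤ x) (hs : 1 ≤ s) :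
    x.factorial * fk k (z * x / (mPoi k z * s)) ^ s / (z * x / (mPoi k z * s)) ^ x ≤
      Real.exp 1 * x * fk k z ^ s / z ^ x * (mPoi k z * s) ^ x * Real.exp (-(mPoi k z * s)) := by
  have hc := mPoi_pos (k := k) hz
  set c := mPoi k z with hcdef
  have hx0 : (0 : ℝ) < x := by exact_mod_cast hx
  have hs0 : (0 : ℝ) < s := by exact_mod_cast hs
  set u := z * x / (c * s) with hu
  have hu0 : 0 < u := by positivity
  have hfz := fk_pos k hz
  have hfu := fk_pos k hu0
  have h1 : fk k u ^ s ≤ fk k z ^ s * Real.exp (x - c * s) := by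
    calc fk k u ^ s ≤ (fk k z * Real.exp (c / z * (u - z))) ^ s := by
          gcongr; exact fk_le_mul_exp hk hu0 hz
      _ = fk k z ^ s * Real.exp (s * (c / z * (u - z))) := by rw [mul_pow, Real.exp_nat_mul]
      _ = _ := by
          congr 2
          rw [hu]; field_simp
  have h2 := factorial_le_mul_exp hx
  calc x.factorial * fk k u ^ s / u ^ x
      ≤ (Real.exp 1 * x * (x ^ x * Real.exp (-x))) * (fk k z ^ s * Real.exp (x - c * s)) / u ^ x := by
        gcongr
    _ = Real.exp 1 * x * fk k z ^ s * (x ^ x / u ^ x) * (Real.exp (-x) * Real.exp (x - c * s)) := by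
        ring
    _ = Real.exp 1 * x * fk k z ^ s * (x ^ x / u ^ x) * Real.exp (-(c * s)) := by
        rw [← Real.exp_add]; congr 2; ring
    _ = _ := by
        rw [← div_pow, show (x : ℝ) / u = c * s / z by rw [hu]; field_simp, div_pow]; ring

/-- The set of positions of a vertex set is dominated by a binomial random set. -/
lemma card_fiber_le_normConst (hk : 1 ≤ k) (hz : 0 < z) (hmean : mPoi k z * N = M)
    (S : Finset (Fin N)) (A : Finset (Fin M)) (hS : 1 ≤ #S) (hSN : #S < N) :
    (#{t ∈ ksurj k (Fin M) (Fin N) | ∀ e, t e ∈ S ↔ e ∈ A} : ℝ) ≤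
      Real.exp 2 * M ^ 2 * normConst k z N M *
        (((#S : ℝ) / N) ^ #A * (1 - (#S : ℝ) / N) ^ (M - #A)) := by
  have hN0 : (0 : ℝ) < N := by exact_mod_cast (by omega : 0 < N)
  have hfz := fk_pos k hz
  have hc := mPoi_pos (k := k) hz
  have hSN' : (#S : ℝ) / N ≤ 1 := by
    rw [div_le_one hN0]; exact_mod_cast hSN.le
  rcases (filter (fun t => ∀ e, t e ∈ S ↔ e ∈ A) (ksurj k (Fin M) (Fin N))).eq_empty_or_nonempty
    with h0 | ⟨t, ht⟩
  · rw [h0, card_empty, Nat.cast_zero]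
    have := normConst_pos (k := k) (N := N) (M := M) hz
    have : 0 ≤ 1 - (#S : ℝ) / N := by linarith
    positivity
  rw [mem_filter, mem_ksurj] at ht
  obtain ⟨ht, htA⟩ := ht
  have hAeq : ({e | t e ∈ S} : Finset _) = A := by ext e; simp [htA]
  have hAeq' : ({e | t e ∈ Sᶜ} : Finset _) = Aᶜ := by ext e; simp [htA]
  have hx := mul_card_le_card_preimage ht S
  have hy := mul_card_le_card_preimage ht Sᶜ
  rw [hAeq] at hx
  rw [hAeq', card_compl, card_compl, Fintype.card_fin, Fintype.card_fin] at hy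
  set x := #A with hxd
  set s := #S with hsd
  clear_value x s
  have hx1 : 1 ≤ x := le_trans (Nat.mul_pos (by omega) (by omega)) hx
  have hy1 : 1 ≤ M - x := le_trans (Nat.mul_pos (by omega) (by omega)) hy
  have hxM : x ≤ M := by omega
  have hcA : Fintype.card {e // e ∈ A} = x := hxd ▸ Fintype.card_coe A
  have hcS : Fintype.card {e // e ∈ S} = s := hsd ▸ Fintype.card_coe S
  have hcA' : Fintype.card {e // e ∉ A} = M - x := by
    rw [Fintype.card_subtype_compl, hcA, Fintype.card_fin]
  have hcS' : Fintype.card {e // e ∉ S} = N - s := by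
    rw [Fintype.card_subtype_compl, hcS, Fintype.card_fin]
  have h1 : (#(ksurj k {e // e ∈ A} {v // v ∈ S}) : ℝ) ≤
      Real.exp 1 * x * fk k z ^ s / z ^ x * (mPoi k z * s) ^ x * Real.exp (-(mPoi k z * s)) := by
    have h := card_ksurj_le (E := {e // e ∈ A}) (V := {v // v ∈ S}) (k := k)
      (u := z * x / (mPoi k z * s)) (by positivity)
    rw [hcA, hcS] at h
    exact h.trans (factorial_mul_fk_le hk hz hx1 (by omega))
  have h2 : (#(ksurj k {e // e ∉ A} {v // v ∉ S}) : ℝ) ≤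
      Real.exp 1 * (M - x : ℕ) * fk k z ^ (N - s) / z ^ (M - x) * (mPoi k z * (N - s : ℕ)) ^ (M - x) *
        Real.exp (-(mPoi k z * (N - s : ℕ))) := by
    have hp : (0 : ℝ) < (M - x : ℕ) := by exact_mod_cast hy1
    have hq : (0 : ℝ) < (N - s : ℕ) := by exact_mod_cast (by omega : 0 < N - s)
    have h := card_ksurj_le (E := {e // e ∉ A}) (V := {v // v ∉ S}) (k := k)
      (u := z * (M - x : ℕ) / (mPoi k z * (N - s : ℕ))) (by positivity)
    rw [hcA', hcS'] at h
    exact h.trans (factorial_mul_fk_le hk hz hy1 (by omega))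
  have h3 : (#{t ∈ ksurj k (Fin M) (Fin N) | ∀ e, t e ∈ S ↔ e ∈ A} : ℝ) ≤
      #(ksurj k {e // e ∈ A} {v // v ∈ S}) * #(ksurj k {e // e ∉ A} {v // v ∉ S}) := by
    exact_mod_cast card_fiber_le_mul k S A
  have hc' : mPoi k z = M / N := by rw [eq_div_iff hN0.ne']; exact hmean
  have hNs : ((N - s : ℕ) : ℝ) = N * (1 - s / N) := by
    rw [Nat.cast_sub hSN.le]; field_simp
  have hs' : (s : ℝ) = N * (s / N) := by field_simp
  have hxx : (x : ℝ) * (M - x : ℕ) ≤ M ^ 2 := by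
    rw [sq]; exact_mod_cast Nat.mul_le_mul hxM (Nat.sub_le M x)
  have hNs0 : 0 ≤ 1 - (s : ℝ) / N := by linarith
  refine h3.trans ((mul_le_mul h1 h2 (Nat.cast_nonneg _) (by positivity)).trans ?_)
  have e1 : mPoi k z * s = M * (s / N) := by rw [hc']; ring
  have e2 : mPoi k z * (N - s : ℕ) = M * (1 - s / N) := by rw [hNs, hc']; field_simp
  rw [e1, e2, mul_pow, mul_pow]
  set α := (s : ℝ) / N
  have hMf := pow_mul_exp_neg_le_factorial M
  calc Real.exp 1 * x * fk k z ^ s / z ^ x * ((M : ℝ) ^ x * α ^ x) * Real.exp (-(M * α)) *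
        (Real.exp 1 * (M - x : ℕ) * fk k z ^ (N - s) / z ^ (M - x) *
          ((M : ℝ) ^ (M - x) * (1 - α) ^ (M - x)) * Real.exp (-(M * (1 - α))))
      = (Real.exp 1 * Real.exp 1) * (x * (M - x : ℕ)) * (fk k z ^ s * fk k z ^ (N - s)) /
          (z ^ x * z ^ (M - x)) * ((M : ℝ) ^ x * (M : ℝ) ^ (M - x)) *
          (Real.exp (-(M * α)) * Real.exp (-(M * (1 - α)))) * (α ^ x * (1 - α) ^ (M - x)) := by
        field_simp
    _ = Real.exp 2 * (x * (M - x : ℕ)) * fk k z ^ N / z ^ M * ((M : ℝ) ^ M * Real.exp (-M)) *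
          (α ^ x * (1 - α) ^ (M - x)) := by
        rw [← Real.exp_add, ← Real.exp_add, ← pow_add, ← pow_add, ← pow_add,
          Nat.add_sub_cancel' hSN.le, Nat.add_sub_cancel' hxM, mul_assoc _ ((M : ℝ) ^ M)]
        congr 3 <;> norm_num
        ring
    _ ≤ Real.exp 2 * M ^ 2 * fk k z ^ N / z ^ M * M.factorial *
          (α ^ x * (1 - α) ^ (M - x)) := by
        have : 0 ≤ α := by positivity
        gcongr
    _ = _ := by rw [normConst]; ring

/-- Binomial domination relative to the number of all maps. -/
lemma exists_card_fiber_le (hk : 2 ≤ k) (hlo : 0 < zlo) (hhi : zlo ≤ zhi) :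
    ∃ C : ℝ, 0 < C ∧ ∃ N0 : ℕ, 2 ≤ N0 ∧ ∀ z N M, Tuned k zlo zhi z N M → N0 ≤ N →
      ∀ (S : Finset (Fin N)) (A : Finset (Fin M)), 1 ≤ #S → #S < N →
      (#{t ∈ ksurj k (Fin M) (Fin N) | ∀ e, t e ∈ S ↔ e ∈ A} : ℝ) ≤
      C * N ^ 3 * #(ksurj k (Fin M) (Fin N)) *
        (((#S : ℝ) / N) ^ #A * (1 - (#S : ℝ) / N) ^ (M - #A)) := by
  obtain ⟨N0, hN0, hlow⟩ := exists_hitProb_lower hk hlo hhi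
  set V := momBound k zlo zhi 2 with hV
  have hc0 : 0 < (k : ℝ) + zhi := by have := hlo.trans_le hhi; positivity
  have hV0 : 0 < V := (vPoi_pos hk hlo).trans_le (vPoi_le hk hlo le_rfl hhi)
  refine ⟨Real.exp 2 * (k + zhi) ^ 2 * (2 * √(2 * Real.pi * V)), by positivity, N0, hN0,
    fun z N M hT hN S A hS hSN => ?_⟩
  have hz : 0 < z := hlo.trans_le hT.lo
  have hN1 : (1 : ℝ) ≤ N := by exact_mod_cast (by omega : 1 ≤ N)
  have hM : (M : ℝ) ≤ (k + zhi) * N := by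
    rw [← hT.mean]
    gcongr
    linarith [mPoi_sub_le (k := k) (by omega) hz, hT.hi]
  have hnc := normConst_pos (k := k) (N := N) (M := M) hz
  have h1 : normConst k z N M ≤ 2 * √(2 * Real.pi * V) * N * #(ksurj k (Fin M) (Fin N)) := by
    have h2 := hlow z N M hT hN
    have h3 : √(2 * Real.pi * N * vPoi k z) ≤ √(2 * Real.pi * V) * N := by
      rw [show √(2 * Real.pi * V) * N = √(2 * Real.pi * V * N ^ 2) by
        
        rw [Real.sqrt_mul (by positivity) ((N : ℝ) ^ 2), Real.sqrt_sq (by positivity)]]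
      refine Real.sqrt_le_sqrt ?_
      have h4 := vPoi_le hk hlo hT.lo hT.hi
      calc 2 * Real.pi * N * vPoi k z ≤ 2 * Real.pi * N * V := by gcongr
        _ = 2 * Real.pi * V * (1 * N) := by ring
        _ ≤ 2 * Real.pi * V * (N * N) := by gcongr
        _ = _ := by ring
    have hq : 0 ≤ hitProb k z N M :=
      convPow_nonneg (fun j => poiProb_nonneg hz.le j) N M
    rw [card_ksurj_fin hz]
    calc normConst k z N M = normConst k z N M * (2 * (1 / 2)) := by ring
      _ ≤ normConst k z N M * (2 * (hitProb k z N M * (√(2 * Real.pi * V) * N))) := by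
          gcongr
          exact h2.trans (by gcongr)
      _ = _ := by ring
  have hα : 0 ≤ 1 - (#S : ℝ) / N := by
    rw [sub_nonneg, div_le_one (by positivity)]; exact_mod_cast hSN.le
  refine (card_fiber_le_normConst (by omega) hz hT.mean S A hS hSN).trans ?_
  refine mul_le_mul_of_nonneg_right ?_ (by positivity)
  calc Real.exp 2 * M ^ 2 * normConst k z N M
      ≤ Real.exp 2 * ((k + zhi) * N) ^ 2 *
        (2 * √(2 * Real.pi * V) * N * #(ksurj k (Fin M) (Fin N))) := by gcongr
    _ = _ := by ring

end DicoreCount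

namespace DicoreCount

open Finset

variable {N M k k' : ℕ} {zlo zhi : ℝ}

lemma sum_disjoint_pow (a₁ a₀ b₁ b₀ : ℝ) :
    ∑ A : Finset (Fin M), ∑ B ∈ Aᶜ.powerset,
      (a₁ ^ #A * a₀ ^ (M - #A)) * (b₁ ^ #B * b₀ ^ (M - #B)) = (a₁ * b₀ + a₀ * (b₁ + b₀)) ^ M := by
  have h1 : ∀ A : Finset (Fin M), ∑ B ∈ Aᶜ.powerset,
      (a₁ ^ #A * a₀ ^ (M - #A)) * (b₁ ^ #B * b₀ ^ (M - #B)) =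
      (a₁ * b₀) ^ #A * (a₀ * (b₁ + b₀)) ^ (M - #A) := by
    intro A
    have hA : #Aᶜ = M - #A := by rw [card_compl, Fintype.card_fin]
    have hAM : #A ≤ M := by simpa using card_le_univ A
    have h2 := sum_pow_mul_eq_add_pow b₁ b₀ Aᶜ
    rw [hA] at h2
    rw [mul_pow, mul_pow, ← h2, mul_sum, mul_sum]
    refine sum_congr rfl fun B hB => ?_
    have hB' : #B ≤ M - #A := hA ▸ card_le_card (mem_powerset.1 hB)
    rw [show M - #B = #A + (M - #A - #B) by omega, pow_add]
    ring
  rw [sum_congr rfl fun A _ => h1 A]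
  have := Fintype.sum_pow_mul_eq_add_pow (Fin M) (a₁ * b₀) (a₀ * (b₁ + b₀))
  rwa [Fintype.card_fin] at this

lemma card_noEdge_le_sum (K K' : Finset (Fin M → Fin N)) (S W : Finset (Fin N)) :
    #{p ∈ K ×ˢ K' | ∀ e, p.1 e ∈ S → p.2 e ∉ W} ≤
      ∑ A : Finset (Fin M), ∑ B ∈ Aᶜ.powerset,
        #{t ∈ K | ∀ e, t e ∈ S ↔ e ∈ A} * #{h ∈ K' | ∀ e, h e ∈ W ↔ e ∈ B} := by
  have h1 : ({p ∈ K ×ˢ K' | ∀ e, p.1 e ∈ S → p.2 e ∉ W} : Finset _) ⊆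
      (univ.sigma fun A : Finset (Fin M) => Aᶜ.powerset).biUnion fun x =>
        {t ∈ K | ∀ e, t e ∈ S ↔ e ∈ x.1} ×ˢ {h ∈ K' | ∀ e, h e ∈ W ↔ e ∈ x.2} := by
    rintro ⟨t, h⟩ hp
    rw [mem_filter, mem_product] at hp
    rw [mem_biUnion]
    refine ⟨⟨({e | t e ∈ S} : Finset _), ({e | h e ∈ W} : Finset _)⟩, ?_, ?_⟩
    · rw [mem_sigma, mem_powerset]
      refine ⟨mem_univ _, fun e he => ?_⟩
      simp only [mem_filter, mem_univ, true_and, mem_compl] at he ⊢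
      exact fun h' => hp.2 e h' he
    · rw [mem_product, mem_filter, mem_filter]
      refine ⟨⟨hp.1.1, by simp⟩, hp.1.2, by simp⟩
  refine (card_le_card h1).trans (card_biUnion_le.trans (le_of_eq ?_))
  rw [sum_sigma]
  refine sum_congr rfl fun A _ => sum_congr rfl fun B _ => card_product _ _

lemma card_fiber_le_tilt {K : Finset (Fin M → Fin N)} (hK : ∀ t ∈ K, ∀ v, 2 ≤ deg t v)
    {S : Finset (Fin N)} {A : Finset (Fin M)} {X α l : ℝ} (hX : 0 ≤ X) (h0 : 0 ≤ α) (h1 : α ≤ 1)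
    (hl : 1 ≤ l) (h : (#{t ∈ K | ∀ e, t e ∈ S ↔ e ∈ A} : ℝ) ≤ X * (α ^ #A * (1 - α) ^ (M - #A))) :
    (#{t ∈ K | ∀ e, t e ∈ S ↔ e ∈ A} : ℝ) ≤
      X * l⁻¹ ^ (2 * #S) * ((l * α) ^ #A * (1 - α) ^ (M - #A)) := by
  have h1' : 0 ≤ 1 - α := by linarith
  have hl0 : 0 < l := by linarith
  rcases (filter (fun t => ∀ e, t e ∈ S ↔ e ∈ A) K).eq_empty_or_nonempty with h2 | ⟨t, ht⟩
  · rw [h2, card_empty, Nat.cast_zero]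
    positivity
  rw [mem_filter] at ht
  have hA : ({e | t e ∈ S} : Finset _) = A := by ext e; simp [ht.2]
  have h3 := mul_card_le_card_preimage (hK t ht.1) S
  rw [hA] at h3
  refine h.trans ?_
  have h4 : 1 ≤ l⁻¹ ^ (2 * #S) * l ^ #A := by
    rw [inv_pow, inv_mul_eq_div, one_le_div (by positivity)]
    exact pow_le_pow_right₀ hl h3
  calc X * (α ^ #A * (1 - α) ^ (M - #A)) = X * (1 * (α ^ #A * (1 - α) ^ (M - #A))) := by ring
    _ ≤ X * ((l⁻¹ ^ (2 * #S) * l ^ #A) * (α ^ #A * (1 - α) ^ (M - #A))) := by gcongr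
    _ = _ := by rw [mul_pow]; ring

/-- Number of pairs without edges from `S` to `W`. -/
lemma exists_card_noEdge_le (hk : 2 ≤ k) (hk' : 2 ≤ k') (hlo : 0 < zlo) (hhi : zlo ≤ zhi) :
    ∃ C : ℝ, 0 < C ∧ ∃ N0 : ℕ, 2 ≤ N0 ∧ ∀ z z' N M, Tuned k zlo zhi z N M →
      Tuned k' zlo zhi z' N M → N0 ≤ N → ∀ S W : Finset (Fin N), 1 ≤ #S → #S < N → 1 ≤ #W → #W < N →
      ∀ l m : ℝ, 1 ≤ l → 1 ≤ m →
      (#{p ∈ ksurj k (Fin M) (Fin N) ×ˢ ksurj k' (Fin M) (Fin N) |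
          ∀ e, p.1 e ∈ S → p.2 e ∉ W} : ℝ) ≤
        C * N ^ 6 * (#(ksurj k (Fin M) (Fin N)) * #(ksurj k' (Fin M) (Fin N))) *
          (l⁻¹ ^ (2 * #S) * m⁻¹ ^ (2 * #W) * (l * (#S / N) * (1 - #W / N) +
            (1 - #S / N) * (m * (#W / N) + (1 - #W / N))) ^ M) := by
  obtain ⟨C, hC, N0, hN0, hF⟩ := exists_card_fiber_le hk hlo hhi
  obtain ⟨C', hC', N0', hN0', hF'⟩ := exists_card_fiber_le hk' hlo hhi
  refine ⟨C * C', by positivity, max N0 N0', le_max_of_le_left hN0,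
    fun z z' N M hT hT' hN S W hS hSN hW hWN l m hl hm => ?_⟩
  rw [max_le_iff] at hN
  have hNp : (0 : ℝ) < N := by exact_mod_cast (by omega : 0 < N)
  set K := ksurj k (Fin M) (Fin N)
  set K' := ksurj k' (Fin M) (Fin N)
  have hα0 : (0 : ℝ) ≤ #S / N := div_nonneg (Nat.cast_nonneg _) hNp.le
  have hα1 : (#S : ℝ) / N ≤ 1 := by rw [div_le_one hNp]; exact_mod_cast hSN.le
  have hβ0 : (0 : ℝ) ≤ #W / N := div_nonneg (Nat.cast_nonneg _) hNp.le
  have hβ1 : (#W : ℝ) / N ≤ 1 := by rw [div_le_one hNp]; exact_mod_cast hWN.le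
  have hX : 0 ≤ C * N ^ 3 * #K := mul_nonneg (by positivity) (Nat.cast_nonneg _)
  have hX' : 0 ≤ C' * N ^ 3 * #K' := mul_nonneg (by positivity) (Nat.cast_nonneg _)
  have hl0 : 0 < l := by linarith
  have hm0 : 0 < m := by linarith
  have hA : ∀ A, (#{t ∈ K | ∀ e, t e ∈ S ↔ e ∈ A} : ℝ) ≤ C * N ^ 3 * #K * l⁻¹ ^ (2 * #S) *
      ((l * (#S / N)) ^ #A * (1 - #S / N) ^ (M - #A)) := fun A =>
    card_fiber_le_tilt (fun t ht v => hk.trans (mem_ksurj.1 ht v)) hX hα0 hα1 hl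
      (hF z N M hT hN.1 S A hS hSN)
  have hB : ∀ B, (#{t ∈ K' | ∀ e, t e ∈ W ↔ e ∈ B} : ℝ) ≤ C' * N ^ 3 * #K' * m⁻¹ ^ (2 * #W) *
      ((m * (#W / N)) ^ #B * (1 - #W / N) ^ (M - #B)) := fun B =>
    card_fiber_le_tilt (fun t ht v => hk'.trans (mem_ksurj.1 ht v)) hX' hβ0 hβ1 hm
      (hF' z' N M hT' hN.2 W B hW hWN)
  have h1 : (#{p ∈ K ×ˢ K' | ∀ e, p.1 e ∈ S → p.2 e ∉ W} : ℝ) ≤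
      ∑ A : Finset (Fin M), ∑ B ∈ Aᶜ.powerset,
        (#{t ∈ K | ∀ e, t e ∈ S ↔ e ∈ A} : ℝ) * #{h ∈ K' | ∀ e, h e ∈ W ↔ e ∈ B} := by
    exact_mod_cast card_noEdge_le_sum K K' S W
  rw [← sum_disjoint_pow]
  refine h1.trans ?_
  set α := (#S : ℝ) / N
  set β := (#W : ℝ) / N
  have hα1' : 0 ≤ 1 - α := by linarith
  calc ∑ A : Finset (Fin M), ∑ B ∈ Aᶜ.powerset,
        (#{t ∈ K | ∀ e, t e ∈ S ↔ e ∈ A} : ℝ) * #{h ∈ K' | ∀ e, h e ∈ W ↔ e ∈ B}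
      ≤ ∑ A : Finset (Fin M), ∑ B ∈ Aᶜ.powerset,
        (C * N ^ 3 * #K * l⁻¹ ^ (2 * #S) * ((l * α) ^ #A * (1 - α) ^ (M - #A))) *
        (C' * N ^ 3 * #K' * m⁻¹ ^ (2 * #W) * ((m * β) ^ #B * (1 - β) ^ (M - #B))) := by
        refine sum_le_sum fun A _ => sum_le_sum fun B _ => ?_
        refine mul_le_mul (hA A) (hB B) (Nat.cast_nonneg _) ?_
        exact (Nat.cast_nonneg _).trans (hA A)
    _ = _ := by
        simp only [mul_sum]
        refine sum_congr rfl fun A _ => sum_congr rfl fun B _ => ?_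
        ring

end DicoreCount

namespace DicoreCount

open Finset

lemma log_one_sub_le {x : ℝ} (h0 : 0 ≤ x) (h1 : x < 1) :
    Real.log (1 - x) ≤ -(x + x ^ 2 / 2 + x ^ 3 / 3) := by
  have h := Real.hasSum_pow_div_log_of_abs_lt_one (by rwa [abs_of_nonneg h0] : |x| < 1)
  have h2 := sum_le_hasSum (range 3) (fun i _ => by positivity) h
  simp only [sum_range_succ, range_zero, sum_empty] at h2
  norm_num at h2
  linarith

lemma log_one_add_le {x : ℝ} (h0 : 0 ≤ x) : Real.log (1 + x) ≤ x - x ^ 2 / 2 + x ^ 3 / 3 := by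
  set g : ℝ → ℝ := fun x => x - x ^ 2 / 2 + x ^ 3 / 3 - Real.log (1 + x) with hg
  have hd : ∀ y, 0 ≤ y → HasDerivAt g (1 - y + y ^ 2 - 1 / (1 + y)) y := fun y hy => by
    have h1 := (((hasDerivAt_id y).sub ((hasDerivAt_pow 2 y).div_const 2)).add
      ((hasDerivAt_pow 3 y).div_const 3)).sub
      (((hasDerivAt_id y).const_add 1).log (by simp only [id_eq]; positivity))
    refine h1.congr_deriv ?_
    simp only [id_eq]; push_cast; ring
  have h1 : MonotoneOn g (Set.Icc 0 x) := by
    refine monotoneOn_of_deriv_nonneg (convex_Icc 0 x)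
      (fun y hy => (hd y hy.1).continuousAt.continuousWithinAt)
      (fun y hy => ?_) fun y hy => ?_
    · rw [interior_Icc] at hy
      exact (hd y hy.1.le).differentiableAt.differentiableWithinAt
    · rw [interior_Icc] at hy
      rw [(hd y hy.1.le).deriv]
      have hy0 := hy.1
      rw [show 1 - y + y ^ 2 - 1 / (1 + y) = y ^ 3 / (1 + y) by field_simp; ring]
      positivity
  have h2 := h1 (Set.left_mem_Icc.2 h0) (Set.right_mem_Icc.2 h0) h0
  simp only [hg] at h2
  norm_num at h2
  linarith

lemma log_le_of_le_half {a : ℝ} (h0 : 0 < a) (h1 : a ≤ 1 / 2) :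
    Real.log a ≤ -(0.6931 + (1 - 2 * a) + (1 - 2 * a) ^ 2 / 2 + (1 - 2 * a) ^ 3 / 3) := by
  have h := log_one_sub_le (x := 1 - 2 * a) (by linarith) (by linarith)
  rw [show 1 - (1 - 2 * a) = 2 * a by ring, Real.log_mul (by norm_num) h0.ne'] at h
  have := Real.log_two_gt_d9
  linarith

lemma entropy_bound {a : ℝ} (h0 : 0 < a) (h1 : a ≤ 1 / 2) :
    a * Real.log a + (1 - a) * Real.log (1 - a) + 2.65 * (a * (1 - a)) ≤ a * Real.log a / 100 := by
  have hL := log_le_of_le_half h0 h1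
  have hM := log_one_sub_le h0.le (by linarith : a < 1)
  have h2 : 0.99 * Real.log a + (1 - a) * (-(1 + a / 2 + a ^ 2 / 3)) + 2.65 * (1 - a) ≤ 0 := by
    nlinarith [mul_nonneg h0.le (by linarith : 0 ≤ 1 - 2 * a), sq_nonneg a, sq_nonneg (1 - 2 * a),
      mul_nonneg (sq_nonneg a) (by linarith : 0 ≤ 1 - 2 * a),
      mul_nonneg h0.le (sq_nonneg (1 - 2 * a))]
  have h3 : (1 - a) * Real.log (1 - a) ≤ a * ((1 - a) * (-(1 + a / 2 + a ^ 2 / 3))) := by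
    calc (1 - a) * Real.log (1 - a) ≤ (1 - a) * (-(a + a ^ 2 / 2 + a ^ 3 / 3)) :=
          mul_le_mul_of_nonneg_left hM (by linarith)
      _ = _ := by ring
  have h4 := mul_nonpos_of_nonneg_of_nonpos h0.le h2
  linarith

lemma tilt_bound {a : ℝ} (h0 : 0 < a) (h1 : a ≤ 1 / 2) :
    a * Real.log a - (1 + a) * Real.log (1 - a) +
      2.65 * (Real.log (1 - a) + Real.log (1 + a)) ≤ a * Real.log a / 100 := by
  have hL := log_le_of_le_half h0 h1
  have hM := log_one_sub_le h0.le (by linarith : a < 1)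
  have hP := log_one_add_le h0.le
  have h2 : 0.99 * Real.log a + (1.65 - a) * (-(1 + a / 2 + a ^ 2 / 3)) +
      2.65 * (1 - a / 2 + a ^ 2 / 3) ≤ 0 := by
    nlinarith [mul_nonneg h0.le (by linarith : 0 ≤ 1 - 2 * a), sq_nonneg a, sq_nonneg (1 - 2 * a),
      mul_nonneg (sq_nonneg a) (by linarith : 0 ≤ 1 - 2 * a),
      mul_nonneg h0.le (sq_nonneg (1 - 2 * a))]
  have h3 : (1.65 - a) * Real.log (1 - a) ≤ a * ((1.65 - a) * (-(1 + a / 2 + a ^ 2 / 3))) := by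
    calc (1.65 - a) * Real.log (1 - a) ≤ (1.65 - a) * (-(a + a ^ 2 / 2 + a ^ 3 / 3)) :=
          mul_le_mul_of_nonneg_left hM (by linarith)
      _ = _ := by ring
  have h4 := mul_nonpos_of_nonneg_of_nonpos h0.le h2
  linarith

lemma choose_mul_pow_le {N s : ℕ} (hs : s ≤ N) {a : ℝ} (h0 : 0 ≤ a) (h1 : a ≤ 1) :
    (N.choose s : ℝ) * (a ^ s * (1 - a) ^ (N - s)) ≤ 1 := by
  have h := add_pow a (1 - a) N
  rw [add_sub_cancel, one_pow] at h
  have h1' : 0 ≤ 1 - a := by linarith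
  have h2 := single_le_sum (f := fun m => a ^ m * (1 - a) ^ (N - m) * (N.choose m : ℝ))
    (s := range (N + 1)) (fun i _ => by positivity) (mem_range.2 (Nat.lt_succ_of_le hs))
  rw [← h] at h2
  linarith

lemma pow_eq_exp_mul_log {x : ℝ} (hx : 0 < x) (n : ℕ) : x ^ n = Real.exp (n * Real.log x) := by
  rw [Real.exp_nat_mul, Real.exp_log hx]

/-- The weight of the union bound for a set of size `s` with suitable tilting parameters. -/
lemma exists_tilt (κ : ℕ) (c : ℝ) : ∃ D : ℝ, 0 < D ∧ ∀ N M s w : ℕ, 1 ≤ s → 2 * s ≤ N →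
    s + w + κ = N → (M : ℝ) ≤ c * N → ∃ l m : ℝ, 1 ≤ l ∧ 1 ≤ m ∧
      (N.choose s : ℝ) * (l⁻¹ ^ (2 * s) * m⁻¹ ^ (2 * w) * (l * (s / N) * (1 - w / N) +
        (1 - s / N) * (m * (w / N) + (1 - w / N))) ^ M) ≤
        D * Real.exp (s * Real.log (s / N) / 100) := by
  refine ⟨max (Real.exp (2 * κ) * 4 ^ κ) (Real.exp (κ * c)), lt_max_of_lt_left (by positivity),
    fun N M s w hs hsN hw hM => ?_⟩
  have hs0 : (0 : ℝ) < s := by exact_mod_cast hs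
  have hN0 : (0 : ℝ) < N := by exact_mod_cast (by omega : 0 < N)
  have hwN : (s : ℝ) + w + κ = N := by exact_mod_cast hw
  obtain ⟨α, hα⟩ : ∃ α : ℝ, α = s / N := ⟨_, rfl⟩
  obtain ⟨β, hβ⟩ : ∃ β : ℝ, β = w / N := ⟨_, rfl⟩
  have hα0 : 0 < α := by rw [hα]; positivity
  have hα1 : α ≤ 1 / 2 := by
    rw [hα, div_le_iff₀ hN0]
    have : (2 : ℝ) * s ≤ N := by exact_mod_cast hsN
    linarith
  have hβ0 : 0 ≤ β := by rw [hβ]; positivity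
  have hsα : (s : ℝ) = N * α := by rw [hα]; field_simp
  have hβα : 1 - β = α + κ / N := by
    rw [hα, hβ]; field_simp; linarith
  have hκ : (0 : ℝ) ≤ κ / N := by positivity
  rw [← hα, ← hβ]
  have hα1' : 0 < 1 - α := by linarith
  have hβ1' : 0 < 1 - β := by rw [hβα]; positivity
  have hch := choose_mul_pow_le (show s ≤ N by omega) hα0.le (by linarith : α ≤ 1)
  have hch' : (N.choose s : ℝ) ≤ Real.exp (-(N * (α * Real.log α + (1 - α) * Real.log (1 - α)))) := by
    rw [pow_eq_exp_mul_log hα0, pow_eq_exp_mul_log hα1', ← Real.exp_add] at hch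
    rw [Real.exp_neg, ← one_div, le_div_iff₀ (Real.exp_pos _)]
    have e : (N : ℝ) * (α * Real.log α + (1 - α) * Real.log (1 - α)) =
        s * Real.log α + ((N - s : ℕ) : ℝ) * Real.log (1 - α) := by
      rw [Nat.cast_sub (by omega), hsα]; ring
    rw [e]; exact hch
  have hNα : N * (α * Real.log α / 100) = s * Real.log α / 100 := by rw [hsα]; ring
  rcases le_total (M : ℝ) (2.65 * N) with hc | hc
  · refine ⟨(1 - β)⁻¹, (1 - α)⁻¹, (one_le_inv₀ hβ1').2 (by linarith),
      (one_le_inv₀ hα1').2 (by linarith), ?_⟩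
    rw [inv_inv, inv_inv, show (1 - β)⁻¹ * α * (1 - β) + (1 - α) * ((1 - α)⁻¹ * β + (1 - β)) =
      1 + α * β by field_simp; ring]
    have h1 : (1 - β) ^ (2 * s) ≤ Real.exp (2 * κ) * Real.exp (2 * s * Real.log α) := by
      have h2 : 1 - β ≤ α * Real.exp (κ / s) := by
        have h3 := Real.add_one_le_exp ((κ : ℝ) / s)
        calc 1 - β = α * (κ / s + 1) := by rw [hβα, hsα]; field_simp; ring
          _ ≤ _ := by gcongr
      calc (1 - β) ^ (2 * s) ≤ (α * Real.exp (κ / s)) ^ (2 * s) := by gcongr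
        _ = _ := by
          rw [mul_pow, pow_eq_exp_mul_log hα0, ← Real.exp_nat_mul, mul_comm]
          congr 2
          · push_cast; field_simp
          · push_cast; rfl
    have h2 : (1 - α) ^ (2 * w) ≤ 4 ^ κ * Real.exp (2 * (N - s) * Real.log (1 - α)) := by
      have h3 : (1 : ℝ) ≤ 4 ^ κ * (1 - α) ^ (2 * κ) := by
        rw [pow_mul, ← mul_pow]
        refine one_le_pow₀ ?_
        nlinarith
      calc (1 - α) ^ (2 * w) ≤ (1 - α) ^ (2 * w) * (4 ^ κ * (1 - α) ^ (2 * κ)) :=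
            le_mul_of_one_le_right (by positivity) h3
        _ = 4 ^ κ * (1 - α) ^ (2 * w + 2 * κ) := by rw [pow_add]; ring
        _ = _ := by
          rw [pow_eq_exp_mul_log hα1']; push_cast
          rw [← hwN]; ring_nf
    have h3 : (1 + α * β) ^ M ≤ Real.exp (2.65 * N * (α * (1 - α))) := by
      calc (1 + α * β) ^ M ≤ Real.exp (α * β) ^ M := by
            gcongr; linarith [Real.add_one_le_exp (α * β)]
        _ = Real.exp (M * (α * β)) := by rw [Real.exp_nat_mul]
        _ ≤ _ := by
          refine Real.exp_le_exp.2 ?_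
          gcongr
          linarith
    have h4 := mul_le_mul_of_nonneg_left (entropy_bound hα0 hα1) hN0.le
    rw [hNα] at h4
    calc (N.choose s : ℝ) * ((1 - β) ^ (2 * s) * (1 - α) ^ (2 * w) * (1 + α * β) ^ M)
        ≤ Real.exp (-(N * (α * Real.log α + (1 - α) * Real.log (1 - α)))) *
          ((Real.exp (2 * κ) * Real.exp (2 * s * Real.log α)) *
          (4 ^ κ * Real.exp (2 * (N - s) * Real.log (1 - α))) *
          Real.exp (2.65 * N * (α * (1 - α)))) := by
          gcongr
      _ = (Real.exp (2 * κ) * 4 ^ κ) * Real.exp (N * (α * Real.log α +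
            (1 - α) * Real.log (1 - α) + 2.65 * (α * (1 - α)))) := by
          rw [show (N : ℝ) * (α * Real.log α + (1 - α) * Real.log (1 - α) + 2.65 * (α * (1 - α))) =
            -(N * (α * Real.log α + (1 - α) * Real.log (1 - α))) + 2 * s * Real.log α +
            2 * (N - s) * Real.log (1 - α) + 2.65 * N * (α * (1 - α)) by rw [hsα]; ring,
            Real.exp_add, Real.exp_add, Real.exp_add]
          ring
      _ ≤ _ := by
          gcongr
          exact le_max_left _ _
  · refine ⟨(1 - α) / α, 1, (one_le_div hα0).2 (by linarith), le_rfl, ?_⟩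
    rw [inv_div, inv_one, one_pow, mul_one, show (1 - α) / α * α * (1 - β) +
      (1 - α) * (1 * β + (1 - β)) = (1 - α) * (1 + α + κ / N) by
        rw [div_mul_cancel₀ _ hα0.ne', show 1 * β + (1 - β) = 1 by ring, hβα]; ring]
    have h1 : (α / (1 - α)) ^ (2 * s) = Real.exp (2 * s * (Real.log α - Real.log (1 - α))) := by
      rw [pow_eq_exp_mul_log (by positivity), Real.log_div hα0.ne' hα1'.ne']; push_cast; rfl
    have h2 : ((1 - α) * (1 + α + κ / N)) ^ M ≤
        Real.exp (κ * c) * Real.exp (2.65 * N * (Real.log (1 - α) + Real.log (1 + α))) := by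
      have h3 : 1 + α + κ / N ≤ (1 + α) * Real.exp (κ / N) := by
        have h3 := Real.add_one_le_exp ((κ : ℝ) / N)
        calc 1 + α + κ / N ≤ (1 + α) * (κ / N + 1) := by linarith [mul_nonneg hα0.le hκ]
          _ ≤ _ := by gcongr
      have h5 : Real.log (1 - α) + Real.log (1 + α) ≤ 0 := by
        rw [← Real.log_mul hα1'.ne' (by positivity)]
        exact Real.log_nonpos (by positivity) (by nlinarith)
      calc ((1 - α) * (1 + α + κ / N)) ^ M
          ≤ ((1 - α) * ((1 + α) * Real.exp (κ / N))) ^ M := by gcongr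
        _ = Real.exp (M * (κ / N)) * Real.exp (M * (Real.log (1 - α) + Real.log (1 + α))) := by
          rw [mul_pow, mul_pow, pow_eq_exp_mul_log hα1', pow_eq_exp_mul_log (by positivity : 0 < 1 + α),
            ← Real.exp_nat_mul, mul_add, Real.exp_add (_ * _)]
          ring
        _ ≤ _ := by
          refine mul_le_mul (Real.exp_le_exp.2 ?_) (Real.exp_le_exp.2 ?_) (Real.exp_pos _).le
            (Real.exp_pos _).le
          · calc (M : ℝ) * (κ / N) ≤ (c * N) * (κ / N) := by gcongr
              _ = _ := by field_simp
          · exact mul_le_mul_of_nonpos_right hc h5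
    have h4 := mul_le_mul_of_nonneg_left (tilt_bound hα0 hα1) hN0.le
    rw [hNα] at h4
    calc (N.choose s : ℝ) * ((α / (1 - α)) ^ (2 * s) * ((1 - α) * (1 + α + κ / N)) ^ M)
        ≤ Real.exp (-(N * (α * Real.log α + (1 - α) * Real.log (1 - α)))) *
          (Real.exp (2 * s * (Real.log α - Real.log (1 - α))) *
          (Real.exp (κ * c) * Real.exp (2.65 * N * (Real.log (1 - α) + Real.log (1 + α))))) := by
          rw [h1]; gcongr
      _ = Real.exp (κ * c) * Real.exp (N * (α * Real.log α - (1 + α) * Real.log (1 - α) +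
            2.65 * (Real.log (1 - α) + Real.log (1 + α)))) := by
          rw [show (N : ℝ) * (α * Real.log α - (1 + α) * Real.log (1 - α) +
            2.65 * (Real.log (1 - α) + Real.log (1 + α))) =
            -(N * (α * Real.log α + (1 - α) * Real.log (1 - α))) +
            2 * s * (Real.log α - Real.log (1 - α)) +
            2.65 * N * (Real.log (1 - α) + Real.log (1 + α)) by rw [hsα]; ring,
            Real.exp_add, Real.exp_add]
          ring
      _ ≤ _ := by
          gcongr
          exact le_max_right _ _

end DicoreCount

namespace DicoreCount

open Finset

lemma exp_neg_le_pow {N : ℕ} (hN : 1 ≤ N) (P : ℕ) {x : ℝ} (hx : P * Real.log N ≤ x) :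
    Real.exp (-x) ≤ ((N : ℝ) ^ P)⁻¹ := by
  have hN0 : (0 : ℝ) < N := by exact_mod_cast hN
  rw [pow_eq_exp_mul_log hN0, ← Real.exp_neg]
  exact Real.exp_le_exp.2 (by linarith)

/-- The tilted weight is polynomially small once the set has at least a constant size. -/
lemma exists_weight_le (P : ℕ) : ∃ C : ℝ, 0 < C ∧ ∀ N s : ℕ, 200 * P ≤ s → 1 ≤ s → 2 * s ≤ N →
    Real.exp (s * Real.log (s / N) / 100) ≤ C * ((N : ℝ) ^ P)⁻¹ := by
  refine ⟨max 1 ((2 * P).factorial * 200 ^ (2 * P)), lt_max_of_lt_left one_pos,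
    fun N s hs hs1 hsN => ?_⟩
  have hN : 1 ≤ N := by omega
  have hN0 : (0 : ℝ) < N := by exact_mod_cast hN
  have hs0 : (0 : ℝ) < s := by exact_mod_cast hs1
  have hPN : (0 : ℝ) < ((N : ℝ) ^ P)⁻¹ := by positivity
  have hlogN : 0 ≤ Real.log N := Real.log_nonneg (by exact_mod_cast hN)
  have hdiv : Real.log (s / N) = Real.log s - Real.log N :=
    Real.log_div hs0.ne' hN0.ne'
  rcases le_total (s ^ 2) N with h | h
  · have h1 : 2 * Real.log s ≤ Real.log N := by
      have : Real.log ((s : ℝ) ^ 2) ≤ Real.log N :=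
        Real.log_le_log (by positivity) (by exact_mod_cast h)
      rwa [Real.log_pow, Nat.cast_ofNat] at this
    have h2 : (P : ℝ) * Real.log N ≤ -(s * Real.log (s / N) / 100) := by
      have h3 : (200 : ℝ) * P ≤ s := by exact_mod_cast hs
      calc (P : ℝ) * Real.log N = 200 * P * Real.log N / 200 := by ring
        _ ≤ s * Real.log N / 200 := by gcongr
        _ = s * (Real.log N / 2) / 100 := by ring
        _ ≤ s * (Real.log N - Real.log s) / 100 := by gcongr; linarith
        _ = _ := by rw [hdiv]; ring
    have h4 := exp_neg_le_pow hN P h2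
    rw [neg_neg] at h4
    exact h4.trans (le_mul_of_one_le_left hPN.le (le_max_left _ _))
  · have hlog : Real.log (s / N) ≤ -(1 / 2) := by
      have h1 : (s : ℝ) / N ≤ 1 / 2 := by
        rw [div_le_iff₀ hN0]
        have : (2 : ℝ) * s ≤ N := by exact_mod_cast hsN
        linarith
      calc Real.log (s / N) ≤ s / N - 1 := Real.log_le_sub_one_of_pos (by positivity)
        _ ≤ _ := by linarith
    have h2 : s * Real.log (s / N) / 100 ≤ -((s : ℝ) / 200) := by
      calc s * Real.log (s / N) / 100 ≤ s * (-(1 / 2)) / 100 := by gcongr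
        _ = _ := by ring
    have h3 : ((s : ℝ) / 200) ^ (2 * P) * Real.exp (-((s : ℝ) / 200)) ≤ (2 * P).factorial := by
      have h5 := Real.pow_div_factorial_le_exp ((s : ℝ) / 200) (by positivity) (2 * P)
      rw [div_le_iff₀ (by positivity)] at h5
      rw [Real.exp_neg, ← div_eq_mul_inv, div_le_iff₀ (Real.exp_pos _)]
      linarith
    have h4 : (N : ℝ) ^ P ≤ (s : ℝ) ^ (2 * P) := by
      rw [pow_mul]
      exact pow_le_pow_left₀ hN0.le (by exact_mod_cast h) P
    calc Real.exp (s * Real.log (s / N) / 100) ≤ Real.exp (-((s : ℝ) / 200)) := Real.exp_le_exp.2 h2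
      _ = ((s : ℝ) / 200) ^ (2 * P) * Real.exp (-((s : ℝ) / 200)) * 200 ^ (2 * P) *
          ((s : ℝ) ^ (2 * P))⁻¹ := by rw [div_pow]; field_simp
      _ ≤ ((2 * P).factorial : ℝ) * 200 ^ (2 * P) * ((N : ℝ) ^ P)⁻¹ := by gcongr
      _ ≤ _ := by gcongr; exact le_max_right _ _

/-- There are disjoint vertex sets, the first of size `s` and together missing `κ` vertices, with no
edge from the first to the second. -/
def HasCut {N M : ℕ} (κ s : ℕ) (t h : Fin M → Fin N) : Prop :=
  ∃ S W : Finset (Fin N), Disjoint S W ∧ #S = s ∧ #S + #W + κ = N ∧ ∀ e, t e ∈ S → h e ∉ W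

noncomputable instance {N M : ℕ} (κ s : ℕ) (t h : Fin M → Fin N) : Decidable (HasCut κ s t h) :=
  Classical.propDecidable _

/-- Union bound over the cuts with a first set of size `s`. -/
lemma card_hasCut_le {N M : ℕ} (P : Finset ((Fin M → Fin N) × (Fin M → Fin N))) (κ s : ℕ) {B : ℝ}
    (hB : 0 ≤ B)
    (h : ∀ S W : Finset (Fin N), Disjoint S W → #S = s → #S + #W + κ = N →
      (#{p ∈ P | ∀ e, p.1 e ∈ S → p.2 e ∉ W} : ℝ) ≤ B) :
    (#{p ∈ P | HasCut κ s p.1 p.2} : ℝ) ≤ N.choose s * N ^ κ * B := by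
  classical
  let I : Finset (Finset (Fin N) × Finset (Fin N)) :=
    {q ∈ powersetCard s univ ×ˢ powersetCard κ univ | Disjoint q.1 q.2}
  have hsub : ({p ∈ P | HasCut κ s p.1 p.2} : Finset _) ⊆
      I.biUnion fun q => {p ∈ P | ∀ e, p.1 e ∈ q.1 → p.2 e ∉ (q.1 ∪ q.2)ᶜ} := by
    intro p hp
    rw [mem_filter] at hp
    obtain ⟨hpP, S, W, hd, hS, hSW, he⟩ := hp
    have hcard : #(S ∪ W) = #S + #W := card_union_of_disjoint hd
    have hc := card_add_card_compl (S ∪ W)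
    rw [Fintype.card_fin] at hc
    rw [mem_biUnion]
    refine ⟨(S, (S ∪ W)ᶜ), ?_, ?_⟩
    · simp only [I, mem_filter, mem_product, mem_powersetCard, subset_univ, true_and]
      refine ⟨⟨hS, by omega⟩, ?_⟩
      exact disjoint_compl_right.mono_left subset_union_left
    · rw [mem_filter]
      refine ⟨hpP, fun e h1 h2 => he e h1 ?_⟩
      simp only [mem_compl, mem_union, not_or, not_and, not_not] at h2
      tauto
  have hI : (#I : ℝ) ≤ N.choose s * N ^ κ := by
    have h1 : #I ≤ N.choose s * N.choose κ := by
      refine (card_filter_le _ _).trans (le_of_eq ?_)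
      rw [card_product, card_powersetCard, card_powersetCard, card_univ, Fintype.card_fin]
    calc (#I : ℝ) ≤ ((N.choose s * N.choose κ : ℕ) : ℝ) := by exact_mod_cast h1
      _ ≤ ((N.choose s * N ^ κ : ℕ) : ℝ) := by
        exact_mod_cast Nat.mul_le_mul_left _ (Nat.choose_le_pow N κ)
      _ = _ := by push_cast; rfl
  calc (#{p ∈ P | HasCut κ s p.1 p.2} : ℝ)
      ≤ ∑ q ∈ I, (#{p ∈ P | ∀ e, p.1 e ∈ q.1 → p.2 e ∉ (q.1 ∪ q.2)ᶜ} : ℝ) := by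
        exact_mod_cast (card_le_card hsub).trans card_biUnion_le
    _ ≤ ∑ _q ∈ I, B := by
        refine sum_le_sum fun q hq => ?_
        simp only [I, mem_filter, mem_product, mem_powersetCard, subset_univ, true_and] at hq
        refine h _ _ (disjoint_compl_right.mono_left subset_union_left) hq.1.1 ?_
        have hc := card_add_card_compl (q.1 ∪ q.2)
        rw [Fintype.card_fin, card_union_of_disjoint hq.2] at hc
        omega
    _ = #I * B := by rw [sum_const, nsmul_eq_mul]
    _ ≤ _ := by gcongr

section

variable {k k' : ℕ} {zlo zhi : ℝ}

/-- Cuts with a first set of at least a constant size are rare. -/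
lemma exists_large_cut (κ : ℕ) (hk : 2 ≤ k) (hk' : 2 ≤ k') (hlo : 0 < zlo) (hhi : zlo ≤ zhi) :
    ∃ s0 : ℕ, ∃ C : ℝ, 0 < C ∧ ∃ N0 : ℕ, 2 ≤ N0 ∧ ∀ z z' N M, Tuned k zlo zhi z N M →
      Tuned k' zlo zhi z' N M → N0 ≤ N →
      (#{p ∈ ksurj k (Fin M) (Fin N) ×ˢ ksurj k' (Fin M) (Fin N) |
          ∃ s ∈ Icc s0 (N / 2), HasCut κ s p.1 p.2} : ℝ) ≤
        C / N * (#(ksurj k (Fin M) (Fin N)) * #(ksurj k' (Fin M) (Fin N))) := by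
  classical
  obtain ⟨C, hC, N0, hN0, hF⟩ := exists_card_noEdge_le hk hk' hlo hhi
  obtain ⟨D, hD, hT⟩ := exists_tilt κ (zhi + k)
  obtain ⟨C', hC', hW⟩ := exists_weight_le (κ + 8)
  obtain ⟨s0, hs0⟩ : ∃ s0, s0 = 200 * (κ + 8) := ⟨_, rfl⟩
  refine ⟨s0, C * D * C', by positivity, max N0 (2 * κ + 2), le_max_of_le_left hN0,
    fun z z' N M hz hz' hN => ?_⟩
  rw [max_le_iff] at hN
  have hN1 : 1 ≤ N := by omega
  have hNp : (0 : ℝ) < N := by exact_mod_cast hN1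
  obtain ⟨n, hn⟩ : ∃ n : ℝ, n = #(ksurj k (Fin M) (Fin N)) * #(ksurj k' (Fin M) (Fin N)) := ⟨_, rfl⟩
  have hn0 : 0 ≤ n := by rw [hn]; positivity
  have hMc : (M : ℝ) ≤ (zhi + k) * N := by
    rw [← hz.mean]
    have h1 := mPoi_sub_le (show 1 ≤ k by omega) (hlo.trans_le hz.lo)
    have h2 := hz.hi
    gcongr
    linarith
  have hs : ∀ s, s0 ≤ s → 2 * s ≤ N →
      (#{p ∈ ksurj k (Fin M) (Fin N) ×ˢ ksurj k' (Fin M) (Fin N) | HasCut κ s p.1 p.2} : ℝ) ≤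
        C * D * C' * n * ((N : ℝ) ^ 2)⁻¹ := by
    intro s hs1 hs2
    obtain ⟨w, hw⟩ : ∃ w, s + w + κ = N := ⟨N - κ - s, by omega⟩
    obtain ⟨l, m, hl, hm, hlm⟩ := hT N M s w (by omega) hs2 hw hMc
    have hsN0 : (s : ℝ) / N ≤ 1 := by
      rw [div_le_one hNp]; exact_mod_cast (by omega : s ≤ N)
    have hw0 : (w : ℝ) / N ≤ 1 := by
      rw [div_le_one hNp]; exact_mod_cast (by omega : w ≤ N)
    have hs0' : 0 ≤ 1 - (s : ℝ) / N := by linarith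
    have hw0' : 0 ≤ 1 - (w : ℝ) / N := by linarith
    obtain ⟨X, hX⟩ : ∃ X : ℝ, X = l⁻¹ ^ (2 * s) * m⁻¹ ^ (2 * w) * (l * (s / N) * (1 - w / N) +
        (1 - s / N) * (m * (w / N) + (1 - w / N))) ^ M := ⟨_, rfl⟩
    have hX0 : 0 ≤ X := by rw [hX]; positivity
    rw [← hX] at hlm
    have h1 := card_hasCut_le (ksurj k (Fin M) (Fin N) ×ˢ ksurj k' (Fin M) (Fin N)) κ s
      (B := C * N ^ 6 * n * X) (by positivity) ?_
    · calc _ ≤ _ := h1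
        _ = C * N ^ (κ + 6) * n * (N.choose s * X) := by rw [pow_add]; ring
        _ ≤ C * N ^ (κ + 6) * n * (D * (C' * ((N : ℝ) ^ (κ + 8))⁻¹)) := by
          refine mul_le_mul_of_nonneg_left (hlm.trans ?_) (by positivity)
          exact mul_le_mul_of_nonneg_left (hW N s (hs0 ▸ hs1) (by omega) hs2) hD.le
        _ = _ := by
          rw [show κ + 8 = κ + 6 + 2 by ring, pow_add (N : ℝ) (κ + 6) 2]; field_simp
    · intro S W hd hS hSW
      have hWw : #W = w := by omega
      have h2 := hF z z' N M hz hz' hN.1 S W (by omega) (by omega) (by omega) (by omega) l m hl hm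
      rw [hS, hWw, ← hX, ← hn] at h2
      exact h2
  have hsub : ({p ∈ ksurj k (Fin M) (Fin N) ×ˢ ksurj k' (Fin M) (Fin N) |
      ∃ s ∈ Icc s0 (N / 2), HasCut κ s p.1 p.2} : Finset _) ⊆
      (Icc s0 (N / 2)).biUnion fun s =>
        {p ∈ ksurj k (Fin M) (Fin N) ×ˢ ksurj k' (Fin M) (Fin N) | HasCut κ s p.1 p.2} := by
    intro p hp
    rw [mem_filter] at hp
    obtain ⟨hp1, s, h1, h3⟩ := hp
    rw [mem_biUnion]
    exact ⟨s, h1, mem_filter.2 ⟨hp1, h3⟩⟩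
  rw [← hn]
  calc _ ≤ ∑ s ∈ Icc s0 (N / 2),
        (#{p ∈ ksurj k (Fin M) (Fin N) ×ˢ ksurj k' (Fin M) (Fin N) | HasCut κ s p.1 p.2} : ℝ) := by
        exact_mod_cast (card_le_card hsub).trans card_biUnion_le
    _ ≤ ∑ s ∈ Icc s0 (N / 2),
        C * D * C' * n * ((N : ℝ) ^ 2)⁻¹ :=
        sum_le_sum fun s hs' => by
          rw [mem_Icc] at hs'
          exact hs s hs'.1 (by omega)
    _ ≤ ∑ s ∈ range N, C * D * C' * n * ((N : ℝ) ^ 2)⁻¹ :=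
        sum_le_sum_of_subset_of_nonneg (fun s hs' => by
          rw [mem_Icc] at hs'
          exact mem_range.2 (by omega)) fun _ _ _ => by positivity
    _ = _ := by rw [sum_const, card_range, nsmul_eq_mul]; field_simp

end

end DicoreCount

namespace DicoreCount

open Finset

variable {N M : ℕ}

lemma card_perm_mapsTo_le (A B : Finset (Fin M)) :
    #{σ : Equiv.Perm (Fin M) | ∀ e ∈ A, σ e ∈ B} ≤ #B ^ #A * (M - #A).factorial := by
  classical
  let G : Finset (Fin M → Fin M) := Fintype.piFinset fun e => if e ∈ A then B else {e}
  have hG : #G = #B ^ #A := by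
    rw [Fintype.card_piFinset, ← prod_const, ← prod_subset (subset_univ A)]
    · exact prod_congr rfl fun e he => by rw [if_pos he]
    · intro e _ he
      rw [if_neg he, card_singleton]
  have hsub : ({σ : Equiv.Perm (Fin M) | ∀ e ∈ A, σ e ∈ B} : Finset _) ⊆
      G.biUnion fun g => {σ : Equiv.Perm (Fin M) | ∀ z ∈ A, σ z = g z} := by
    intro σ hσ
    rw [mem_filter] at hσ
    rw [mem_biUnion]
    refine ⟨fun e => if e ∈ A then σ e else e, ?_, ?_⟩
    · rw [Fintype.mem_piFinset]
      intro e
      by_cases he : e ∈ A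
      · simp only [he, if_true]; exact hσ.2 e he
      · simp only [he, if_false, mem_singleton]
    · rw [mem_filter]
      exact ⟨mem_univ _, fun z hz => (if_pos hz).symm⟩
  calc _ ≤ _ := card_le_card hsub
    _ ≤ #G * (M - #A).factorial := by
      refine card_biUnion_le_card_mul _ _ _ fun g _ => ?_
      have h := card_perm_eqOn_le A g
      rw [Fintype.card_fin] at h
      convert h
    _ = _ := by rw [hG]

/-- The probability that there is no edge from `S` to `W`, bounded via a random matching of tails
and heads. -/
lemma card_noEdge_ksurjLe_mul_le {k k' Δ a b : ℕ} (S W : Finset (Fin N)) (ha : a ≤ k * #S)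
    (hb : #Wᶜ * Δ ≤ b) :
    #{p ∈ ksurjLe k Δ N M ×ˢ ksurjLe k' Δ N M | ∀ e, p.1 e ∈ S → p.2 e ∉ W} * M.factorial ≤
      #(ksurjLe k Δ N M) * #(ksurjLe k' Δ N M) * (b ^ a * (M - a).factorial) := by
  have h1 : ∀ σ : Equiv.Perm (Fin M),
      #{p ∈ ksurjLe k Δ N M ×ˢ ksurjLe k' Δ N M | ∀ e, p.1 e ∈ S → p.2 e ∉ W} =
      #{p ∈ ksurjLe k Δ N M ×ˢ ksurjLe k' Δ N M | ∀ e, p.1 e ∈ S → p.2 (σ e) ∉ W} := by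
    intro σ
    refine (card_equiv ((Equiv.refl _).prodCongr (σ.arrowCongr (Equiv.refl _))) ?_)
    rintro ⟨t, h⟩
    have h2 : (h ∘ σ.symm) ∈ ksurjLe k' Δ N M ↔ h ∈ ksurjLe k' Δ N M := comp_mem_ksurjLe σ.symm
    rw [mem_filter, mem_filter, mem_product, mem_product]
    change _ ↔ (t ∈ ksurjLe k Δ N M ∧ h ∘ σ.symm ∈ ksurjLe k' Δ N M) ∧
      ∀ e, t e ∈ S → h (σ.symm (σ e)) ∉ W
    simp only [h2, Equiv.symm_apply_apply]
  have h2 : M.factorial *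
      #{p ∈ ksurjLe k Δ N M ×ˢ ksurjLe k' Δ N M | ∀ e, p.1 e ∈ S → p.2 e ∉ W} =
      ∑ p ∈ ksurjLe k Δ N M ×ˢ ksurjLe k' Δ N M,
        #{σ : Equiv.Perm (Fin M) | ∀ e, p.1 e ∈ S → p.2 (σ e) ∉ W} := by
    rw [← sum_card_filter_comm, ← sum_congr rfl fun σ _ => h1 σ, sum_const, card_univ,
      Fintype.card_perm, Fintype.card_fin, smul_eq_mul]
  rw [mul_comm, h2, ← card_product, ← smul_eq_mul (a := #(_ ×ˢ _))]
  refine sum_le_card_nsmul _ _ _ fun p hp => ?_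
  rw [mem_product, mem_ksurjLe, mem_ksurjLe] at hp
  obtain ⟨A, hA, hAa⟩ := exists_subset_card_eq (ha.trans (mul_card_le_card_preimage hp.1.1 S))
  have hB : #{e | p.2 e ∈ Wᶜ} ≤ b := by
    rw [← sum_deg]
    exact (sum_le_card_nsmul _ _ _ fun v _ => hp.2.2 v).trans hb
  calc #{σ : Equiv.Perm (Fin M) | ∀ e, p.1 e ∈ S → p.2 (σ e) ∉ W}
      ≤ #{σ : Equiv.Perm (Fin M) | ∀ e ∈ A, σ e ∈ ({e | p.2 e ∈ Wᶜ} : Finset _)} := by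
        refine card_le_card fun σ hσ => ?_
        rw [mem_filter] at hσ ⊢
        refine ⟨mem_univ _, fun e he => ?_⟩
        rw [mem_filter, mem_compl]
        exact ⟨mem_univ _, hσ.2 e (mem_filter.1 (hA he)).2⟩
    _ ≤ #{e | p.2 e ∈ Wᶜ} ^ #A * (M - #A).factorial := card_perm_mapsTo_le _ _
    _ ≤ _ := by rw [hAa]; gcongr

/-- Cuts with a first set of bounded size at least two are rare. -/
lemma exists_small_cut {κ s : ℕ} (hκ : 1 ≤ κ) (hs : 2 ≤ s) : ∃ C : ℝ, 0 < C ∧ ∃ N0 : ℕ, 4 ≤ N0 ∧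
    ∀ N M k k', 2 * N ≤ M → κ + 1 ≤ k → N0 ≤ N →
      (#{p ∈ ksurjLe k (cutoff N) N M ×ˢ ksurjLe k' (cutoff N) N M | HasCut κ s p.1 p.2} : ℝ) ≤
        C * Real.log N ^ 6 / N *
          (#(ksurjLe k (cutoff N) N M) * #(ksurjLe k' (cutoff N) N M)) := by
  obtain ⟨a, ha⟩ : ∃ a, a = (κ + 1) * s := ⟨_, rfl⟩
  obtain ⟨r, hr⟩ : ∃ r : ℝ, r = 4 * (s + κ) := ⟨_, rfl⟩
  have hr0 : 0 < r := by rw [hr]; positivity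
  refine ⟨r ^ a * a.factorial, by positivity, max 4 a, le_max_left _ _,
    fun N M k k' hM hk hN => ?_⟩
  rw [max_le_iff] at hN
  have hN1 : 1 ≤ N := by omega
  have hNp : (0 : ℝ) < N := by exact_mod_cast hN1
  have hN1' : (1 : ℝ) ≤ N := by exact_mod_cast hN1
  have hlog := one_le_log hN.1
  obtain ⟨n, hn⟩ : ∃ n : ℝ, n = #(ksurjLe k (cutoff N) N M) * #(ksurjLe k' (cutoff N) N M) :=
    ⟨_, rfl⟩
  have hn0 : 0 ≤ n := by rw [hn]; positivity
  have hfac : (M - a).factorial * N ^ a ≤ M.factorial := by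
    calc (M - a).factorial * N ^ a ≤ (M - a).factorial * (M - a + 1) ^ a := by
          gcongr; omega
      _ ≤ (M - a + a).factorial := Nat.factorial_mul_pow_le_factorial
      _ = _ := by rw [Nat.sub_add_cancel (by omega)]
  have hfac' : ((M - a).factorial : ℝ) * N ^ a ≤ M.factorial := by exact_mod_cast hfac
  have hmain := card_hasCut_le (ksurjLe k (cutoff N) N M ×ˢ ksurjLe k' (cutoff N) N M) κ s
    (B := n * (r * Real.log N) ^ a / N ^ a) (by positivity) ?_
  · rw [← hn]
    refine hmain.trans ?_
    have hch : (N.choose s : ℝ) ≤ N ^ s := by exact_mod_cast Nat.choose_le_pow N s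
    have hpow : (N : ℝ) ^ (s + κ) * Real.log N ^ a / N ^ a ≤ a.factorial * Real.log N ^ 6 / N := by
      have hκs : κ * (s - 1) + (s + κ) = a := by
        rw [ha]; obtain ⟨s, rfl⟩ : ∃ r, s = r + 1 := ⟨s - 1, by omega⟩
        rw [Nat.add_sub_cancel]; ring
      have hfa : (1 : ℝ) ≤ a.factorial := by exact_mod_cast Nat.factorial_pos a
      have h1 : (N : ℝ) ^ (s + κ) * Real.log N ^ a / N ^ a =
          Real.log N ^ a / N ^ (κ * (s - 1)) := by
        rw [div_eq_div_iff (by positivity) (by positivity), ← hκs, pow_add]; ring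
      rw [h1]
      by_cases h2 : κ = 1 ∧ s = 2
      · have : a = 4 := by rw [ha, h2.1, h2.2]
        rw [this, h2.1, h2.2, show 1 * (2 - 1) = 1 from rfl, pow_one]
        gcongr
        calc Real.log N ^ 4 ≤ Real.log N ^ 6 := pow_le_pow_right₀ hlog (by norm_num)
          _ ≤ _ := le_mul_of_one_le_left (by positivity) (by exact_mod_cast Nat.factorial_pos 4)
      · have h3 : 2 ≤ κ * (s - 1) := by
          rcases Nat.lt_or_ge κ 2 with h | h
          · have hκ1 : κ = 1 := by omega
            rw [hκ1, one_mul]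
            by_contra h4
            exact h2 ⟨hκ1, by omega⟩
          · exact h.trans (Nat.le_mul_of_pos_right _ (by omega))
        have h4 : Real.log N ^ a ≤ a.factorial * N := by
          have h5 := Real.pow_div_factorial_le_exp (Real.log N) (by linarith) a
          rw [div_le_iff₀ (by positivity), Real.exp_log hNp] at h5
          linarith
        calc Real.log N ^ a / N ^ (κ * (s - 1)) ≤ a.factorial * N / N ^ 2 := by
              gcongr
          _ = a.factorial * 1 / N := by field_simp
          _ ≤ _ := by gcongr; exact one_le_pow₀ hlog
    calc (N.choose s : ℝ) * N ^ κ * (n * (r * Real.log N) ^ a / N ^ a)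
        ≤ N ^ s * N ^ κ * (n * (r * Real.log N) ^ a / N ^ a) := by gcongr
      _ = n * r ^ a * (N ^ (s + κ) * Real.log N ^ a / N ^ a) := by rw [pow_add, mul_pow]; ring
      _ ≤ n * r ^ a * (a.factorial * Real.log N ^ 6 / N) := by gcongr
      _ = _ := by ring
  · intro S W hd hS hSW
    have hW : #Wᶜ = s + κ := by
      have := card_add_card_compl W
      rw [Fintype.card_fin] at this
      omega
    have h1 := card_noEdge_ksurjLe_mul_le (M := M) (k := k) (k' := k') (Δ := cutoff N) (a := a)
      (b := (s + κ) * cutoff N) S W (by rw [ha, hS]; gcongr) (by rw [hW])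
    have h2 : (#{p ∈ ksurjLe k (cutoff N) N M ×ˢ ksurjLe k' (cutoff N) N M |
        ∀ e, p.1 e ∈ S → p.2 e ∉ W} : ℝ) * M.factorial ≤
        n * (((s + κ : ℕ) * cutoff N : ℝ) ^ a * (M - a).factorial) := by
      rw [hn]; exact_mod_cast h1
    rw [le_div_iff₀ (by positivity)]
    refine le_of_mul_le_mul_right (a := ((M - a).factorial : ℝ)) ?_ (by positivity)
    calc _ = (#{p ∈ ksurjLe k (cutoff N) N M ×ˢ ksurjLe k' (cutoff N) N M |
          ∀ e, p.1 e ∈ S → p.2 e ∉ W} : ℝ) * ((M - a).factorial * N ^ a) := by ring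
      _ ≤ (#{p ∈ ksurjLe k (cutoff N) N M ×ˢ ksurjLe k' (cutoff N) N M |
          ∀ e, p.1 e ∈ S → p.2 e ∉ W} : ℝ) * M.factorial := by gcongr
      _ ≤ _ := h2
      _ ≤ n * ((r * Real.log N) ^ a * (M - a).factorial) := by
        refine mul_le_mul_of_nonneg_left (mul_le_mul_of_nonneg_right
          (pow_le_pow_left₀ (by positivity) ?_ a) (by positivity)) hn0
        calc ((s + κ : ℕ) * cutoff N : ℝ) ≤ (s + κ : ℕ) * (4 * Real.log N) := by
              gcongr; exact cutoff_le hN.1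
          _ = r * Real.log N := by rw [hr]; push_cast; ring
      _ = _ := by ring

end DicoreCount

namespace DicoreCount

open Finset

variable {N M : ℕ}

/-- The edge set of the digraph with tails `t` and heads `h`. -/
def edges (t h : Fin M → Fin N) : Finset (Fin N × Fin N) := univ.image fun e => (t e, h e)

lemma mem_edges {t h : Fin M → Fin N} {x : Fin N × Fin N} :
    x ∈ edges t h ↔ ∃ e, (t e, h e) = x := by
  simp [edges]

lemma Simple.symm {t h : Fin M → Fin N} (H : Simple t h) : Simple h t :=
  ⟨fun a b hab => H.1 (by
    simp only [Prod.mk.injEq] at hab ⊢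
    exact hab.symm), fun e => (H.2 e).symm⟩

/-- The out-neighbours of a vertex of a simple digraph are distinct from it and each other. -/
lemma Simple.deg_lt {t h : Fin M → Fin N} (H : Simple t h) {R : Finset (Fin N)} {x : Fin N}
    (hx : x ∈ R) (hR : ∀ e, t e = x → h e ∈ R) : deg t x < #R := by
  have h1 : #(({e | t e = x} : Finset (Fin M)).image h) = deg t x := by
    refine card_image_of_injOn fun a ha b hb hab => H.1 ?_
    simp only [coe_filter, mem_univ, true_and, Set.mem_ofPred_eq] at ha hb
    simp only [Prod.mk.injEq]
    exact ⟨ha.trans hb.symm, hab⟩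
  rw [← h1]
  refine card_lt_card ⟨?_, fun h2 => ?_⟩
  · intro y hy
    simp only [mem_image, mem_filter, mem_univ, true_and] at hy
    obtain ⟨e, he, rfl⟩ := hy
    exact hR e he
  · have h3 := h2 hx
    simp only [mem_image, mem_filter, mem_univ, true_and] at h3
    obtain ⟨e, he, he'⟩ := h3
    exact H.2 e (he'.trans he.symm)

/-- A simple digraph with large degrees which is not strongly connected has a cut with two sides of
size at least two. -/
lemma exists_hasCut {κ : ℕ} {t h : Fin M → Fin N} (H : Simple t h) (ht : ∀ v, κ + 1 ≤ deg t v)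
    (hh : ∀ v, κ + 1 ≤ deg h v) (hN : κ + 1 < N) (hE : ¬ KStronglyConnected (κ + 1) (edges t h)) :
    ∃ s, 2 ≤ s ∧ 2 * s ≤ N ∧ (HasCut κ s t h ∨ HasCut κ s h t) := by
  classical
  simp only [KStronglyConnected, hN, true_and, not_forall] at hE
  obtain ⟨T, hT, u, v, hu, hv, huv⟩ := hE
  obtain ⟨r, hr⟩ : ∃ r : Fin N → Fin N → Prop,
    r = fun a b => a ∉ T ∧ b ∉ T ∧ (a, b) ∈ edges t h := ⟨_, rfl⟩
  rw [← hr] at huv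
  let S : Finset (Fin N) := {x | x ∉ T ∧ Relation.ReflTransGen r u x}
  let W : Finset (Fin N) := {x | x ∉ T ∧ ¬ Relation.ReflTransGen r u x}
  have hS : ∀ x, x ∈ S ↔ x ∉ T ∧ Relation.ReflTransGen r u x := fun x => by simp [S]
  have hW : ∀ x, x ∈ W ↔ x ∉ T ∧ ¬ Relation.ReflTransGen r u x := fun x => by simp [W]
  have hno : ∀ e, t e ∈ S → h e ∉ W := by
    intro e h1 h2
    rw [hS] at h1
    rw [hW] at h2
    refine h2.2 (h1.2.tail ?_)
    rw [hr]
    exact ⟨h1.1, h2.1, mem_edges.2 ⟨e, rfl⟩⟩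
  have hTS : Disjoint T S := disjoint_left.2 fun x h1 h2 => ((hS x).1 h2).1 h1
  have hTW : Disjoint T W := disjoint_left.2 fun x h1 h2 => ((hW x).1 h2).1 h1
  have hSW : Disjoint S W := disjoint_left.2 fun x h1 h2 => ((hW x).1 h2).2 ((hS x).1 h1).2
  have hcard : #T + #S + #W = N := by
    have h1 : (T ∪ S) ∪ W = univ := by
      ext x
      simp only [mem_union, hS, hW, mem_univ, iff_true]
      tauto
    have h2 : Disjoint (T ∪ S) W := disjoint_union_left.2 ⟨hTW, hSW⟩
    rw [← card_union_of_disjoint hTS, ← card_union_of_disjoint h2, h1, card_univ, Fintype.card_fin]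
  have hScard : κ + 1 < #T + #S := by
    rw [← card_union_of_disjoint hTS]
    refine (ht u).trans_lt (H.deg_lt ?_ fun e he => ?_)
    · exact mem_union_right _ ((hS u).2 ⟨hu, .refl⟩)
    · have h1 := hno e (he ▸ (hS u).2 ⟨hu, .refl⟩)
      rw [hW] at h1
      rw [mem_union, hS]
      tauto
  have hWcard : κ + 1 < #T + #W := by
    rw [← card_union_of_disjoint hTW]
    have hvW : v ∈ W := (hW v).2 ⟨hv, huv⟩
    refine (hh v).trans_lt (H.symm.deg_lt (mem_union_right _ hvW) fun e he => ?_)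
    have h1 : t e ∉ S := fun h2 => hno e h2 (he ▸ hvW)
    rw [hS] at h1
    rw [mem_union, hW]
    tauto
  obtain ⟨W', hW'W, hW'⟩ := exists_subset_card_eq (show N - κ - #S ≤ #W by omega)
  have hd := hSW.mono_right hW'W
  rcases Nat.lt_or_ge N (2 * #S) with h1 | h1
  · exact ⟨#W', by omega, by omega, Or.inr ⟨W', S, hd.symm, rfl, by omega,
      fun e h2 h3 => hno e h3 (hW'W h2)⟩⟩
  · exact ⟨#S, by omega, h1, Or.inl ⟨S, W', hd, rfl, by omega, fun e h2 h3 => hno e h2 (hW'W h3)⟩⟩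

noncomputable instance (k : ℕ) (E : Finset (Fin N × Fin N)) : Decidable (KStronglyConnected k E) :=
  Classical.propDecidable _

/-- Pairs of tail and head maps of `k`-strongly connected simple digraphs. -/
noncomputable def strongPairs (k : ℕ) (K K' : Finset (Fin M → Fin N)) :
    Finset ((Fin M → Fin N) × (Fin M → Fin N)) :=
  {p ∈ simplePairs K K' | KStronglyConnected k (edges p.1 p.2)}

lemma card_filter_edges {t h : Fin M → Fin N} (H : Simple t h) (P : Fin N × Fin N → Prop)
    [DecidablePred P] : #{x ∈ edges t h | P x} = #{e | P (t e, h e)} := by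
  rw [edges, filter_image, card_image_of_injective _ H.1]

lemma card_labellings {E : Finset (Fin N × Fin N)} (hE : #E = M) (hl : ∀ x ∈ E, x.1 ≠ x.2) :
    #{p : (Fin M → Fin N) × (Fin M → Fin N) | Simple p.1 p.2 ∧ edges p.1 p.2 = E} =
      M.factorial := by
  classical
  have hc : #(univ : Finset (Fin M ≃ E)) = M.factorial := by
    rw [card_univ, Fintype.card_equiv (Fintype.equivOfCardEq (by simp [hE])), Fintype.card_fin]
  rw [← hc]
  symm
  refine card_bij (fun φ _ => (fun e => (φ e).1.1, fun e => (φ e).1.2)) ?_ ?_ ?_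
  · intro φ _
    rw [mem_filter]
    refine ⟨mem_univ _, ⟨fun a b hab => φ.injective (Subtype.ext hab), fun e =>
      (hl _ (φ e).2).symm⟩, ?_⟩
    ext x
    rw [mem_edges]
    constructor
    · rintro ⟨e, rfl⟩
      exact (φ e).2
    · intro hx
      exact ⟨φ.symm ⟨x, hx⟩, by simp⟩
  · intro φ _ ψ _ h
    rw [Prod.mk.injEq] at h
    refine Equiv.ext fun e => Subtype.ext (Prod.ext (congrFun h.1 e) (congrFun h.2 e))
  · intro p hp
    rw [mem_filter] at hp
    obtain ⟨-, hs, hpE⟩ := hp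
    have hm : ∀ e, (p.1 e, p.2 e) ∈ E := fun e => hpE ▸ mem_edges.2 ⟨e, rfl⟩
    refine ⟨Equiv.ofBijective (fun e => (⟨(p.1 e, p.2 e), hm e⟩ : E)) ⟨fun a b hab => ?_, ?_⟩,
      mem_univ _, rfl⟩
    · exact hs.1 (congrArg Subtype.val hab)
    · rintro ⟨x, hx⟩
      rw [← hpE, mem_edges] at hx
      obtain ⟨e, he⟩ := hx
      exact ⟨e, Subtype.ext he⟩

/-- Each dicore arises from exactly `M!` pairs of tail and head maps. -/
lemma card_dicores_mul (k1 k2 k : ℕ) :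
    Nat.card {E : Finset (Fin N × Fin N) // IsDicore k1 k2 N M E ∧ KStronglyConnected k E} *
      M.factorial =
      #(strongPairs k (ksurj k2 (Fin M) (Fin N)) (ksurj k1 (Fin M) (Fin N))) := by
  classical
  rw [Nat.card_eq_fintype_card, Fintype.card_subtype]
  let D : Finset (Finset (Fin N × Fin N)) := {E | IsDicore k1 k2 N M E ∧ KStronglyConnected k E}
  have hmem : ∀ p : (Fin M → Fin N) × (Fin M → Fin N),
      p ∈ strongPairs k (ksurj k2 (Fin M) (Fin N)) (ksurj k1 (Fin M) (Fin N)) ↔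
        Simple p.1 p.2 ∧ edges p.1 p.2 ∈ D := by
    intro p
    simp only [strongPairs, simplePairs, mem_filter, mem_product, mem_ksurj, D, mem_univ, true_and]
    have key : ∀ H : Simple p.1 p.2, (((∀ v, k2 ≤ deg p.1 v) ∧ ∀ v, k1 ≤ deg p.2 v) ↔
        IsDicore k1 k2 N M (edges p.1 p.2)) := by
      intro H
      have h1 : #(edges p.1 p.2) = M := by
        rw [edges, card_image_of_injective _ H.1, card_univ, Fintype.card_fin]
      have h2 : ∀ x ∈ edges p.1 p.2, x.1 ≠ x.2 := by
        intro x hx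
        obtain ⟨e, rfl⟩ := mem_edges.1 hx
        exact (H.2 e).symm
      unfold IsDicore
      simp only [h1, true_and, card_filter_edges H]
      exact ⟨fun h => ⟨h2, fun v => ⟨h.2 v, h.1 v⟩⟩,
        fun h => ⟨fun v => (h.2 v).2, fun v => (h.2 v).1⟩⟩
    constructor
    · rintro ⟨⟨h1, H⟩, h2⟩
      exact ⟨H, (key H).1 h1, h2⟩
    · rintro ⟨H, h1, h2⟩
      exact ⟨⟨(key H).2 h1, H⟩, h2⟩
  rw [card_eq_sum_card_fiberwise (f := fun p => edges p.1 p.2) (t := D)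
    fun p hp => ((hmem p).1 hp).2]
  symm
  rw [← smul_eq_mul, ← sum_const]
  refine sum_congr rfl fun E hE => ?_
  have hE' := hE
  simp only [mem_filter, mem_univ, true_and] at hE'
  rw [← card_labellings hE'.1.1 hE'.1.2.1]
  congr 1
  ext p
  rw [mem_filter, mem_filter, hmem]
  constructor
  · rintro ⟨⟨h1, -⟩, h2⟩
    exact ⟨mem_univ _, h1, h2⟩
  · rintro ⟨-, h1, h2⟩
    exact ⟨⟨h1, h2.symm ▸ hE⟩, h2⟩

end DicoreCount

namespace DicoreCount

open Finset

variable {k k' κ : ℕ} {zlo zhi : ℝ}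

/-- Cuts with both sides of size at least two are rare. -/
lemma exists_cut (hκ : 1 ≤ κ) (hk : κ + 1 ≤ k) (hk' : κ + 1 ≤ k') (hlo : 0 < zlo)
    (hhi : zlo ≤ zhi) : ∃ C : ℝ, 0 < C ∧ ∃ N0 : ℕ, 4 ≤ N0 ∧ ∀ z z' N M, Tuned k zlo zhi z N M →
      Tuned k' zlo zhi z' N M → N0 ≤ N →
      (#{p ∈ ksurjLe k (cutoff N) N M ×ˢ ksurjLe k' (cutoff N) N M |
          ∃ s ∈ Icc 2 (N / 2), HasCut κ s p.1 p.2} : ℝ) ≤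
        C * Real.log N ^ 6 / N * (#(ksurj k (Fin M) (Fin N)) * #(ksurj k' (Fin M) (Fin N))) := by
  classical
  obtain ⟨s0, C, hC, N0, hN0, hL⟩ :=
    exists_large_cut κ (show 2 ≤ k by omega) (show 2 ≤ k' by omega) hlo hhi
  have hsm : ∀ s, 2 ≤ s → _ := fun s hs => exists_small_cut hκ hs
  choose! D hD N1 hN1 hS using hsm
  refine ⟨C + ∑ s ∈ Ico 2 s0, D s, ?_, max 4 (max N0 ((Ico 2 s0).sup N1)), le_max_left _ _,
    fun z z' N M hz hz' hN => ?_⟩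
  · have : 0 ≤ ∑ s ∈ Ico 2 s0, D s := sum_nonneg fun s hs => (hD s (mem_Ico.1 hs).1).le
    linarith
  rw [max_le_iff, max_le_iff] at hN
  obtain ⟨hN4, hNN0, hNN1⟩ := hN
  have hlog := one_le_log hN4
  obtain ⟨K, hK⟩ : ∃ K, K = ksurj k (Fin M) (Fin N) := ⟨_, rfl⟩
  obtain ⟨K', hK'⟩ : ∃ K, K = ksurj k' (Fin M) (Fin N) := ⟨_, rfl⟩
  obtain ⟨L, hLe⟩ : ∃ L, L = ksurjLe k (cutoff N) N M := ⟨_, rfl⟩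
  obtain ⟨L', hLe'⟩ : ∃ L, L = ksurjLe k' (cutoff N) N M := ⟨_, rfl⟩
  have hLK : L ⊆ K := by rw [hLe, hK]; exact ksurjLe_subset _ _ _ _
  have hLK' : L' ⊆ K' := by rw [hLe', hK']; exact ksurjLe_subset _ _ _ _
  obtain ⟨n, hn⟩ : ∃ n : ℝ, n = #K * #K' := ⟨_, rfl⟩
  have hn0 : 0 ≤ n := by rw [hn]; positivity
  have hll : (#L * #L' : ℝ) ≤ n := by
    rw [hn]; exact_mod_cast Nat.mul_le_mul (card_le_card hLK) (card_le_card hLK')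
  have h1 := hL z z' N M hz hz' hNN0
  have h2 : ∀ s ∈ Ico 2 s0, (#{p ∈ L ×ˢ L' | HasCut κ s p.1 p.2} : ℝ) ≤
      D s * Real.log N ^ 6 / N * n := by
    intro s hs
    have hs2 := (mem_Ico.1 hs).1
    have h3 := hS s hs2 N M k k' hz.le hk ((le_sup hs).trans hNN1)
    rw [← hLe, ← hLe'] at h3
    have := hD s hs2
    exact h3.trans (by gcongr)
  rw [← hK, ← hK', ← hn] at h1
  rw [← hLe, ← hLe', ← hK, ← hK', ← hn]
  have hsub : ({p ∈ L ×ˢ L' | ∃ s ∈ Icc 2 (N / 2), HasCut κ s p.1 p.2} : Finset _) ⊆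
      ({p ∈ K ×ˢ K' | ∃ s ∈ Icc s0 (N / 2), HasCut κ s p.1 p.2} : Finset _) ∪
      (Ico 2 s0).biUnion fun s => {p ∈ L ×ˢ L' | HasCut κ s p.1 p.2} := by
    intro p hp
    rw [mem_filter] at hp
    obtain ⟨hpL, s, hs, hc⟩ := hp
    rw [mem_Icc] at hs
    rw [mem_union]
    rcases Nat.lt_or_ge s s0 with h | h
    · exact Or.inr (mem_biUnion.2 ⟨s, mem_Ico.2 ⟨hs.1, h⟩, mem_filter.2 ⟨hpL, hc⟩⟩)
    · exact Or.inl (mem_filter.2 ⟨product_subset_product hLK hLK' hpL, s, mem_Icc.2 ⟨h, hs.2⟩, hc⟩)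
  have h3 := (card_le_card hsub).trans ((card_union_le _ _).trans
    (Nat.add_le_add_left card_biUnion_le _))
  have hl6 : (1 : ℝ) ≤ Real.log N ^ 6 := one_le_pow₀ hlog
  calc (#{p ∈ L ×ˢ L' | ∃ s ∈ Icc 2 (N / 2), HasCut κ s p.1 p.2} : ℝ)
      ≤ (#{p ∈ K ×ˢ K' | ∃ s ∈ Icc s0 (N / 2), HasCut κ s p.1 p.2} : ℝ) +
        ∑ s ∈ Ico 2 s0, (#{p ∈ L ×ˢ L' | HasCut κ s p.1 p.2} : ℝ) := by exact_mod_cast h3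
    _ ≤ C * 1 / N * n + ∑ s ∈ Ico 2 s0, D s * Real.log N ^ 6 / N * n := by
        rw [mul_one]; exact add_le_add h1 (sum_le_sum h2)
    _ ≤ C * Real.log N ^ 6 / N * n + ∑ s ∈ Ico 2 s0, D s * Real.log N ^ 6 / N * n := by gcongr
    _ = _ := by rw [← sum_mul, ← sum_div, ← sum_mul]; ring

/-- The number of pairs giving a strongly connected simple digraph. -/
lemma exists_strong (hκ : 1 ≤ κ) (hk : κ + 1 ≤ k) (hk' : κ + 1 ≤ k') (hlo : 0 < zlo)
    (hhi : zlo ≤ zhi) : ∃ C : ℝ, 0 < C ∧ ∃ N0 : ℕ, 4 ≤ N0 ∧ ∀ z z' N M, Tuned k zlo zhi z N M →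
      Tuned k' zlo zhi z' N M → N0 ≤ N →
      |(#(strongPairs (κ + 1) (ksurj k (Fin M) (Fin N)) (ksurj k' (Fin M) (Fin N))) : ℝ) -
        Real.exp (-((M : ℝ) / N) - 1 / 2 * ePoi k' z' * ePoi k z) *
          (#(ksurj k (Fin M) (Fin N)) * #(ksurj k' (Fin M) (Fin N)))| ≤
        C * Real.log N ^ 6 / N * (#(ksurj k (Fin M) (Fin N)) * #(ksurj k' (Fin M) (Fin N))) := by
  classical
  obtain ⟨C1, hC1, N1, hN1, h1⟩ := exists_cut hκ hk hk' hlo hhi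
  obtain ⟨C2, hC2, N2, hN2, h2⟩ := exists_cut hκ hk' hk hlo hhi
  obtain ⟨C3, hC3, N3, hN3, h3⟩ :=
    exists_simple (show 2 ≤ k by omega) (show 2 ≤ k' by omega) hlo hhi
  refine ⟨C1 + C2 + 2 * C3, by positivity, max (κ + 2) (max N1 (max N2 N3)), by omega,
    fun z z' N M hz hz' hN => ?_⟩
  simp only [max_le_iff] at hN
  obtain ⟨hNκ, hNN1, hNN2, hNN3⟩ := hN
  replace h1 := h1 z z' N M hz hz' hNN1
  replace h2 := h2 z' z N M hz' hz hNN2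
  replace h3 := h3 z z' N M hz hz' hNN3
  obtain ⟨K, hK⟩ : ∃ K, K = ksurj k (Fin M) (Fin N) := ⟨_, rfl⟩
  obtain ⟨K', hK'⟩ : ∃ K, K = ksurj k' (Fin M) (Fin N) := ⟨_, rfl⟩
  obtain ⟨L, hLe⟩ : ∃ L, L = ksurjLe k (cutoff N) N M := ⟨_, rfl⟩
  obtain ⟨L', hLe'⟩ : ∃ L, L = ksurjLe k' (cutoff N) N M := ⟨_, rfl⟩
  have hLK : L ⊆ K := by rw [hLe, hK]; exact ksurjLe_subset _ _ _ _
  have hLK' : L' ⊆ K' := by rw [hLe', hK']; exact ksurjLe_subset _ _ _ _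
  have hLdeg : ∀ t ∈ L, ∀ v, κ + 1 ≤ deg t v := fun t ht v => by
    rw [hLe, mem_ksurjLe] at ht; exact hk.trans (ht.1 v)
  have hLdeg' : ∀ t ∈ L', ∀ v, κ + 1 ≤ deg t v := fun t ht v => by
    rw [hLe', mem_ksurjLe] at ht; exact hk'.trans (ht.1 v)
  rw [← hLe, ← hLe', ← hK, ← hK'] at h1 h2 h3
  rw [← hK, ← hK']
  clear hLe hLe' hK hK'
  have hswap : #{p ∈ L' ×ˢ L | ∃ s ∈ Icc 2 (N / 2), HasCut κ s p.1 p.2} =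
      #{p ∈ L ×ˢ L' | ∃ s ∈ Icc 2 (N / 2), HasCut κ s p.2 p.1} := by
    refine card_equiv (Equiv.prodComm _ _) fun p => ?_
    simp only [mem_filter, mem_product, Equiv.prodComm_apply, Prod.fst_swap, Prod.snd_swap]
    tauto
  have hlow : simplePairs L L' ⊆ strongPairs (κ + 1) K K' ∪
      (({p ∈ L ×ˢ L' | ∃ s ∈ Icc 2 (N / 2), HasCut κ s p.1 p.2} : Finset _) ∪
      ({p ∈ L ×ˢ L' | ∃ s ∈ Icc 2 (N / 2), HasCut κ s p.2 p.1} : Finset _)) := by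
    intro p hp
    rw [simplePairs, mem_filter] at hp
    obtain ⟨hpL, H⟩ := hp
    have hpL' := mem_product.1 hpL
    by_cases hs : KStronglyConnected (κ + 1) (edges p.1 p.2)
    · exact mem_union_left _ (mem_filter.2 ⟨mem_filter.2 ⟨product_subset_product hLK hLK' hpL, H⟩, hs⟩)
    · obtain ⟨s, hs2, hsN, hc⟩ := exists_hasCut H (hLdeg _ hpL'.1) (hLdeg' _ hpL'.2) (by omega) hs
      have hsI : s ∈ Icc 2 (N / 2) := mem_Icc.2 ⟨hs2, by omega⟩
      refine mem_union_right _ (mem_union.2 (hc.imp (fun hc => ?_) fun hc => ?_))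
      · exact mem_filter.2 ⟨hpL, s, hsI, hc⟩
      · exact mem_filter.2 ⟨hpL, s, hsI, hc⟩
  have hlow' := (card_le_card hlow).trans ((card_union_le _ _).trans
    (Nat.add_le_add_left (card_union_le _ _) _))
  rw [← hswap] at hlow'
  have hup : strongPairs (κ + 1) K K' ⊆ simplePairs L L' ∪ ((K ×ˢ K') \ (L ×ˢ L')) := by
    intro p hp
    rw [strongPairs, mem_filter, simplePairs, mem_filter] at hp
    rw [mem_union, mem_sdiff]
    by_cases hpL : p ∈ L ×ˢ L'
    · exact Or.inl (mem_filter.2 ⟨hpL, hp.1.2⟩)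
    · exact Or.inr ⟨hp.1.1, hpL⟩
  have hup' := (card_le_card hup).trans (card_union_le _ _)
  have hd : (#((K ×ˢ K') \ (L ×ˢ L')) : ℝ) = #K * #K' - #L * #L' := by
    have h4 := card_sdiff_add_card_eq_card (product_subset_product hLK hLK')
    rw [card_product, card_product] at h4
    rw [eq_sub_iff_add_eq]
    exact_mod_cast h4
  have hlowR : (#(simplePairs L L') : ℝ) ≤ #(strongPairs (κ + 1) K K') +
      ((#{p ∈ L ×ˢ L' | ∃ s ∈ Icc 2 (N / 2), HasCut κ s p.1 p.2} : ℝ) +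
      (#{p ∈ L' ×ˢ L | ∃ s ∈ Icc 2 (N / 2), HasCut κ s p.1 p.2} : ℝ)) := by exact_mod_cast hlow'
  have hupR : (#(strongPairs (κ + 1) K K') : ℝ) ≤ #(simplePairs L L') +
      (#((K ×ˢ K') \ (L ×ˢ L')) : ℝ) := by exact_mod_cast hup'
  rw [hd] at hupR
  have h5 := abs_le.1 h3.1
  have h6 : (#K' * #K : ℝ) = #K * #K' := mul_comm _ _
  rw [h6] at h2
  have hN0 : (0 : ℝ) < N := by exact_mod_cast (by omega : 0 < N)
  have hnn : 0 ≤ Real.log N ^ 6 / N * (#K * #K' : ℝ) := by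
    have := one_le_log (show 4 ≤ N by omega)
    exact mul_nonneg (by positivity) (mul_nonneg (Nat.cast_nonneg _) (Nat.cast_nonneg _))
  have e : ∀ c : ℝ, c * Real.log N ^ 6 / N * (#K * #K' : ℝ) =
    c * (Real.log N ^ 6 / N * (#K * #K' : ℝ)) := fun c => by ring
  rw [e] at h1 h2 h3 h5
  rw [e]
  have p1 := mul_nonneg hC1.le hnn
  have p2 := mul_nonneg hC2.le hnn
  have p3 := mul_nonneg hC3.le hnn
  rw [abs_le]
  constructor <;> linarith [h3.2, h5.1, h5.2]

end DicoreCount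

namespace DicoreCount

open Finset

lemma ePoi_pos (k : ℕ) {z : ℝ} (hz : 0 < z) : 0 < ePoi k z :=
  div_pos (mul_pos hz (fk_pos _ hz)) (fk_pos _ hz)

lemma ePoi_le {k : ℕ} (hk : 2 ≤ k) {z : ℝ} (hz : 0 < z) : ePoi k z ≤ z + k := by
  have h : ePoi k z = mPoi (k - 1) z := by rw [ePoi, mPoi, Nat.sub_sub]
  have h1 := mPoi_sub_le (show 1 ≤ k - 1 by omega) hz
  rw [Nat.cast_sub (by omega), Nat.cast_one] at h1
  linarith

/-- Moving from an estimate valid for large `N` to one valid for `2 ≤ N`. -/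
lemma le_log_pow_div {N N0 : ℕ} (hN : 2 ≤ N) (hN0 : N < N0) :
    1 ≤ N0 / Real.log 2 ^ 6 * Real.log N ^ 6 / N := by
  have h2 : 0 < Real.log 2 := Real.log_pos (by norm_num)
  have hNp : (0 : ℝ) < N := by exact_mod_cast (by omega : 0 < N)
  have h3 : Real.log 2 ≤ Real.log N := Real.log_le_log (by norm_num) (by exact_mod_cast hN)
  have h4 : (N : ℝ) ≤ N0 := by exact_mod_cast hN0.le
  rw [le_div_iff₀ hNp, one_mul]
  calc (N : ℝ) = N / Real.log 2 ^ 6 * Real.log 2 ^ 6 := by field_simp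
    _ ≤ _ := by gcongr

lemma inv_le_log_pow_div {N : ℕ} (hN : 2 ≤ N) :
    1 / (N : ℝ) ≤ 1 / Real.log 2 ^ 6 * Real.log N ^ 6 / N := by
  have h2 : 0 < Real.log 2 := Real.log_pos (by norm_num)
  have hNp : (0 : ℝ) < N := by exact_mod_cast (by omega : 0 < N)
  have h3 : Real.log 2 ≤ Real.log N := Real.log_le_log (by norm_num) (by exact_mod_cast hN)
  gcongr
  calc (1 : ℝ) = 1 / Real.log 2 ^ 6 * Real.log 2 ^ 6 := by field_simp
    _ ≤ _ := by gcongr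

section

variable {k k' κ : ℕ} {zlo zhi : ℝ}

lemma exists_strong_of_two_le (hκ : 1 ≤ κ) (hk : κ + 1 ≤ k) (hk' : κ + 1 ≤ k') (hlo : 0 < zlo)
    (hhi : zlo ≤ zhi) : ∃ C : ℝ, 0 < C ∧ ∀ z z' N M, Tuned k zlo zhi z N M →
      Tuned k' zlo zhi z' N M → 2 ≤ N →
      |(#(strongPairs (κ + 1) (ksurj k (Fin M) (Fin N)) (ksurj k' (Fin M) (Fin N))) : ℝ) -
        Real.exp (-((M : ℝ) / N) - 1 / 2 * ePoi k' z' * ePoi k z) *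
          (#(ksurj k (Fin M) (Fin N)) * #(ksurj k' (Fin M) (Fin N)))| ≤
        C * Real.log N ^ 6 / N * (#(ksurj k (Fin M) (Fin N)) * #(ksurj k' (Fin M) (Fin N))) := by
  obtain ⟨C, hC, N0, hN0, h⟩ := exists_strong hκ hk hk' hlo hhi
  have hl2 : 0 < Real.log 2 := Real.log_pos (by norm_num)
  refine ⟨C + N0 / Real.log 2 ^ 6, by positivity, fun z z' N M hz hz' hN => ?_⟩
  obtain ⟨K, hK⟩ : ∃ K, K = ksurj k (Fin M) (Fin N) := ⟨_, rfl⟩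
  obtain ⟨K', hK'⟩ : ∃ K, K = ksurj k' (Fin M) (Fin N) := ⟨_, rfl⟩
  have hlN : 0 ≤ Real.log N := Real.log_natCast_nonneg N
  have hn0 : (0 : ℝ) ≤ #K * #K' := mul_nonneg (Nat.cast_nonneg _) (Nat.cast_nonneg _)
  rcases Nat.lt_or_ge N N0 with hNN | hNN
  · have h1 := le_log_pow_div hN hNN
    have h2 : (#(strongPairs (κ + 1) K K') : ℝ) ≤ #K * #K' := by
      exact_mod_cast (card_filter_le _ _).trans ((card_filter_le _ _).trans (card_product K K').le)
    have h3 : (0 : ℝ) ≤ #(strongPairs (κ + 1) K K') := Nat.cast_nonneg _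
    have he : Real.exp (-((M : ℝ) / N) - 1 / 2 * ePoi k' z' * ePoi k z) ≤ 1 := by
      refine Real.exp_le_one_iff.2 ?_
      have h4 := ePoi_pos k (hlo.trans_le hz.lo)
      have h5 := ePoi_pos k' (hlo.trans_le hz'.lo)
      have h6 : (0 : ℝ) ≤ M / N := by positivity
      have h7 : 0 ≤ 1 / 2 * ePoi k' z' * ePoi k z := by positivity
      linarith
    rw [← hK, ← hK']
    have h8 := mul_le_mul_of_nonneg_right he hn0
    have h9 := mul_nonneg (Real.exp_pos (-((M : ℝ) / N) - 1 / 2 * ePoi k' z' * ePoi k z)).le hn0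
    calc |(#(strongPairs (κ + 1) K K') : ℝ) - _| ≤ 1 * (#K * #K') := by
          rw [abs_le]; constructor <;> linarith
      _ ≤ _ := by
          refine mul_le_mul_of_nonneg_right (h1.trans ?_) hn0
          gcongr
          linarith
  · refine (h z z' N M hz hz' hNN).trans ?_
    rw [← hK, ← hK']
    refine mul_le_mul_of_nonneg_right ?_ hn0
    gcongr
    have : 0 ≤ N0 / Real.log 2 ^ 6 := by positivity
    linarith

lemma exists_normalised_hitProb (hk : 2 ≤ k) (hlo : 0 < zlo) (hhi : zlo ≤ zhi) :
    ∃ C : ℝ, 0 < C ∧ ∀ z N M, Tuned k zlo zhi z N M → 2 ≤ N →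
      |hitProb k z N M * Real.sqrt (2 * Real.pi * N * vPoi k z) - 1| ≤ C / N := by
  obtain ⟨C, hC, h⟩ := exists_local_limit hk hlo hhi
  refine ⟨C, hC, fun z N M hz hN => (h z hz.lo hz.hi N hN M).trans (le_of_eq ?_)⟩
  rw [← hz.mean, mul_comm (mPoi k z), sub_self]
  ring

end

lemma abs_mul_sub_one_le {x y C D u : ℝ} (hx : |x - 1| ≤ C * u) (hy : |y - 1| ≤ D * u) (hu : u ≤ 1)
    (hC : 0 ≤ C) (hu0 : 0 ≤ u) : |x * y - 1| ≤ (C * D + C + D) * u := by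
  have hD : 0 ≤ D * u := (abs_nonneg _).trans hy
  calc |x * y - 1| = |(x - 1) * (y - 1) + (x - 1) + (y - 1)| := by congr 1; ring
    _ ≤ |x - 1| * |y - 1| + |x - 1| + |y - 1| := by
      rw [← abs_mul]; exact (abs_add_le _ _).trans (by gcongr; exact abs_add_le _ _)
    _ ≤ C * u * (D * u) + C * u + D * u := by gcongr
    _ ≤ C * 1 * (D * u) + C * u + D * u := by gcongr
    _ = _ := by ring

end DicoreCount

set_option maxHeartbeats 1000000 in
theorem asymptotics_of_k_strongly_connected_dicore_count
    (k1 k2 : ℕ) (hk1 : 2 ≤ k1) (hk2 : 2 ≤ k2) (ε C1 : ℝ) (hε : 0 < ε)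
    (hC1 : ((max k1 k2 : ℕ) : ℝ) + ε < C1) :
    ∃ C : ℝ, 0 < C ∧ ∀ N M : ℕ, 2 ≤ N → 0 < M →
      (((max k1 k2 : ℕ) : ℝ) + ε) * N ≤ M → (M : ℝ) ≤ C1 * N →
      ∀ z1 z2 : ℝ, 0 < z1 → 0 < z2 →
        mPoi k1 z1 = (M : ℝ) / N → mPoi k2 z2 = (M : ℝ) / N →
        |(Nat.card {E : Finset (Fin N × Fin N) //
              IsDicore k1 k2 N M E ∧ KStronglyConnected (min k1 k2) E} : ℝ) /
            (Real.exp (-(M : ℝ) / N - (1 / 2) * ePoi k1 z1 * ePoi k2 z2) *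
              (M.factorial : ℝ) *
              (fk k1 z1 ^ N / (z1 ^ M * Real.sqrt (2 * Real.pi * N * vPoi k1 z1))) *
              (fk k2 z2 ^ N / (z2 ^ M * Real.sqrt (2 * Real.pi * N * vPoi k2 z2)))) - 1| ≤
          C * (Real.log N) ^ 6 / N := by
  have hmax0 : (0 : ℝ) ≤ ((max k1 k2 : ℕ) : ℝ) := Nat.cast_nonneg _
  have hlohi : ε ≤ C1 := by linarith
  obtain ⟨κ, hκ⟩ : ∃ κ, κ + 1 = min k1 k2 := ⟨min k1 k2 - 1, by omega⟩
  have hκ1 : 1 ≤ κ := by omega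
  obtain ⟨A, hA, hstrong⟩ := DicoreCount.exists_strong_of_two_le hκ1
    (show κ + 1 ≤ k2 by omega) (show κ + 1 ≤ k1 by omega) hε hlohi
  obtain ⟨B1, hB1, hloc1⟩ := DicoreCount.exists_normalised_hitProb hk1 hε hlohi
  obtain ⟨B2, hB2, hloc2⟩ := DicoreCount.exists_normalised_hitProb hk2 hε hlohi
  obtain ⟨B, hB⟩ : ∃ B : ℝ, B = B1 * B2 + B1 + B2 := ⟨_, rfl⟩
  have hB0 : 0 < B := by rw [hB]; positivity
  obtain ⟨G, hG⟩ : ∃ G : ℝ, G = Real.exp (C1 + 1 / 2 * (C1 + k1) * (C1 + k2)) := ⟨_, rfl⟩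
  have hG0 : 0 < G := by rw [hG]; positivity
  have hl2 : 0 < Real.log 2 := Real.log_pos (by norm_num)
  refine ⟨G * A * (1 + B) + B * (1 / Real.log 2 ^ 6), by positivity, ?_⟩
  intro N M hN hM hlow hupp z1 z2 hz1 hz2 hm1 hm2
  have hNp : (0 : ℝ) < N := by exact_mod_cast (by omega : 0 < N)
  have hlN : 0 ≤ Real.log N := Real.log_natCast_nonneg N
  have hc1 : (M : ℝ) / N ≤ C1 := by rwa [div_le_iff₀ hNp]
  have hc0 : ((max k1 k2 : ℕ) : ℝ) + ε ≤ M / N := by rwa [le_div_iff₀ hNp]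
  have hk1m : (k1 : ℝ) ≤ ((max k1 k2 : ℕ) : ℝ) := by exact_mod_cast le_max_left k1 k2
  have hk2m : (k2 : ℝ) ≤ ((max k1 k2 : ℕ) : ℝ) := by exact_mod_cast le_max_right k1 k2
  have hMN : 2 * N ≤ M := by
    have h2 : (2 : ℝ) ≤ k1 := by exact_mod_cast hk1
    have h3 : (2 : ℝ) * N ≤ M := by
      rw [← le_div_iff₀ hNp]; linarith
    exact_mod_cast h3
  have hT1 : DicoreCount.Tuned k1 ε C1 z1 N M :=
    ⟨by linarith [DicoreCount.mPoi_sub_le (show 1 ≤ k1 by omega) hz1],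
      by linarith [DicoreCount.le_mPoi (k := k1) hz1], by rw [hm1]; field_simp, hMN⟩
  have hT2 : DicoreCount.Tuned k2 ε C1 z2 N M :=
    ⟨by linarith [DicoreCount.mPoi_sub_le (show 1 ≤ k2 by omega) hz2],
      by linarith [DicoreCount.le_mPoi (k := k2) hz2], by rw [hm2]; field_simp, hMN⟩
  have hP := hstrong z2 z1 N M hT2 hT1 hN
  have hx1 := hloc1 z1 N M hT1 hN
  have hx2 := hloc2 z2 N M hT2 hN
  have hcount := DicoreCount.card_dicores_mul (N := N) (M := M) k1 k2 (κ + 1)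
  rw [hκ] at hcount hP
  rw [DicoreCount.card_ksurj_fin hz2, DicoreCount.card_ksurj_fin hz1] at hP
  have hcountR : (Nat.card {E : Finset (Fin N × Fin N) //
      IsDicore k1 k2 N M E ∧ KStronglyConnected (min k1 k2) E} : ℝ) * M.factorial =
      ((DicoreCount.strongPairs (min k1 k2) (DicoreCount.ksurj k2 (Fin M) (Fin N))
        (DicoreCount.ksurj k1 (Fin M) (Fin N))).card : ℝ) := by exact_mod_cast hcount
  rw [← hcountR] at hP
  clear hcountR hcount
  rw [neg_div]
  obtain ⟨X, hX⟩ : ∃ X : ℝ, X = (Nat.card {E : Finset (Fin N × Fin N) //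
      IsDicore k1 k2 N M E ∧ KStronglyConnected (min k1 k2) E} : ℝ) := ⟨_, rfl⟩
  rw [← hX] at hP ⊢
  obtain ⟨e, he⟩ : ∃ e : ℝ, e = Real.exp (-((M : ℝ) / N) - 1 / 2 * ePoi k1 z1 * ePoi k2 z2) :=
    ⟨_, rfl⟩
  have he0 : 0 < e := by rw [he]; positivity
  have heG : 1 ≤ G * e := by
    rw [hG, he, ← Real.exp_add]
    refine Real.one_le_exp ?_
    have h1 : ePoi k1 z1 ≤ C1 + k1 := (DicoreCount.ePoi_le hk1 hz1).trans (by linarith [hT1.hi])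
    have h2 : ePoi k2 z2 ≤ C1 + k2 := (DicoreCount.ePoi_le hk2 hz2).trans (by linarith [hT2.hi])
    have h3 := DicoreCount.ePoi_pos k1 hz1
    have h4 := DicoreCount.ePoi_pos k2 hz2
    have h5 : 1 / 2 * ePoi k1 z1 * ePoi k2 z2 ≤ 1 / 2 * (C1 + k1) * (C1 + k2) := by
      have h6 : 0 ≤ 1 / 2 * (C1 + k1) := by linarith
      gcongr
    linarith
  have hs1 : 0 < Real.sqrt (2 * Real.pi * N * vPoi k1 z1) := by
    have := DicoreCount.vPoi_pos hk1 hz1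
    have := Real.pi_pos
    positivity
  have hs2 : 0 < Real.sqrt (2 * Real.pi * N * vPoi k2 z2) := by
    have := DicoreCount.vPoi_pos hk2 hz2
    have := Real.pi_pos
    positivity
  obtain ⟨r1, hr1⟩ : ∃ r : ℝ, r = Real.sqrt (2 * Real.pi * N * vPoi k1 z1) := ⟨_, rfl⟩
  obtain ⟨r2, hr2⟩ : ∃ r : ℝ, r = Real.sqrt (2 * Real.pi * N * vPoi k2 z2) := ⟨_, rfl⟩
  obtain ⟨q1, hq1⟩ : ∃ q : ℝ, q = DicoreCount.hitProb k1 z1 N M := ⟨_, rfl⟩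
  obtain ⟨q2, hq2⟩ : ∃ q : ℝ, q = DicoreCount.hitProb k2 z2 N M := ⟨_, rfl⟩
  have hf1 := DicoreCount.fk_pos k1 hz1
  have hf2 := DicoreCount.fk_pos k2 hz2
  rw [DicoreCount.normConst, DicoreCount.normConst] at hP
  rw [← he, ← hq1, ← hq2] at hP
  rw [← hq1, ← hr1] at hx1
  rw [← hq2, ← hr2] at hx2
  rw [← hr1] at hs1
  rw [← hr2] at hs2
  rw [← he, ← hr1, ← hr2]
  have hF : (0 : ℝ) < M.factorial := by positivity
  obtain ⟨F, hFd⟩ : ∃ F : ℝ, F = M.factorial := ⟨_, rfl⟩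
  obtain ⟨f1, hf1d⟩ : ∃ f : ℝ, f = fk k1 z1 ^ N := ⟨_, rfl⟩
  obtain ⟨f2, hf2d⟩ : ∃ f : ℝ, f = fk k2 z2 ^ N := ⟨_, rfl⟩
  obtain ⟨y1, hy1d⟩ : ∃ y : ℝ, y = z1 ^ M := ⟨_, rfl⟩
  obtain ⟨y2, hy2d⟩ : ∃ y : ℝ, y = z2 ^ M := ⟨_, rfl⟩
  have hf1p : 0 < f1 := by rw [hf1d]; positivity
  have hf2p : 0 < f2 := by rw [hf2d]; positivity
  have hy1p : 0 < y1 := by rw [hy1d]; positivity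
  have hy2p : 0 < y2 := by rw [hy2d]; positivity
  rw [← hFd, ← hf1d, ← hf2d, ← hy1d, ← hy2d] at hP ⊢
  rw [← hFd] at hF
  obtain ⟨η, hη⟩ : ∃ η : ℝ, η = Real.log N ^ 6 / N := ⟨_, rfl⟩
  have hη0 : 0 ≤ η := by rw [hη]; positivity
  have hNη : 1 / (N : ℝ) ≤ 1 / Real.log 2 ^ 6 * η := by
    rw [hη, ← mul_div_assoc]; exact DicoreCount.inv_le_log_pow_div hN
  obtain ⟨m, hmd⟩ : ∃ m : ℝ, m = F * F * (f1 / (y1 * r1)) * (f2 / (y2 * r2)) := ⟨_, rfl⟩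
  have hm0 : 0 < m := by rw [hmd]; positivity
  have hn : F * f2 / y2 * q2 * (F * f1 / y1 * q1) = m * (q1 * r1 * (q2 * r2)) := by
    rw [hmd]; field_simp
  rw [hn, mul_div_assoc, ← hη] at hP
  have hxy : |q1 * r1 * (q2 * r2) - 1| ≤ B * (1 / N) := by
    rw [hB]
    refine DicoreCount.abs_mul_sub_one_le ?_ ?_ ?_ hB1.le (by positivity)
    · rwa [mul_one_div]
    · rwa [mul_one_div]
    · rw [div_le_one hNp]; exact_mod_cast (by omega : 1 ≤ N)
  obtain ⟨x, hx⟩ : ∃ x : ℝ, x = q1 * r1 * (q2 * r2) := ⟨_, rfl⟩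
  rw [← hx] at hP hxy
  have hN1 : 1 / (N : ℝ) ≤ 1 := by
    rw [div_le_one hNp]; exact_mod_cast (by omega : 1 ≤ N)
  have hxle : x ≤ 1 + B := by
    have h1 := (abs_le.1 hxy).2
    have h2 := mul_le_mul_of_nonneg_left hN1 hB0.le
    linarith
  have hratio : X / (e * F * (f1 / (y1 * r1)) * (f2 / (y2 * r2))) - 1 =
      (X * F - e * (m * x)) / (e * m) + (x - 1) := by
    rw [show e * m = F * (e * F * (f1 / (y1 * r1)) * (f2 / (y2 * r2))) by rw [hmd]; ring]
    have hd : e * F * (f1 / (y1 * r1)) * (f2 / (y2 * r2)) ≠ 0 := by positivity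
    rw [sub_div, show e * (m * x) = (F * (e * F * (f1 / (y1 * r1)) * (f2 / (y2 * r2)))) * x by
      rw [hmd]; ring, mul_div_cancel_left₀ _ (mul_ne_zero hF.ne' hd), mul_comm X F,
      mul_div_mul_left _ _ hF.ne']
    ring
  rw [hratio, mul_div_assoc, ← hη]
  calc |(X * F - e * (m * x)) / (e * m) + (x - 1)|
      ≤ |X * F - e * (m * x)| / (e * m) + |x - 1| := by
        refine (abs_add_le _ _).trans (le_of_eq ?_)
        rw [abs_div, abs_of_pos (mul_pos he0 hm0)]
    _ ≤ A * η * (m * x) / (e * m) + B * (1 / N) := by gcongr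
    _ = A * η * x / e + B * (1 / N) := by
        congr 1; field_simp
    _ ≤ G * (A * η * (1 + B)) + B * (1 / Real.log 2 ^ 6 * η) := by
        refine add_le_add ?_ (mul_le_mul_of_nonneg_left hNη hB0.le)
        rw [div_le_iff₀ he0]
        have h1 : A * η * x ≤ A * η * (1 + B) := by gcongr
        have h2 : 0 ≤ A * η * (1 + B) := by positivity
        calc A * η * x ≤ 1 * (A * η * (1 + B)) := by rw [one_mul]; exact h1
          _ ≤ G * e * (A * η * (1 + B)) := mul_le_mul_of_nonneg_right heG h2
          _ = _ := by ring
    _ = _ := by ring
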